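/- Let γ ∈ (0,1), let f belong to C(M,p,ν_γ) for some M > 0 and some p > 2, and let q satisfy 2 ≤ q < p. (1) If γ < 2(p−q)/(2(p−q)+pq), then ‖S_n(f − ν_γ(f))‖_{L^q(ν_γ)} = O(√n). (2) If 2(p−q)/(2(p−q)+pq) ≤ γ < 1, then for any ε > 0, ‖S_n(f − ν_γ(f))‖_{L^q(ν_γ)} = O( n^{1+ε−(1−γ)(p−q)/(γ p q)} ). -/

import Mathlib

open MeasureTheory ProbabilityTheory Filter Set
open scoped ENNReal NNReal Topology

noncomputable section

/-- The intermittent (Liverani–Saussol–Vaienti) map `T_γ` on `[0,1]`. -/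
def Tmap (γ : ℝ) (x : ℝ) : ℝ :=
  if x < 1/2 then x * (1 + 2 ^ γ * x ^ γ) else 2 * x - 1

/-- `K` is the Perron–Frobenius operator of `T_γ` with respect to `ν`:
`ν(f · g∘T_γ) = ν(K f · g)` for all bounded measurable `f, g`. -/
def IsPFOp (γ : ℝ) (ν : Measure ℝ) (K : (ℝ → ℝ) → ℝ → ℝ) : Prop :=
  ∀ f g : ℝ → ℝ, Measurable f → Measurable g → (∃ C, ∀ x, |f x| ≤ C) →
    (∃ C, ∀ x, |g x| ≤ C) →
    ∫ x, f x * g (Tmap γ x) ∂ν = ∫ x, (K f) x * g x ∂ν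

/-- Birkhoff sums `S_n(f) = ∑_{i=1}^n f ∘ T_γ^i`. -/
def Sn (γ : ℝ) (f : ℝ → ℝ) (n : ℕ) (x : ℝ) : ℝ :=
  ∑ i ∈ Finset.range n, f ((Tmap γ)^[i + 1] x)

/-- The class `H_{α,1}` of `α`-Hölder functions (with constant 1) on `[0,1]`. -/
def Hclass (α : ℝ) : Set (ℝ → ℝ) :=
  {f | ∀ x ∈ Set.Icc (0:ℝ) 1, ∀ y ∈ Set.Icc (0:ℝ) 1, |f x - f y| ≤ |x - y| ^ α}

/-- `f_t = 1_{(-∞, t]}`. -/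
def indic (t : ℝ) : ℝ → ℝ := Set.indicator (Set.Iic t) (fun _ => 1)

/-- Nested operator `K^{(n_1,…,n_k)}(f_1,…,f_k)
= K^{n_1}(f_1 · K^{n_2}(f_2 ⋯ K^{n_k}(f_k)⋯))`, encoded by a list of pairs. -/
def nestedK (K : (ℝ → ℝ) → ℝ → ℝ) : List (ℕ × (ℝ → ℝ)) → ℝ → ℝ
  | [] => fun _ => 1
  | (n, f) :: r => K^[n] (fun x => f x * nestedK K r x)

/-- The list `[(n, f_{t_1}), (n_2, f_{t_2}), …, (n_l, f_{t_l})]`. -/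
def tList (n : ℕ) {l : ℕ} (ns : Fin l → ℕ) (ts : Fin (l + 1) → ℝ) :
    List (ℕ × (ℝ → ℝ)) :=
  (n, indic (ts 0)) :: List.ofFn (fun i : Fin l => (ns i, indic (ts i.succ)))

/-- The coefficient `α_1(n)` for an operator `K` with invariant measure `ν`. -/
def alpha1 (K : (ℝ → ℝ) → ℝ → ℝ) (ν : Measure ℝ) (n : ℕ) : ℝ :=
  ⨆ t : ℝ, ∫ x, |K^[n] (indic t) x - ∫ y, indic t y ∂ν| ∂ν

/-- The dependence coefficient `α_k(n)`. -/
def alphaCoef (K : (ℝ → ℝ) → ℝ → ℝ) (ν : Measure ℝ) (k n : ℕ) : ℝ :=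
  max (alpha1 K ν n)
    (⨆ j : Fin (k - 1), ⨆ ns : {m : Fin (j.1 + 1) → ℕ // ∀ i, 1 ≤ m i},
      ⨆ ts : Fin (j.1 + 2) → ℝ,
        ∫ x, |nestedK K (tList n ns.1 ts) x - ∫ y, nestedK K (tList n ns.1 ts) y ∂ν| ∂ν)

/-- The dependence coefficient `β_1(n)`. -/
def beta1 (K : (ℝ → ℝ) → ℝ → ℝ) (ν : Measure ℝ) (n : ℕ) : ℝ :=
  ∫ x, (⨆ t : ℝ, |K^[n] (indic t) x - ∫ y, indic t y ∂ν|) ∂ν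

/-- The dependence coefficient `β_k(n)`. -/
def betaCoef (K : (ℝ → ℝ) → ℝ → ℝ) (ν : Measure ℝ) (k n : ℕ) : ℝ :=
  max (beta1 K ν n)
    (⨆ j : Fin (k - 1), ⨆ ns : {m : Fin (j.1 + 1) → ℕ // ∀ i, 1 ≤ m i},
      ∫ x, (⨆ ts : Fin (j.1 + 2) → ℝ,
        |nestedK K (tList n ns.1 ts) x - ∫ y, nestedK K (tList n ns.1 ts) y ∂ν|) ∂ν)

/-- The operator associated with a Markov transition kernel: `(Kg)(x) = ∫ g(y) K(x,dy)`. -/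
def Kop (K : Kernel ℝ ℝ) (g : ℝ → ℝ) : ℝ → ℝ := fun x => ∫ y, g y ∂(K x)

/-- The class `Mon(M,p,μ)` of monotonic functions on an open interval, vanishing
elsewhere, with tail condition `μ(|g|>t) ≤ M^p t^{-p}` (for `p < ∞`),
resp. `μ(|g|>M) = 0` (for `p = ∞`). -/
def Mon (M : ℝ) (p : ℝ≥0∞) (μ : Measure ℝ) (g : ℝ → ℝ) : Prop :=
  (∃ I : Set ℝ, IsOpen I ∧ I.OrdConnected ∧ (MonotoneOn g I ∨ AntitoneOn g I) ∧
      ∀ x ∉ I, g x = 0) ∧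
  (if p = ∞ then μ {x | M < |g x|} = 0
   else ∀ t : ℝ, 0 < t →
      μ {x | t < |g x|} ≤ ENNReal.ofReal (M ^ p.toReal * t ^ (-p.toReal)))

/-- The class `C(M,p,μ)`: the closure in `L¹(μ)` of convex-type combinations
`∑ a_i g_i`, `∑ |a_i| ≤ 1`, `g_i ∈ Mon(M,p,μ)`. -/
def ClassC (M : ℝ) (p : ℝ≥0∞) (μ : Measure ℝ) (f : ℝ → ℝ) : Prop :=
  Integrable f μ ∧ ∀ ε : ℝ, 0 < ε → ∃ (n : ℕ) (a : Fin n → ℝ) (g : Fin n → ℝ → ℝ),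
    (∑ i, |a i|) ≤ 1 ∧ (∀ i, Mon M p μ (g i)) ∧
    ∫ x, |f x - ∑ i, a i * g i x| ∂μ < ε

/-- The class `Lip_c` of functions `g` with `|g(x) − g(y)| ≤ c(|x−y|)`. -/
def LipC (c : ℝ → ℝ) : Set (ℝ → ℝ) := {g | ∀ x y : ℝ, |g x - g y| ≤ c |x - y|}

/-- The distance `d_c(P,Q) = sup_{g ∈ Lip_c} |P(g) − Q(g)|`. -/
def dC (c : ℝ → ℝ) (P Q : Measure ℝ) : ℝ :=
  ⨆ g : LipC c, |(∫ x, (g : ℝ → ℝ) x ∂P) - ∫ x, (g : ℝ → ℝ) x ∂Q|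

/-! ### The left branch and its inverse -/

/-- The left branch `y ↦ y (1 + 2^γ y^γ)` of `T_γ`. -/
def leftBranch (γ y : ℝ) : ℝ := y * (1 + 2 ^ γ * y ^ γ)

/-- The derivative of the left branch. -/
def leftSlope (γ y : ℝ) : ℝ := 1 + (1 + γ) * (2 ^ γ * y ^ γ)

/-- The inverse of the left branch on `(0,1)`. -/
def leftInv (γ x : ℝ) : ℝ := Function.invFunOn (leftBranch γ) (Ioo 0 (1/2)) x

lemma Tmap_eq_leftBranch {γ y : ℝ} (hy : y < 1/2) : Tmap γ y = leftBranch γ y := by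
  rw [Tmap, if_pos hy, leftBranch]

lemma Tmap_eq_right {γ y : ℝ} (hy : 1/2 ≤ y) : Tmap γ y = 2 * y - 1 := by
  rw [Tmap, if_neg (not_lt.mpr hy)]

lemma measurable_Tmap (γ : ℝ) : Measurable (Tmap γ) := by
  unfold Tmap
  refine Measurable.ite measurableSet_Iio ?_ ?_ <;> fun_prop

lemma rpow_scale_mem {γ y : ℝ} (hγ : 0 < γ) (hy : y ∈ Ioo (0:ℝ) (1/2)) :
    2 ^ γ * y ^ γ ∈ Ioo (0:ℝ) 1 := by
  have h0 : 0 < y := hy.1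
  rw [← Real.mul_rpow (by norm_num) h0.le]
  exact ⟨by positivity, Real.rpow_lt_one (by positivity) (by linarith [hy.2]) hγ⟩

lemma leftSlope_pos {γ y : ℝ} (hγ : 0 < γ) (hy : 0 ≤ y) : 1 ≤ leftSlope γ y := by
  have : 0 ≤ (1 + γ) * (2 ^ γ * y ^ γ) := by positivity
  unfold leftSlope; linarith

lemma leftSlope_mono {γ y z : ℝ} (hγ : 0 < γ) (hy : 0 ≤ y) (hyz : y ≤ z) :
    leftSlope γ y ≤ leftSlope γ z := by
  unfold leftSlope
  have := Real.rpow_le_rpow hy hyz hγ.le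
  gcongr

lemma leftSlope_le {γ y : ℝ} (hγ : γ ∈ Ioo (0:ℝ) 1) (hy : y ∈ Ioo (0:ℝ) (1/2)) :
    leftSlope γ y ≤ 3 := by
  have h := rpow_scale_mem hγ.1 hy
  unfold leftSlope
  nlinarith [hγ.1, hγ.2, h.1, h.2]

lemma hasDerivAt_leftBranch {γ y : ℝ} (hy : 0 < y) :
    HasDerivAt (leftBranch γ) (leftSlope γ y) y := by
  have h1 : HasDerivAt (fun y : ℝ => y ^ γ) (γ * y ^ (γ - 1)) y :=
    Real.hasDerivAt_rpow_const (Or.inl hy.ne')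
  have h2 := (hasDerivAt_id y).mul ((h1.const_mul (2 ^ γ)).const_add 1)
  refine h2.congr_deriv ?_
  have : y * y ^ (γ - 1) = y ^ γ := by
    rw [Real.rpow_sub_one hy.ne']; field_simp
  simp only [id, leftSlope]
  linear_combination (2 ^ γ * γ) * this

lemma leftBranch_strictMonoOn {γ : ℝ} (hγ : 0 < γ) : StrictMonoOn (leftBranch γ) (Ici 0) := by
  intro y hy z hz hyz
  have h := Real.rpow_le_rpow hy hyz.le hγ.le
  have hz0 : (0:ℝ) < z := lt_of_le_of_lt hy hyz
  unfold leftBranch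
  have : (0:ℝ) < 2 ^ γ * z ^ γ := by positivity
  have h3 : (2:ℝ) ^ γ * y ^ γ ≤ 2 ^ γ * z ^ γ := by gcongr
  have hy' : (0:ℝ) ≤ y := hy
  nlinarith

lemma leftBranch_image {γ : ℝ} (hγ : 0 < γ) : leftBranch γ '' Ioo 0 (1/2) = Ioo 0 1 := by
  have h0 : leftBranch γ 0 = 0 := by simp [leftBranch]
  have h1 : leftBranch γ (1/2) = 1 := by
    unfold leftBranch
    rw [← Real.mul_rpow (by norm_num) (by norm_num)]
    norm_num
  have hc : ContinuousOn (leftBranch γ) (Icc 0 (1/2)) := by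
    unfold leftBranch
    have : Continuous fun y : ℝ => y ^ γ := Real.continuous_rpow_const hγ.le
    fun_prop
  apply Subset.antisymm
  · rintro _ ⟨y, hy, rfl⟩
    have hm := leftBranch_strictMonoOn hγ
    have a := hm (mem_Ici.2 le_rfl) (mem_Ici.2 hy.1.le) hy.1
    have b := hm (mem_Ici.2 hy.1.le) (mem_Ici.2 (by norm_num)) hy.2
    rw [h0] at a; rw [h1] at b
    exact ⟨a, b⟩
  · have := intermediate_value_Ioo (by norm_num : (0:ℝ) ≤ 1/2) hc
    rwa [h0, h1] at this

lemma leftInv_mem {γ x : ℝ} (hγ : 0 < γ) (hx : x ∈ Ioo (0:ℝ) 1) :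
    leftInv γ x ∈ Ioo (0:ℝ) (1/2) := by
  rw [← leftBranch_image hγ] at hx
  exact Function.invFunOn_mem hx

lemma leftBranch_leftInv {γ x : ℝ} (hγ : 0 < γ) (hx : x ∈ Ioo (0:ℝ) 1) :
    leftBranch γ (leftInv γ x) = x := by
  rw [← leftBranch_image hγ] at hx
  exact Function.invFunOn_eq hx

lemma leftInv_leftBranch {γ y : ℝ} (hγ : 0 < γ) (hy : y ∈ Ioo (0:ℝ) (1/2)) :
    leftInv γ (leftBranch γ y) = y := by
  have hx : leftBranch γ y ∈ Ioo (0:ℝ) 1 := by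
    rw [← leftBranch_image hγ]; exact mem_image_of_mem _ hy
  exact (leftBranch_strictMonoOn hγ).injOn (leftInv_mem hγ hx).1.le hy.1.le
    (leftBranch_leftInv hγ hx)

lemma leftInv_mono {γ x z : ℝ} (hγ : 0 < γ) (hx : x ∈ Ioo (0:ℝ) 1) (hz : z ∈ Ioo (0:ℝ) 1)
    (hxz : x ≤ z) : leftInv γ x ≤ leftInv γ z := by
  rw [← (leftBranch_strictMonoOn hγ).le_iff_le (leftInv_mem hγ hx).1.le (leftInv_mem hγ hz).1.le,
    leftBranch_leftInv hγ hx, leftBranch_leftInv hγ hz]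
  exact hxz

/-! ### The transfer operator -/

/-- The transfer operator of `T_γ` with respect to Lebesgue measure on `(0,1)`. -/
def transfer (γ : ℝ) (f : ℝ → ℝ) (x : ℝ) : ℝ :=
  f (leftInv γ x) / leftSlope γ (leftInv γ x) + f ((1 + x) / 2) / 2

lemma half_add_mem {x : ℝ} (hx : x ∈ Ioo (0:ℝ) 1) : (1 + x) / 2 ∈ Ioo (0:ℝ) 1 :=
  ⟨by linarith [hx.1], by linarith [hx.2]⟩

lemma leftInv_mem_unit {γ x : ℝ} (hγ : 0 < γ) (hx : x ∈ Ioo (0:ℝ) 1) :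
    leftInv γ x ∈ Ioo (0:ℝ) 1 :=
  Ioo_subset_Ioo_right (by norm_num) (leftInv_mem hγ hx)

lemma transfer_nonneg {γ : ℝ} (hγ : 0 < γ) {f : ℝ → ℝ} (hf : ∀ x ∈ Ioo (0:ℝ) 1, 0 ≤ f x) :
    ∀ x ∈ Ioo (0:ℝ) 1, 0 ≤ transfer γ f x := by
  intro x hx
  have h1 := hf _ (leftInv_mem_unit hγ hx)
  have h2 := hf _ (half_add_mem hx)
  have h3 := leftSlope_pos hγ (leftInv_mem hγ hx).1.le
  unfold transfer
  positivity

lemma transfer_antitoneOn {γ : ℝ} (hγ : 0 < γ) {f : ℝ → ℝ} (hf : ∀ x ∈ Ioo (0:ℝ) 1, 0 ≤ f x)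
    (hfa : AntitoneOn f (Ioo 0 1)) : AntitoneOn (transfer γ f) (Ioo 0 1) := by
  intro x hx z hz hxz
  have hm := leftInv_mono hγ hx hz hxz
  have h1 := hfa (leftInv_mem_unit hγ hx) (leftInv_mem_unit hγ hz) hm
  have h2 := hfa (half_add_mem hx) (half_add_mem hz) (by linarith)
  have h3 := leftSlope_pos hγ (leftInv_mem hγ hx).1.le
  have h4 := leftSlope_mono hγ (leftInv_mem hγ hx).1.le hm
  have h5 := hf _ (leftInv_mem_unit hγ hx)
  unfold transfer
  gcongr

lemma Ioo_split_ae : (Ioo (0:ℝ) 1) =ᵐ[volume] (Ioo (0:ℝ) (1/2) ∪ Ioo (1/2) 1 : Set ℝ) := by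
  have h : Ioo (0:ℝ) (1/2) ∪ Ioo (1/2) 1 = Ioo (0:ℝ) 1 \ {1/2} := by
    ext x
    simp only [mem_union, mem_Ioo, Set.mem_sdiff, mem_singleton_iff]
    constructor
    · rintro (h | h)
      · exact ⟨⟨h.1, by linarith [h.2]⟩, h.2.ne⟩
      · exact ⟨⟨by linarith [h.1], h.2⟩, h.1.ne'⟩
    · rintro ⟨h, h'⟩
      rcases lt_or_gt_of_ne h' with h1 | h1
      · exact Or.inl ⟨h.1, h1⟩
      · exact Or.inr ⟨h1, h.2⟩
  rw [h]
  exact (sdiff_null_ae_eq_self (by simp)).symm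

lemma half_image : (fun y : ℝ => 2 * y - 1) '' Ioo (1/2) 1 = Ioo 0 1 := by
  ext x
  constructor
  · rintro ⟨y, hy, rfl⟩
    exact ⟨by simp only; linarith [hy.1], by simp only; linarith [hy.2]⟩
  · intro hx
    exact ⟨(1 + x) / 2, ⟨by linarith [hx.1], by linarith [hx.2]⟩, by simp only; ring⟩

/-- The transfer operator is the dual of composition with `T_γ`. -/
lemma transfer_integral_one_step {γ : ℝ} (hγ : 0 < γ) {f Y : ℝ → ℝ}
    (hf : IntegrableOn (fun x => f x * Y (Tmap γ x)) (Ioo 0 1)) :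
    IntegrableOn (fun x => transfer γ f x * Y x) (Ioo 0 1) ∧
    ∫ x in Ioo 0 1, transfer γ f x * Y x = ∫ x in Ioo 0 1, f x * Y (Tmap γ x) := by
  set FL : ℝ → ℝ := fun x => f (leftInv γ x) / leftSlope γ (leftInv γ x) * Y x
  set FR : ℝ → ℝ := fun x => f ((1 + x) / 2) / 2 * Y x
  have hF : (fun x => transfer γ f x * Y x) = fun x => FL x + FR x := by
    ext x; simp only [transfer, FL, FR]; ring
  have hIL : IntegrableOn (fun x => f x * Y (Tmap γ x)) (Ioo 0 (1/2)) :=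
    hf.mono_set (Ioo_subset_Ioo_right (by norm_num))
  have hIR : IntegrableOn (fun x => f x * Y (Tmap γ x)) (Ioo (1/2) 1) :=
    hf.mono_set (Ioo_subset_Ioo_left (by norm_num))
  have dL : ∀ x ∈ Ioo (0:ℝ) (1/2),
      HasDerivWithinAt (leftBranch γ) (leftSlope γ x) (Ioo 0 (1/2)) x :=
    fun x hx => (hasDerivAt_leftBranch hx.1).hasDerivWithinAt
  have iL : InjOn (leftBranch γ) (Ioo 0 (1/2)) :=
    (leftBranch_strictMonoOn hγ).injOn.mono fun x hx => hx.1.le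
  have dR : ∀ x ∈ Ioo (1/2:ℝ) 1,
      HasDerivWithinAt (fun y : ℝ => 2 * y - 1) 2 (Ioo (1/2) 1) x := fun x _ => by
    have := ((hasDerivAt_id x).const_mul 2).sub_const 1
    simpa using this.hasDerivWithinAt
  have iR : InjOn (fun y : ℝ => 2 * y - 1) (Ioo (1/2) 1) := fun a _ b _ h => by
    simp only at h; linarith
  have eL : EqOn (fun x => |leftSlope γ x| • FL (leftBranch γ x))
      (fun x => f x * Y (Tmap γ x)) (Ioo 0 (1/2)) := fun x hx => by
    have hp : 0 < leftSlope γ x := lt_of_lt_of_le one_pos (leftSlope_pos hγ hx.1.le)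
    simp only [FL, leftInv_leftBranch hγ hx, Tmap_eq_leftBranch hx.2, smul_eq_mul, abs_of_pos hp]
    field_simp
  have eR : EqOn (fun x => |(2:ℝ)| • FR (2 * x - 1))
      (fun x => f x * Y (Tmap γ x)) (Ioo (1/2) 1) := fun x hx => by
    have : (1 + (2 * x - 1)) / 2 = x := by ring
    simp only [FR, this, Tmap_eq_right hx.1.le, smul_eq_mul, abs_two]
    ring
  have jL : IntegrableOn FL (Ioo 0 1) := by
    rw [← leftBranch_image hγ,
      integrableOn_image_iff_integrableOn_abs_deriv_smul measurableSet_Ioo dL iL]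
    exact (integrableOn_congr_fun eL measurableSet_Ioo).2 hIL
  have jR : IntegrableOn FR (Ioo 0 1) := by
    rw [← half_image,
      integrableOn_image_iff_integrableOn_abs_deriv_smul measurableSet_Ioo dR iR]
    exact (integrableOn_congr_fun eR measurableSet_Ioo).2 hIR
  rw [hF]
  refine ⟨jL.add jR, ?_⟩
  rw [integral_add jL jR]
  have kL : ∫ x in Ioo 0 1, FL x = ∫ x in Ioo 0 (1/2), f x * Y (Tmap γ x) := by
    rw [← leftBranch_image hγ,
      integral_image_eq_integral_abs_deriv_smul measurableSet_Ioo dL iL]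
    exact setIntegral_congr_fun measurableSet_Ioo eL
  have kR : ∫ x in Ioo 0 1, FR x = ∫ x in Ioo (1/2) 1, f x * Y (Tmap γ x) := by
    rw [← half_image,
      integral_image_eq_integral_abs_deriv_smul measurableSet_Ioo dR iR]
    exact setIntegral_congr_fun measurableSet_Ioo eR
  rw [kL, kR, setIntegral_congr_set Ioo_split_ae, setIntegral_union _ measurableSet_Ioo hIL hIR]
  exact Set.disjoint_left.2 fun x h1 h2 => (lt_asymm h1.2 h2.1).elim

lemma integrableOn_mul_bounded {f Y : ℝ → ℝ} {s : Set ℝ} {c : ℝ} (hf : IntegrableOn f s)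
    (hY : Measurable Y) (hb : ∀ x, |Y x| ≤ c) : IntegrableOn (fun x => f x * Y x) s :=
  hf.mul_bdd hY.aestronglyMeasurable (Eventually.of_forall fun x => hb x)

lemma integrableOn_transfer {γ : ℝ} (hγ : 0 < γ) {f : ℝ → ℝ} (hf : IntegrableOn f (Ioo 0 1)) :
    IntegrableOn (transfer γ f) (Ioo 0 1) := by
  have := (transfer_integral_one_step (Y := fun _ => 1) hγ (by simpa using hf)).1
  simpa using this

lemma integrableOn_transfer_iterate {γ : ℝ} (hγ : 0 < γ) {f : ℝ → ℝ}
    (hf : IntegrableOn f (Ioo 0 1)) (n : ℕ) :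
    IntegrableOn ((transfer γ)^[n] f) (Ioo 0 1) := by
  induction n with
  | zero => exact hf
  | succ n ih => rw [Function.iterate_succ_apply']; exact integrableOn_transfer hγ ih

lemma measurable_Tmap_iterate (γ : ℝ) (n : ℕ) : Measurable ((Tmap γ)^[n]) :=
  (measurable_Tmap γ).iterate n

lemma integral_transfer_iterate {γ : ℝ} (hγ : 0 < γ) {f : ℝ → ℝ}
    (hf : IntegrableOn f (Ioo 0 1)) {c : ℝ} {Y : ℝ → ℝ} (hY : Measurable Y)
    (hb : ∀ x, |Y x| ≤ c) (n : ℕ) :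
    ∫ x in Ioo 0 1, (transfer γ)^[n] f x * Y x
      = ∫ x in Ioo 0 1, f x * Y ((Tmap γ)^[n] x) := by
  induction n generalizing Y with
  | zero => rfl
  | succ n ih =>
    rw [Function.iterate_succ_apply']
    have hY' : Measurable fun x => Y (Tmap γ x) := hY.comp (measurable_Tmap γ)
    rw [(transfer_integral_one_step hγ
      (integrableOn_mul_bounded (integrableOn_transfer_iterate hγ hf n) hY' fun x => hb _)).2,
      ih hY' fun x => hb _]
    simp only [Function.iterate_succ_apply']

lemma integral_transfer_iterate_one {γ : ℝ} (hγ : 0 < γ) {f : ℝ → ℝ}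
    (hf : IntegrableOn f (Ioo 0 1)) (n : ℕ) :
    ∫ x in Ioo 0 1, (transfer γ)^[n] f x = ∫ x in Ioo 0 1, f x := by
  have := integral_transfer_iterate hγ hf (Y := fun _ => 1) (c := 1) measurable_const (by simp) n
  simpa using this

/-! ### Decreasing densities -/

/-- `f` is a nonnegative nonincreasing function on `(0,1)` with integral `m`. -/
structure DecDensity (m : ℝ) (f : ℝ → ℝ) : Prop where
  anti : AntitoneOn f (Ioo 0 1)
  nonneg : ∀ x ∈ Ioo (0:ℝ) 1, 0 ≤ f x
  integrableOn : IntegrableOn f (Ioo 0 1)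
  mass : ∫ x in Ioo 0 1, f x = m

lemma DecDensity.mass_nonneg {m : ℝ} {f : ℝ → ℝ} (hf : DecDensity m f) : 0 ≤ m := by
  rw [← hf.mass]; exact setIntegral_nonneg measurableSet_Ioo hf.nonneg

lemma DecDensity.transfer {γ : ℝ} (hγ : 0 < γ) {m : ℝ} {f : ℝ → ℝ} (hf : DecDensity m f) :
    DecDensity m (transfer γ f) where
  anti := transfer_antitoneOn hγ hf.nonneg hf.anti
  nonneg := transfer_nonneg hγ hf.nonneg
  integrableOn := integrableOn_transfer hγ hf.integrableOn
  mass := by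
    have := integral_transfer_iterate_one hγ hf.integrableOn 1
    rw [Function.iterate_one] at this
    rw [this, hf.mass]

lemma DecDensity.transfer_iterate {γ : ℝ} (hγ : 0 < γ) {m : ℝ} {f : ℝ → ℝ} (hf : DecDensity m f)
    (n : ℕ) : DecDensity m ((_root_.transfer γ)^[n] f) := by
  induction n with
  | zero => exact hf
  | succ n ih => rw [Function.iterate_succ_apply']; exact ih.transfer hγ

lemma DecDensity.mul_le_mass {m : ℝ} {f : ℝ → ℝ} (hf : DecDensity m f) {x : ℝ}
    (hx : x ∈ Ioo (0:ℝ) 1) : x * f x ≤ m := by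
  have hs : Ioo (0:ℝ) x ⊆ Ioo 0 1 := Ioo_subset_Ioo_right hx.2.le
  calc x * f x = ∫ _ in Ioo (0:ℝ) x, f x := by
        simp [hx.1.le]
    _ ≤ ∫ y in Ioo (0:ℝ) x, f y := by
        refine setIntegral_mono_on (by simp) (hf.integrableOn.mono_set hs)
          measurableSet_Ioo fun y hy => hf.anti (hs hy) hx hy.2.le
    _ ≤ ∫ y in Ioo (0:ℝ) 1, f y :=
        setIntegral_mono_set hf.integrableOn
          ((ae_restrict_iff' measurableSet_Ioo).2 (Eventually.of_forall hf.nonneg))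
          hs.eventuallyLE
    _ = m := hf.mass

lemma leftInv_rpow_facts {γ x : ℝ} (hγ : γ ∈ Ioo (0:ℝ) 1) (hx : x ∈ Ioo (0:ℝ) 1) :
    ∃ u w s : ℝ, (leftInv γ x) ^ γ = u ∧ 2 ^ γ * u = w ∧ x ^ γ = u * s ∧ 0 < u ∧ u ≤ w ∧
      w ≤ 1 ∧ 1 ≤ s ∧ s ≤ 1 + γ * w ∧ u * s ≤ w ∧ leftSlope γ (leftInv γ x) = 1 + (1 + γ) * w := by
  have hy := leftInv_mem hγ.1 hx
  have hw := rpow_scale_mem hγ.1 hy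
  have hb := leftBranch_leftInv hγ.1 hx
  set y := leftInv γ x with hydef
  have hx' : x = y * (1 + 2 ^ γ * y ^ γ) := hb.symm
  refine ⟨y ^ γ, 2 ^ γ * y ^ γ, (1 + 2 ^ γ * y ^ γ) ^ γ, rfl, rfl, ?_,
    Real.rpow_pos_of_pos hy.1 _, ?_, hw.2.le, ?_, ?_, ?_, rfl⟩
  · conv_lhs => rw [hx']
    rw [Real.mul_rpow hy.1.le (by linarith [hw.1])]
  · have h1 : (1:ℝ) ≤ 2 ^ γ := Real.one_le_rpow (by norm_num) hγ.1.le
    have h2 : 0 < y ^ γ := Real.rpow_pos_of_pos hy.1 _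
    nlinarith
  · exact Real.one_le_rpow (by linarith [hw.1]) hγ.1.le
  · have := rpow_one_add_le_one_add_mul_self (s := 2 ^ γ * y ^ γ) (by linarith [hw.1])
      hγ.1.le hγ.2.le
    linarith
  · rw [← Real.mul_rpow hy.1.le (by linarith [hw.1]), ← hx', ← Real.mul_rpow (by norm_num) hy.1.le]
    refine Real.rpow_le_rpow hx.1.le ?_ hγ.1.le
    rw [hx']
    nlinarith [hy.1, hw.2]

/-- The key Lyapunov-type bound: an initial bound `l` is washed out at rate `1 / (j x^γ)`, and
`a b x^{-γ}` is a supersolution. -/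
lemma DecDensity.transfer_bound {γ : ℝ} (hγ : γ ∈ Ioo (0:ℝ) 1) {m : ℝ} {f : ℝ → ℝ}
    (hf : DecDensity m f) {a b l : ℝ} {j : ℕ} (ha : 3 ≤ a) (hb : m ≤ b) (hl : 0 ≤ l)
    (hfb : ∀ x ∈ Ioo (0:ℝ) 1, f x ≤ l / (1 + j * x ^ γ / 2) + a * b / x ^ γ) :
    ∀ x ∈ Ioo (0:ℝ) 1,
      _root_.transfer γ f x ≤ l / (1 + (j + 1 : ℕ) * x ^ γ / 2) + a * b / x ^ γ := by
  intro x hx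
  obtain ⟨u, w, s, hu, hw, hxs, hu0, huw, hw1, hs1, hsw, husw, hD⟩ := leftInv_rpow_facts hγ hx
  have h1 := hfb _ (leftInv_mem_unit hγ.1 hx)
  have hm0 := hf.mass_nonneg
  have hb0 : 0 ≤ b := hm0.trans hb
  have h2 : f ((1 + x) / 2) / 2 ≤ b := by
    have h3 := hf.mul_le_mass (half_add_mem hx)
    have h4 := hf.nonneg _ (half_add_mem hx)
    nlinarith [hx.1]
  unfold _root_.transfer
  rw [hD, hxs]
  rw [hu] at h1
  have hw0 : 0 < w := hu0.trans_le huw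
  have hγ0 := hγ.1
  have hγ1 := hγ.2
  have hDpos : 0 < 1 + (1 + γ) * w := by positivity
  have hs0 : 0 < s := by linarith
  have hj : (0:ℝ) ≤ j := Nat.cast_nonneg j
  have e1 : l / (1 + j * u / 2) / (1 + (1 + γ) * w) ≤ l / (1 + (j + 1 : ℕ) * (u * s) / 2) := by
    rw [div_div]
    apply div_le_div_of_nonneg_left hl (by positivity)
    push_cast
    have t1 : (j:ℝ) * u * s ≤ j * u * (1 + γ * w) := by gcongr
    have t2 : 0 ≤ (j:ℝ) * u * w := by positivity
    nlinarith
  have e2 : a * b / u / (1 + (1 + γ) * w) + b ≤ a * b / (u * s) := by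
    rw [div_div, div_add' _ _ _ (by positivity), div_le_div_iff₀ (by positivity) (by positivity)]
    have key : a * s + (u * s) * (1 + (1 + γ) * w) ≤ a * (1 + (1 + γ) * w) := by
      have t1 : a * s ≤ a * (1 + γ * w) := by gcongr
      have t2 : (u * s) * (1 + (1 + γ) * w) ≤ w * 3 := by
        apply mul_le_mul husw _ hDpos.le hw0.le
        nlinarith
      nlinarith
    have : 0 ≤ u * b := by positivity
    nlinarith [mul_le_mul_of_nonneg_left key this]
  have e3 : f (leftInv γ x) / (1 + (1 + γ) * w)
      ≤ (l / (1 + j * u / 2) + a * b / u) / (1 + (1 + γ) * w) := by gcongr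
  rw [add_div] at e3
  linarith

lemma DecDensity.transfer_iterate_bound {γ : ℝ} (hγ : γ ∈ Ioo (0:ℝ) 1) {m : ℝ} {f : ℝ → ℝ}
    (hf : DecDensity m f) {a b l : ℝ} (ha : 3 ≤ a) (hb : m ≤ b) (hl : 0 ≤ l)
    (hfb : ∀ x ∈ Ioo (0:ℝ) 1, f x ≤ l + a * b / x ^ γ) (n : ℕ) :
    ∀ x ∈ Ioo (0:ℝ) 1,
      (_root_.transfer γ)^[n] f x ≤ l / (1 + n * x ^ γ / 2) + a * b / x ^ γ := by
  induction n with
  | zero => simpa using hfb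
  | succ n ih =>
    rw [Function.iterate_succ_apply']
    exact (hf.transfer_iterate hγ.1 n).transfer_bound hγ ha hb hl ih

/-! ### Lower bounds -/

lemma integrableOn_inv_rpow {γ : ℝ} (hγ : γ ∈ Ioo (0:ℝ) 1) (d : ℝ) :
    IntegrableOn (fun x : ℝ => 1 / x ^ γ) (Ioo 0 d) := by
  have h := (intervalIntegral.intervalIntegrable_rpow' (a := 0) (b := d) (r := -γ)
    (by linarith [hγ.2])).1
  refine ((h.mono_set Ioo_subset_Ioc_self).congr_fun (fun x hx => ?_) measurableSet_Ioo)
  simp [Real.rpow_neg hx.1.le]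

lemma integral_inv_rpow {γ : ℝ} (hγ : γ ∈ Ioo (0:ℝ) 1) {d : ℝ} (hd : 0 ≤ d) :
    ∫ x in Ioo 0 d, 1 / x ^ γ = d ^ (1 - γ) / (1 - γ) := by
  have h := integral_rpow (a := 0) (b := d) (r := -γ) (Or.inl (by linarith [hγ.2]))
  rw [intervalIntegral.integral_of_le hd, ← integral_Ioc_eq_integral_Ioo.symm] at h
  have e : ∫ x in Ioo 0 d, 1 / x ^ γ = ∫ x in Ioo 0 d, x ^ (-γ) :=
    setIntegral_congr_fun measurableSet_Ioo fun x hx => by simp [Real.rpow_neg hx.1.le]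
  have h2 : -γ + 1 ≠ 0 := by linarith [hγ.2]
  rw [e, h, Real.zero_rpow h2, sub_zero, neg_add_eq_sub]

/-- A decreasing density of mass `m` bounded by `A m x^{-γ}` is at least `m/2` near zero. -/
lemma exists_lower_bound_near_zero {γ : ℝ} (hγ : γ ∈ Ioo (0:ℝ) 1) (A : ℝ) :
    ∃ d ∈ Ioo (0:ℝ) 1, ∀ (m : ℝ) (f : ℝ → ℝ), DecDensity m f →
      (∀ x ∈ Ioo (0:ℝ) 1, f x ≤ A * m / x ^ γ) → ∀ x ∈ Ioc (0:ℝ) d, m / 2 ≤ f x := by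
  have ht : Tendsto (fun d : ℝ => A * (d ^ (1 - γ) / (1 - γ))) (𝓝[>] 0) (𝓝 0) := by
    have h1 : ContinuousAt (fun d : ℝ => A * (d ^ (1 - γ) / (1 - γ))) 0 := by
      have : ContinuousAt (fun d : ℝ => d ^ (1 - γ)) 0 :=
        Real.continuousAt_rpow_const _ _ (Or.inr (by linarith [hγ.2]))
      fun_prop
    have h2 := h1.tendsto
    rw [Real.zero_rpow (by linarith [hγ.2])] at h2
    simp only [zero_div, mul_zero] at h2
    exact h2.mono_left nhdsWithin_le_nhds
  have h3 := (ht.eventually (gt_mem_nhds (by norm_num : (0:ℝ) < 1/2))).and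
    (Ioo_mem_nhdsGT (by norm_num : (0:ℝ) < 1))
  obtain ⟨d, hd, hd1⟩ := h3.exists
  refine ⟨d, hd1, fun m f hf hb x hx => ?_⟩
  have hx1 : x ∈ Ioo (0:ℝ) 1 := ⟨hx.1, hx.2.trans_lt hd1.2⟩
  refine le_trans ?_ (hf.anti hx1 hd1 hx.2)
  have hs : Ioo (0:ℝ) 1 = Ioo 0 d ∪ Ico d 1 := (Ioo_union_Ico_eq_Ioo hd1.1 hd1.2.le).symm
  have hdisj : Disjoint (Ioo (0:ℝ) d) (Ico d 1) :=
    Set.disjoint_left.2 fun y h1 h2 => absurd h1.2 (not_lt.2 h2.1)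
  have hm := hf.mass
  have hm0 := hf.mass_nonneg
  have hsub1 : Ioo (0:ℝ) d ⊆ Ioo 0 1 := Ioo_subset_Ioo_right hd1.2.le
  have hsub2 : Ico d 1 ⊆ Ioo (0:ℝ) 1 := Ico_subset_Ioo_left hd1.1
  rw [hs, setIntegral_union hdisj measurableSet_Ico (hf.integrableOn.mono_set hsub1)
    (hf.integrableOn.mono_set hsub2)] at hm
  have i1 : ∫ x in Ioo 0 d, f x ≤ m / 2 := by
    calc ∫ x in Ioo 0 d, f x ≤ ∫ x in Ioo 0 d, A * m * (1 / x ^ γ) := by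
          refine setIntegral_mono_on (hf.integrableOn.mono_set hsub1)
            ((integrableOn_inv_rpow hγ d).const_mul _) measurableSet_Ioo fun y hy => ?_
          have := hb y (hsub1 hy)
          rwa [mul_one_div]
      _ = A * (d ^ (1 - γ) / (1 - γ)) * m := by
          rw [integral_const_mul, integral_inv_rpow hγ hd1.1.le]; ring
      _ ≤ m / 2 := by nlinarith
  have i2 : ∫ x in Ico d 1, f x ≤ f d := by
    have hfd := hf.nonneg d hd1
    calc ∫ x in Ico d 1, f x ≤ ∫ x in Ico d 1, f d := by
          refine setIntegral_mono_on (hf.integrableOn.mono_set hsub2) (by simp)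
            measurableSet_Ico fun y hy => hf.anti hd1 (hsub2 hy) hy.1
      _ = (1 - d) * f d := by simp [hd1.2.le]
      _ ≤ f d := by nlinarith [hd1.1]
  linarith

lemma transfer_lower_bound {γ : ℝ} (hγ : γ ∈ Ioo (0:ℝ) 1) {d : ℝ} (hd : 0 < d) (k : ℕ)
    {f : ℝ → ℝ} {c : ℝ} (hf0 : ∀ x ∈ Ioo (0:ℝ) 1, 0 ≤ f x)
    (hf : ∀ x ∈ Ioo (0:ℝ) 1, x ≤ d → c ≤ f x) :
    ∀ x ∈ Ioo (0:ℝ) 1, x ≤ d * (1 + d ^ γ) ^ k → c / 3 ^ k ≤ (transfer γ)^[k] f x := by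
  have hf0k : ∀ k, ∀ x ∈ Ioo (0:ℝ) 1, 0 ≤ (transfer γ)^[k] f x := by
    intro k
    induction k with
    | zero => exact hf0
    | succ k ih => rw [Function.iterate_succ_apply']; exact transfer_nonneg hγ.1 ih
  have hd0 : 0 < d ^ γ := Real.rpow_pos_of_pos hd _
  induction k with
  | zero => simpa using hf
  | succ k ih =>
    intro x hx hxd
    rw [Function.iterate_succ_apply']
    have hy := leftInv_mem hγ.1 hx
    have hyu := leftInv_mem_unit hγ.1 hx
    have hS1 := leftSlope_pos hγ.1 hy.1.le
    have hS3 := leftSlope_le hγ hy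
    have hb := leftBranch_leftInv hγ.1 hx
    have hle : leftInv γ x ≤ d * (1 + d ^ γ) ^ k := by
      by_contra! hcon
      have hdy : d ≤ leftInv γ x := by
        refine le_trans ?_ hcon.le
        have : 1 ≤ (1 + d ^ γ) ^ k := one_le_pow₀ (by linarith)
        nlinarith
      have h1 := Real.rpow_le_rpow hd.le hdy hγ.1.le
      have h2 : (1:ℝ) ≤ 2 ^ γ := Real.one_le_rpow (by norm_num) hγ.1.le
      have h3 : d ^ γ ≤ 2 ^ γ * leftInv γ x ^ γ := by nlinarith
      have : d * (1 + d ^ γ) ^ (k + 1) < x := by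
        rw [← hb, leftBranch, pow_succ, ← mul_assoc]
        calc d * (1 + d ^ γ) ^ k * (1 + d ^ γ) < leftInv γ x * (1 + d ^ γ) := by gcongr
          _ ≤ _ := by have := hy.1; gcongr
      linarith
    have h1 := ih _ hyu hle
    have h2 := hf0k k _ (half_add_mem hx)
    have h3 := hf0k k _ hyu
    unfold transfer
    have h4 : (transfer γ)^[k] f (leftInv γ x) / 3
        ≤ (transfer γ)^[k] f (leftInv γ x) / leftSlope γ (leftInv γ x) := by gcongr
    have h5 : c / 3 ^ (k + 1) = c / 3 ^ k / 3 := by rw [pow_succ, div_div]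
    unfold transfer at h1 h2 h4
    rw [h5]
    linarith

/-- A uniform Doeblin-type minorization after a fixed number of steps. -/
lemma exists_minorization {γ : ℝ} (hγ : γ ∈ Ioo (0:ℝ) 1) (A : ℝ) :
    ∃ (N : ℕ) (c : ℝ), 0 < c ∧ c ≤ 1 / 4 ∧ ∀ (m : ℝ) (f : ℝ → ℝ), DecDensity m f →
      (∀ x ∈ Ioo (0:ℝ) 1, f x ≤ A * m / x ^ γ) →
      ∀ x ∈ Ioo (0:ℝ) 1, c * m ≤ (transfer γ)^[N] f x := by
  obtain ⟨d, hd, hlow⟩ := exists_lower_bound_near_zero hγ A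
  have hd0 : 0 < d ^ γ := Real.rpow_pos_of_pos hd.1 _
  have ht := (tendsto_pow_atTop_atTop_of_one_lt (by linarith : 1 < 1 + d ^ γ))
  obtain ⟨N, hN⟩ := (ht.eventually_ge_atTop (1 / d)).exists
  refine ⟨N + 1, 1 / 2 / 3 ^ (N + 1), by positivity, ?_, fun m f hf hb x hx => ?_⟩
  · rw [div_div]
    apply one_div_le_one_div_of_le (by norm_num)
    have : (1:ℝ) ≤ 3 ^ N := one_le_pow₀ (by norm_num)
    rw [pow_succ]; linarith
  · have := transfer_lower_bound hγ hd.1 (N + 1) (c := m / 2)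
      hf.nonneg (fun y hy hyd => hlow m f hf hb y ⟨hy.1, hyd⟩) x hx ?_
    · calc _ = m / 2 / 3 ^ (N + 1) := by ring
        _ ≤ _ := this
    · rw [div_le_iff₀ hd.1] at hN
      have h1 : (1 + d ^ γ) ^ N ≤ (1 + d ^ γ) ^ (N + 1) := by
        apply pow_le_pow_right₀ <;> linarith
      nlinarith [hx.2, hd.1]

/-! ### Coupling of decreasing densities -/

lemma abs_integral_mul_le {f Y : ℝ → ℝ} (hf : IntegrableOn f (Ioo 0 1))
    (hf0 : ∀ x ∈ Ioo (0:ℝ) 1, 0 ≤ f x) (hb : ∀ x, |Y x| ≤ 1) :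
    |∫ x in Ioo 0 1, f x * Y x| ≤ ∫ x in Ioo 0 1, f x := by
  refine norm_integral_le_of_norm_le (f := fun x => f x * Y x) hf ?_
  refine (ae_restrict_iff' measurableSet_Ioo).2 (Eventually.of_forall fun x hx => ?_)
  rw [Real.norm_eq_abs, abs_mul, abs_of_nonneg (hf0 x hx)]
  exact mul_le_of_le_one_right (hf0 x hx) (hb x)

lemma DecDensity.sub_const {m c : ℝ} {f : ℝ → ℝ} (hf : DecDensity m f)
    (hc : ∀ x ∈ Ioo (0:ℝ) 1, c ≤ f x) : DecDensity (m - c) (fun x => f x - c) where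
  anti := fun x hx y hy hxy => by have := hf.anti hx hy hxy; simp only; linarith
  nonneg := fun x hx => by linarith [hc x hx]
  integrableOn := hf.integrableOn.sub (by simp)
  mass := by
    rw [integral_sub hf.integrableOn (by simp), hf.mass]
    simp

lemma DecDensity.const_mul {m c : ℝ} {f : ℝ → ℝ} (hf : DecDensity m f) (hc : 0 ≤ c) :
    DecDensity (c * m) (fun x => c * f x) where
  anti := fun x hx y hy hxy => mul_le_mul_of_nonneg_left (hf.anti hx hy hxy) hc
  nonneg := fun x hx => mul_nonneg hc (hf.nonneg x hx)
  integrableOn := hf.integrableOn.const_mul c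
  mass := by rw [integral_const_mul, hf.mass]

/-- Truncating a decreasing density from above at the level `6 m δ^{-γ}`. -/
lemma DecDensity.truncate {γ : ℝ} (hγ : γ ∈ Ioo (0:ℝ) 1) {m m' δ : ℝ} {u : ℝ → ℝ}
    (hu : DecDensity m' u) (hm : 0 ≤ m) (hδ : δ ∈ Ioc (0:ℝ) 1)
    (hub : ∀ x ∈ Ioo (0:ℝ) 1, u x ≤ 6 * m / x ^ γ) :
    ∃ m'', m' - 6 * (δ ^ (1 - γ) / (1 - γ)) * m ≤ m'' ∧
      DecDensity m'' (fun x => min (u x) (6 * m / δ ^ γ)) := by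
  have hδ0 : 0 < δ ^ γ := Real.rpow_pos_of_pos hδ.1 _
  have hl : 0 ≤ 6 * m / δ ^ γ := by positivity
  have hi : IntegrableOn (fun x => min (u x) (6 * m / δ ^ γ)) (Ioo 0 1) :=
    Integrable.inf hu.integrableOn (by simp)
  refine ⟨_, ?_, ⟨fun x hx y hy hxy => min_le_min_right _ (hu.anti hx hy hxy),
    fun x hx => le_min (hu.nonneg x hx) hl, hi, rfl⟩⟩
  have hsub : Ioo 0 δ ⊆ Ioo (0:ℝ) 1 := Ioo_subset_Ioo_right hδ.2
  have h1 : ∫ x in Ioo 0 1, (u x - min (u x) (6 * m / δ ^ γ))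
      ≤ ∫ x in Ioo 0 1, (Ioo 0 δ).indicator (fun x => 6 * m * (1 / x ^ γ)) x := by
    refine setIntegral_mono_on (hu.integrableOn.sub hi) ?_ measurableSet_Ioo fun x hx => ?_
    · exact (IntegrableOn.integrable_indicator ((integrableOn_inv_rpow hγ δ).const_mul _)
        measurableSet_Ioo).integrableOn
    · by_cases hxd : x ∈ Ioo 0 δ
      · rw [indicator_of_mem hxd, mul_one_div]
        have := hub x hx
        have := le_min (hu.nonneg x hx) hl
        linarith
      · rw [indicator_of_notMem hxd]
        have hdx : δ ≤ x := by
          by_contra! h; exact hxd ⟨hx.1, h⟩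
        have h2 : u x ≤ 6 * m / δ ^ γ := by
          refine (hub x hx).trans ?_
          have := Real.rpow_le_rpow hδ.1.le hdx hγ.1.le
          gcongr
        rw [min_eq_left h2, sub_self]
  rw [integral_sub hu.integrableOn hi, hu.mass, setIntegral_indicator measurableSet_Ioo,
    inter_eq_self_of_subset_right hsub, integral_const_mul, integral_inv_rpow hγ hδ.1.le] at h1
  linarith

/-- One step of the coupling: a fixed proportion of the mass is replaced by Lebesgue measure. -/
lemma coupling_step {γ : ℝ} (hγ : γ ∈ Ioo (0:ℝ) 1) {N : ℕ} {c : ℝ} (hc : 0 < c) (hc4 : c ≤ 1 / 4)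
    (hmin : ∀ (m : ℝ) (f : ℝ → ℝ), DecDensity m f →
      (∀ x ∈ Ioo (0:ℝ) 1, f x ≤ 6 * m / x ^ γ) →
      ∀ x ∈ Ioo (0:ℝ) 1, c * m ≤ (transfer γ)^[N] f x)
    {δ η : ℝ} (hδ : δ ∈ Ioc (0:ℝ) 1) (hη : η = 6 * (δ ^ (1 - γ) / (1 - γ))) (hη4 : η ≤ 1 / 4)
    {τ : ℕ} (hτ : 8 / δ ^ γ ≤ τ) {m : ℝ} (hm : 0 < m) {f : ℝ → ℝ} (hf : DecDensity m f)
    (hfb : ∀ x ∈ Ioo (0:ℝ) 1, f x ≤ 6 * m / x ^ γ) :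
    ∃ g, DecDensity ((1 - c - η) * m) g ∧
      (∀ x ∈ Ioo (0:ℝ) 1, g x ≤ 6 * ((1 - c - η) * m) / x ^ γ) ∧
      ∀ Y : ℝ → ℝ, Measurable Y → (∀ x, |Y x| ≤ 1) →
        |(∫ x in Ioo 0 1, f x * Y ((Tmap γ)^[τ + N] x)) -
          c * m * (∫ x in Ioo 0 1, Y ((Tmap γ)^[τ] x)) - ∫ x in Ioo 0 1, g x * Y x| ≤ η * m := by
  have hδ0 : 0 < δ ^ γ := Real.rpow_pos_of_pos hδ.1 _
  have hη0 : 0 < η := by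
    have := Real.rpow_pos_of_pos hδ.1 (1 - γ)
    have : 0 < 1 - γ := by linarith [hγ.2]
    rw [hη]; positivity
  set ρ := 1 - c - η with hρ
  have hρ2 : 1 / 2 ≤ ρ := by linarith
  set F := (transfer γ)^[N] f
  have hF : DecDensity m F := hf.transfer_iterate hγ.1 N
  have hFb : ∀ x ∈ Ioo (0:ℝ) 1, F x ≤ 6 * m / x ^ γ := by
    have := hf.transfer_iterate_bound hγ (a := 6) (b := m) (l := 0) (by norm_num) le_rfl le_rfl
      (by simpa using hfb) N
    simpa using this
  have hu := hF.sub_const (hmin m f hf hfb)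
  have hub : ∀ x ∈ Ioo (0:ℝ) 1, F x - c * m ≤ 6 * m / x ^ γ := fun x hx => by
    have := hFb x hx
    have : 0 < c * m := by positivity
    linarith
  obtain ⟨m'', hm'', ht⟩ := hu.truncate hγ hm.le hδ hub
  rw [← hη] at hm''
  have hm2 : ρ * m ≤ m'' := by rw [hρ]; linarith
  have hρm : 0 < ρ * m := by positivity
  have hm0 : 0 < m'' := hρm.trans_le hm2
  set θ := ρ * m / m''
  have hθ0 : 0 ≤ θ := by positivity
  have hθ1 : θ ≤ 1 := (div_le_one hm0).2 hm2
  have hs := ht.const_mul hθ0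
  have hθm : θ * m'' = ρ * m := div_mul_cancel₀ _ hm0.ne'
  rw [hθm] at hs
  set w := fun x => θ * min (F x - c * m) (6 * m / δ ^ γ)
  have hwle : ∀ x ∈ Ioo (0:ℝ) 1, w x ≤ F x - c * m := fun x hx => by
    have h1 : min (F x - c * m) (6 * m / δ ^ γ) ≤ F x - c * m := min_le_left _ _
    have h2 := ht.nonneg x hx
    calc w x ≤ 1 * min (F x - c * m) (6 * m / δ ^ γ) := mul_le_mul_of_nonneg_right hθ1 h2
      _ ≤ _ := by rwa [one_mul]
  refine ⟨(transfer γ)^[τ] w, hs.transfer_iterate hγ.1 τ, fun x hx => ?_, fun Y hY hYb => ?_⟩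
  · have hb := hs.transfer_iterate_bound hγ (a := 3) (b := ρ * m) (l := 6 * m / δ ^ γ) le_rfl le_rfl
      (by positivity) (fun x hx => ?_) τ x hx
    · refine hb.trans ?_
      have hx0 : 0 < x ^ γ := Real.rpow_pos_of_pos hx.1 _
      have hτ0 : (0:ℝ) < τ := lt_of_lt_of_le (by positivity) hτ
      have h1 : 6 * m / δ ^ γ / (1 + τ * x ^ γ / 2) ≤ 3 * (ρ * m) / x ^ γ := by
        calc 6 * m / δ ^ γ / (1 + τ * x ^ γ / 2) ≤ 6 * m / δ ^ γ / (τ * x ^ γ / 2) := by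
              gcongr; linarith
          _ = (3 / 2 * m / x ^ γ) * ((8 / δ ^ γ) / τ) := by field_simp; ring
          _ ≤ (3 / 2 * m / x ^ γ) * 1 := by
              gcongr; exact (div_le_one hτ0).2 hτ
          _ ≤ 3 * (ρ * m) / x ^ γ := by
              rw [mul_one]; gcongr ?_ / _; nlinarith
      calc _ ≤ 3 * (ρ * m) / x ^ γ + 3 * (ρ * m) / x ^ γ := by gcongr
        _ = _ := by ring
    · have hx0 : 0 < x ^ γ := Real.rpow_pos_of_pos hx.1 _
      have h2 := ht.nonneg x hx
      have : w x ≤ 6 * m / δ ^ γ := by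
        calc w x ≤ 1 * min (F x - c * m) (6 * m / δ ^ γ) := mul_le_mul_of_nonneg_right hθ1 h2
          _ ≤ _ := by rw [one_mul]; exact min_le_right _ _
      have : 0 ≤ 3 * (ρ * m) / x ^ γ := by positivity
      linarith
  · have hYτ : Measurable fun x => Y ((Tmap γ)^[τ] x) := hY.comp (measurable_Tmap_iterate γ τ)
    have e1 : ∫ x in Ioo 0 1, f x * Y ((Tmap γ)^[τ + N] x)
        = ∫ x in Ioo 0 1, F x * Y ((Tmap γ)^[τ] x) := by
      have h := integral_transfer_iterate hγ.1 hf.integrableOn hYτ (fun x => hYb _) N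
      refine Eq.trans (integral_congr_ae (Eventually.of_forall fun x => ?_)) h.symm
      rw [← Function.iterate_add_apply]
    rw [e1, integral_transfer_iterate hγ.1 hs.integrableOn hY hYb, ← integral_const_mul]
    have i1 := integrableOn_mul_bounded hF.integrableOn hYτ (fun x => hYb _)
    have i2 := integrableOn_mul_bounded (f := fun _ => c * m) (s := Ioo 0 1)
      (integrableOn_const (by simp)) hYτ (fun x => hYb _)
    have i3 := integrableOn_mul_bounded hs.integrableOn hYτ (fun x => hYb _)
    have i12 : IntegrableOn (fun x => F x * Y ((Tmap γ)^[τ] x) - c * m * Y ((Tmap γ)^[τ] x))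
      (Ioo 0 1) := i1.sub i2
    rw [← integral_sub i1 i2, ← integral_sub i12 i3]
    have e2 : ∀ x, F x * Y ((Tmap γ)^[τ] x) - c * m * Y ((Tmap γ)^[τ] x)
        - w x * Y ((Tmap γ)^[τ] x) = (F x - c * m - w x) * Y ((Tmap γ)^[τ] x) := fun x => by ring
    rw [integral_congr_ae (Eventually.of_forall e2)]
    refine (abs_integral_mul_le (hu.integrableOn.sub hs.integrableOn)
      (fun x hx => sub_nonneg.2 (hwle x hx)) fun x => hYb _).trans ?_
    rw [integral_sub' hu.integrableOn hs.integrableOn, hu.mass, hs.mass, hρ]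
    linarith

lemma coupling_iterate {γ : ℝ} (hγ : γ ∈ Ioo (0:ℝ) 1) {N : ℕ} {c : ℝ} (hc : 0 < c)
    (hc4 : c ≤ 1 / 4)
    (hmin : ∀ (m : ℝ) (f : ℝ → ℝ), DecDensity m f →
      (∀ x ∈ Ioo (0:ℝ) 1, f x ≤ 6 * m / x ^ γ) →
      ∀ x ∈ Ioo (0:ℝ) 1, c * m ≤ (transfer γ)^[N] f x)
    {δ η : ℝ} (hδ : δ ∈ Ioc (0:ℝ) 1) (hη : η = 6 * (δ ^ (1 - γ) / (1 - γ))) (hη4 : η ≤ 1 / 4)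
    {τ : ℕ} (hτ : 8 / δ ^ γ ≤ τ) (K : ℕ) {m : ℝ} (hm : 0 < m) {u v : ℝ → ℝ}
    (hu : DecDensity m u) (hv : DecDensity m v)
    (hub : ∀ x ∈ Ioo (0:ℝ) 1, u x ≤ 6 * m / x ^ γ)
    (hvb : ∀ x ∈ Ioo (0:ℝ) 1, v x ≤ 6 * m / x ^ γ) {n : ℕ} (hn : K * (τ + N) ≤ n)
    {Y : ℝ → ℝ} (hY : Measurable Y) (hYb : ∀ x, |Y x| ≤ 1) :
    |(∫ x in Ioo 0 1, u x * Y ((Tmap γ)^[n] x)) - ∫ x in Ioo 0 1, v x * Y ((Tmap γ)^[n] x)|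
      ≤ m * (2 * (1 - c) ^ K + 2 * K * η) := by
  have hη0 : 0 < η := by
    have := Real.rpow_pos_of_pos hδ.1 (1 - γ)
    have : 0 < 1 - γ := by linarith [hγ.2]
    rw [hη]; positivity
  induction K generalizing m u v n with
  | zero =>
    have h1 := abs_integral_mul_le hu.integrableOn hu.nonneg
      (Y := fun x => Y ((Tmap γ)^[n] x)) fun x => hYb _
    have h2 := abs_integral_mul_le hv.integrableOn hv.nonneg
      (Y := fun x => Y ((Tmap γ)^[n] x)) fun x => hYb _
    rw [hu.mass] at h1
    rw [hv.mass] at h2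
    refine (norm_sub_le (_ : ℝ) _).trans ?_
    rw [Real.norm_eq_abs, Real.norm_eq_abs]
    rw [pow_zero, Nat.cast_zero]
    linarith
  | succ K ih =>
    obtain ⟨u', hu', hub', hu''⟩ := coupling_step hγ hc hc4 hmin hδ hη hη4 hτ hm hu hub
    obtain ⟨v', hv', hvb', hv''⟩ := coupling_step hγ hc hc4 hmin hδ hη hη4 hτ hm hv hvb
    obtain ⟨r, rfl⟩ : ∃ r, n = r + (τ + N) := ⟨n - (τ + N), by
      have : τ + N ≤ (K + 1) * (τ + N) := Nat.le_mul_of_pos_left _ (by omega)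
      omega⟩
    have hr : K * (τ + N) ≤ r := by rw [add_mul, one_mul] at hn; omega
    have hYr : Measurable fun x => Y ((Tmap γ)^[r] x) := hY.comp (measurable_Tmap_iterate γ r)
    have h1 := hu'' _ hYr fun x => hYb _
    have h2 := hv'' _ hYr fun x => hYb _
    have hρ0 : 0 < 1 - c - η := by linarith
    have h3 := ih (m := (1 - c - η) * m) (by positivity) hu' hv' hub' hvb' hr
    simp only [Function.iterate_add_apply (Tmap γ) r]
    have hpow : 0 ≤ (1 - c) ^ K := pow_nonneg (by linarith) _
    have h4 : (1 - c - η) * m * (2 * (1 - c) ^ K + 2 * K * η)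
        ≤ m * (2 * (1 - c) ^ (K + 1) + 2 * K * η) := by
      have e : (1 - c - η) * (2 * (1 - c) ^ K + 2 * K * η)
          ≤ 2 * (1 - c) ^ (K + 1) + 2 * K * η := by
        have : 0 ≤ 2 * (K:ℝ) * η := by positivity
        rw [pow_succ]
        nlinarith [mul_nonneg hη0.le hpow, mul_nonneg (by linarith : 0 ≤ c + η) this]
      calc _ = m * ((1 - c - η) * (2 * (1 - c) ^ K + 2 * K * η)) := by ring
        _ ≤ _ := by gcongr
    rw [abs_le] at h1 h2 h3 ⊢
    push_cast
    constructor <;> linarith [h1.1, h1.2, h2.1, h2.2, h3.1, h3.2]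

/-! ### Rate of decay -/

lemma eventually_geometric_le {c ε κ : ℝ} (hc : 0 < c) (hc1 : c < 1) (hε : 0 < ε) :
    ∀ᶠ n : ℕ in atTop, (1 - c) ^ ⌊(n:ℝ) ^ ε⌋₊ ≤ (n:ℝ) ^ (-κ) := by
  have hL : 0 < -Real.log (1 - c) := by
    have := Real.log_neg (by linarith : 0 < 1 - c) (by linarith)
    linarith
  have ht : Tendsto (fun n : ℕ => (n:ℝ) ^ ε) atTop atTop :=
    (tendsto_rpow_atTop hε).comp tendsto_natCast_atTop_atTop
  have h := ((tendsto_rpow_mul_exp_neg_mul_atTop_nhds_zero (κ / ε) _ hL).comp ht).eventually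
    (eventually_le_nhds (show (0:ℝ) < 1 - c by linarith))
  filter_upwards [h, eventually_ge_atTop 1] with n hn hn1
  have hn0 : (0:ℝ) < n := by exact_mod_cast hn1
  simp only [Function.comp, neg_neg] at hn
  rw [← Real.rpow_mul hn0.le, mul_div_cancel₀ _ hε.ne', mul_comm (Real.log _),
    ← le_div_iff₀' (by positivity)] at hn
  have h1 : (1 - c) * (1 - c) ^ ⌊(n:ℝ) ^ ε⌋₊ ≤ Real.exp ((n:ℝ) ^ ε * Real.log (1 - c)) := by
    rw [← pow_succ', ← Real.exp_log (by linarith : 0 < 1 - c), ← Real.exp_nat_mul, Real.log_exp]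
    refine Real.exp_le_exp.2 (mul_le_mul_of_nonpos_right ?_ (by linarith))
    have := Nat.lt_floor_add_one ((n:ℝ) ^ ε)
    push_cast
    exact this.le
  have h2 := h1.trans hn
  rw [div_eq_mul_inv, ← Real.rpow_neg hn0.le] at h2
  exact le_of_mul_le_mul_left h2 (by linarith)

theorem coupling_decay {γ : ℝ} (hγ : γ ∈ Ioo (0:ℝ) 1) {κ : ℝ} (hκ0 : 0 ≤ κ)
    (hκ : κ < (1 - γ) / γ) :
    ∃ C, 0 ≤ C ∧ ∀ (m : ℝ) (u v : ℝ → ℝ), 0 < m → DecDensity m u → DecDensity m v →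
      (∀ x ∈ Ioo (0:ℝ) 1, u x ≤ 6 * m / x ^ γ) → (∀ x ∈ Ioo (0:ℝ) 1, v x ≤ 6 * m / x ^ γ) →
      ∀ (n : ℕ) (Y : ℝ → ℝ), Measurable Y → (∀ x, |Y x| ≤ 1) →
      |(∫ x in Ioo 0 1, u x * Y ((Tmap γ)^[n] x)) - ∫ x in Ioo 0 1, v x * Y ((Tmap γ)^[n] x)|
        ≤ C * m * ((n:ℝ) + 1) ^ (-κ) := by
  obtain ⟨N, c, hc, hc4, hmin⟩ := exists_minorization hγ 6
  set κ₀ := (1 - γ) / γ with hκ₀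
  have hγ1 : 0 < 1 - γ := by linarith [hγ.2]
  have hκ₀0 : 0 < κ₀ := div_pos hγ1 hγ.1
  obtain ⟨ε, hε, hε4, hεκ⟩ : ∃ ε : ℝ, 0 < ε ∧ ε ≤ 1 / 4 ∧ ε * (1 + 2 * κ₀) ≤ κ₀ - κ :=
    ⟨min (1 / 4) ((κ₀ - κ) / (1 + 2 * κ₀)), lt_min (by norm_num) (div_pos (by linarith)
      (by linarith)), min_le_left _ _, by
        rw [← le_div_iff₀ (by linarith)]; exact min_le_right _ _⟩
  set C₁ := 6 / (1 - γ) with hC₁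
  have hC₁0 : 0 < C₁ := by positivity
  have ht : Tendsto (fun n : ℕ => (n:ℝ) ^ ε) atTop atTop :=
    (tendsto_rpow_atTop hε).comp tendsto_natCast_atTop_atTop
  have ht2 : Tendsto (fun n : ℕ => C₁ * (n:ℝ) ^ (-((1 - 2 * ε) * κ₀))) atTop (𝓝 (C₁ * 0)) :=
    ((tendsto_rpow_neg_atTop (mul_pos (by linarith) hκ₀0)).comp
      tendsto_natCast_atTop_atTop).const_mul _
  rw [mul_zero] at ht2
  have hev : ∀ᶠ n : ℕ in atTop, ∀ (m : ℝ) (u v : ℝ → ℝ), 0 < m → DecDensity m u →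
      DecDensity m v → (∀ x ∈ Ioo (0:ℝ) 1, u x ≤ 6 * m / x ^ γ) →
      (∀ x ∈ Ioo (0:ℝ) 1, v x ≤ 6 * m / x ^ γ) →
      ∀ (Y : ℝ → ℝ), Measurable Y → (∀ x, |Y x| ≤ 1) →
      |(∫ x in Ioo 0 1, u x * Y ((Tmap γ)^[n] x)) - ∫ x in Ioo 0 1, v x * Y ((Tmap γ)^[n] x)|
        ≤ m * ((2 + 2 * C₁) * (n:ℝ) ^ (-κ)) := by
    filter_upwards [eventually_geometric_le (κ := κ) hc (by linarith) hε, eventually_ge_atTop 1,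
      ht.eventually_ge_atTop (9 + N), ht2.eventually (eventually_le_nhds (show (0:ℝ) < 1 / 4 by
        norm_num))] with n h1 hn1 h2 h3 m u v hm hu hv hub hvb Y hY hYb
    have hn0 : (0:ℝ) < n := by exact_mod_cast hn1
    have hn1' : (1:ℝ) ≤ n := by exact_mod_cast hn1
    have hδ : (n:ℝ) ^ (-((1 - 2 * ε) / γ)) ∈ Ioc (0:ℝ) 1 :=
      ⟨by positivity, Real.rpow_le_one_of_one_le_of_nonpos hn1'
        (neg_nonpos.2 (div_nonneg (by linarith) hγ.1.le))⟩
    have hη : C₁ * (n:ℝ) ^ (-((1 - 2 * ε) * κ₀))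
        = 6 * (((n:ℝ) ^ (-((1 - 2 * ε) / γ))) ^ (1 - γ) / (1 - γ)) := by
      rw [← Real.rpow_mul hn0.le, hC₁, hκ₀]
      have : -((1 - 2 * ε) / γ) * (1 - γ) = -((1 - 2 * ε) * ((1 - γ) / γ)) := by ring
      rw [this]; ring
    have hδγ : ((n:ℝ) ^ (-((1 - 2 * ε) / γ))) ^ γ = (n:ℝ) ^ (-(1 - 2 * ε)) := by
      rw [← Real.rpow_mul hn0.le]
      congr 1
      field_simp [hγ.1.ne']
    have hτ : 8 / ((n:ℝ) ^ (-((1 - 2 * ε) / γ))) ^ γ ≤ (⌈8 * (n:ℝ) ^ (1 - 2 * ε)⌉₊ : ℝ) := by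
      rw [hδγ, Real.rpow_neg hn0.le, div_inv_eq_mul]
      exact Nat.le_ceil _
    have hK : ⌊(n:ℝ) ^ ε⌋₊ * (⌈8 * (n:ℝ) ^ (1 - 2 * ε)⌉₊ + N) ≤ n := by
      have e1 : (⌊(n:ℝ) ^ ε⌋₊ : ℝ) ≤ (n:ℝ) ^ ε := Nat.floor_le (by positivity)
      have e2 : (⌈8 * (n:ℝ) ^ (1 - 2 * ε)⌉₊ : ℝ) ≤ 8 * (n:ℝ) ^ (1 - 2 * ε) + 1 :=
        (Nat.ceil_lt_add_one (by positivity)).le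
      have e3 : (1:ℝ) ≤ (n:ℝ) ^ (1 - 2 * ε) := Real.one_le_rpow hn1' (by linarith)
      have e4 : (n:ℝ) ^ ε * ((n:ℝ) ^ (1 - 2 * ε) * (n:ℝ) ^ ε) = n := by
        rw [← Real.rpow_add hn0, ← Real.rpow_add hn0]
        convert Real.rpow_one (n:ℝ) using 2
        ring
      have e5 : (⌈8 * (n:ℝ) ^ (1 - 2 * ε)⌉₊ : ℝ) + N ≤ (n:ℝ) ^ (1 - 2 * ε) * (n:ℝ) ^ ε := by
        have : (n:ℝ) ^ (1 - 2 * ε) * (9 + N) ≤ (n:ℝ) ^ (1 - 2 * ε) * (n:ℝ) ^ ε := by gcongr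
        have hN : (0:ℝ) ≤ N := Nat.cast_nonneg _
        nlinarith
      have : ((⌊(n:ℝ) ^ ε⌋₊ * (⌈8 * (n:ℝ) ^ (1 - 2 * ε)⌉₊ + N) : ℕ) : ℝ) ≤ n := by
        push_cast
        refine le_trans ?_ e4.le
        gcongr
      exact_mod_cast this
    refine (coupling_iterate hγ hc hc4 hmin hδ hη h3 hτ _ hm hu hv hub hvb hK hY hYb).trans ?_
    have hlast : (⌊(n:ℝ) ^ ε⌋₊ : ℝ) * (C₁ * (n:ℝ) ^ (-((1 - 2 * ε) * κ₀))) ≤ C₁ * (n:ℝ) ^ (-κ) := by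
      have e1 : (⌊(n:ℝ) ^ ε⌋₊ : ℝ) ≤ (n:ℝ) ^ ε := Nat.floor_le (by positivity)
      calc _ ≤ (n:ℝ) ^ ε * (C₁ * (n:ℝ) ^ (-((1 - 2 * ε) * κ₀))) := by gcongr
        _ = C₁ * (n:ℝ) ^ (ε + -((1 - 2 * ε) * κ₀)) := by rw [Real.rpow_add hn0]; ring
        _ ≤ _ := by
          gcongr
          nlinarith
    gcongr
    linarith
  obtain ⟨n₀, hn₀⟩ := eventually_atTop.1 (hev.and (eventually_ge_atTop 1))
  refine ⟨2 ^ κ * (2 + 2 * C₁) + 2 * ((n₀:ℝ) + 1) ^ κ, by positivity,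
    fun m u v hm hu hv hub hvb n Y hY hYb => ?_⟩
  have hn1 : (0:ℝ) < (n:ℝ) + 1 := by positivity
  rcases le_or_gt n₀ n with hn | hn
  · obtain ⟨h1, h2⟩ := hn₀ n hn
    have hn0 : (0:ℝ) < n := by exact_mod_cast h2
    have h2' : (1:ℝ) ≤ n := by exact_mod_cast h2
    refine (h1 m u v hm hu hv hub hvb Y hY hYb).trans ?_
    have h3 : (n:ℝ) ^ (-κ) ≤ 2 ^ κ * ((n:ℝ) + 1) ^ (-κ) := by
      have : (2 * (n:ℝ)) ^ (-κ) ≤ ((n:ℝ) + 1) ^ (-κ) :=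
        Real.rpow_le_rpow_of_nonpos hn1 (by linarith) (by linarith)
      rw [Real.mul_rpow (by norm_num) hn0.le, Real.rpow_neg (by norm_num : (0:ℝ) ≤ 2)] at this
      rwa [inv_mul_le_iff₀ (by positivity)] at this
    have h4 : 0 ≤ 2 * ((n₀:ℝ) + 1) ^ κ * m * ((n:ℝ) + 1) ^ (-κ) := by positivity
    calc m * ((2 + 2 * C₁) * (n:ℝ) ^ (-κ))
        ≤ m * ((2 + 2 * C₁) * (2 ^ κ * ((n:ℝ) + 1) ^ (-κ))) := by gcongr
      _ ≤ _ := by linarith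
  · have h1 := abs_integral_mul_le hu.integrableOn hu.nonneg
      (Y := fun x => Y ((Tmap γ)^[n] x)) fun x => hYb _
    have h2 := abs_integral_mul_le hv.integrableOn hv.nonneg
      (Y := fun x => Y ((Tmap γ)^[n] x)) fun x => hYb _
    rw [hu.mass] at h1
    rw [hv.mass] at h2
    have h3 : 1 ≤ ((n₀:ℝ) + 1) ^ κ * ((n:ℝ) + 1) ^ (-κ) := by
      rw [Real.rpow_neg hn1.le, ← div_eq_mul_inv, one_le_div (by positivity)]
      gcongr
    have h4 : 0 ≤ 2 ^ κ * (2 + 2 * C₁) * m * ((n:ℝ) + 1) ^ (-κ) := by positivity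
    refine (norm_sub_le (_ : ℝ) _).trans ?_
    rw [Real.norm_eq_abs, Real.norm_eq_abs]
    nlinarith

/-- Decay for arbitrary decreasing functions of equal mass dominated by `A x^{-γ}`. -/
theorem antitone_decay {γ : ℝ} (hγ : γ ∈ Ioo (0:ℝ) 1) {κ : ℝ} (hκ0 : 0 ≤ κ)
    (hκ : κ < (1 - γ) / γ) (A : ℝ) :
    ∃ C, 0 ≤ C ∧ ∀ (m : ℝ) (u v : ℝ → ℝ), DecDensity m u → DecDensity m v →
      (∀ x ∈ Ioo (0:ℝ) 1, u x ≤ A / x ^ γ) → (∀ x ∈ Ioo (0:ℝ) 1, v x ≤ A / x ^ γ) →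
      ∀ (n : ℕ) (Y : ℝ → ℝ), Measurable Y → (∀ x, |Y x| ≤ 1) →
      |(∫ x in Ioo 0 1, u x * Y ((Tmap γ)^[n] x)) - ∫ x in Ioo 0 1, v x * Y ((Tmap γ)^[n] x)|
        ≤ C * ((n:ℝ) + 1) ^ (-κ) := by
  obtain ⟨C, hC, h⟩ := coupling_decay hγ hκ0 hκ
  wlog hA : 0 < A generalizing A
  · obtain ⟨C', hC', h'⟩ := this 1 one_pos
    refine ⟨C', hC', fun m u v hu hv hub hvb => h' m u v hu hv (fun x hx => ?_) fun x hx => ?_⟩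
    · have := Real.rpow_pos_of_pos hx.1 γ
      exact (hub x hx).trans (by gcongr; linarith)
    · have := Real.rpow_pos_of_pos hx.1 γ
      exact (hvb x hx).trans (by gcongr; linarith)
  have hγ1 : 0 < 1 - γ := by linarith [hγ.2]
  refine ⟨C * (A / (1 - γ) + A), by positivity, fun m u v hu hv hub hvb n Y hY hYb => ?_⟩
  have hm : m ≤ A / (1 - γ) := by
    have h1 := setIntegral_mono_on hu.integrableOn ((integrableOn_inv_rpow hγ 1).const_mul A)
      measurableSet_Ioo fun x hx => by rw [mul_one_div]; exact hub x hx
    rwa [hu.mass, integral_const_mul, integral_inv_rpow hγ zero_le_one, Real.one_rpow,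
      mul_one_div] at h1
  have hadd : ∀ w, DecDensity m w → DecDensity (m + A) (fun x => w x + A) := fun w hw => by
    have := hw.sub_const (c := -A) fun x hx => by linarith [hw.nonneg x hx]
    simpa only [sub_neg_eq_add] using this
  have hbd : ∀ w : ℝ → ℝ, (∀ x ∈ Ioo (0:ℝ) 1, w x ≤ A / x ^ γ) →
      ∀ x ∈ Ioo (0:ℝ) 1, w x + A ≤ 6 * (m + A) / x ^ γ := fun w hw x hx => by
    have h0 := Real.rpow_pos_of_pos hx.1 γ
    have h1 : x ^ γ ≤ 1 := Real.rpow_le_one hx.1.le hx.2.le hγ.1.le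
    have h2 := hw x hx
    rw [le_div_iff₀ h0] at h2 ⊢
    nlinarith [hu.mass_nonneg]
  have hmA : 0 < m + A := by linarith [hu.mass_nonneg]
  have key := h (m + A) _ _ hmA (hadd u hu) (hadd v hv) (hbd u hub) (hbd v hvb) n Y hY hYb
  have hYn : Measurable fun x => Y ((Tmap γ)^[n] x) := hY.comp (measurable_Tmap_iterate γ n)
  have i0 := integrableOn_mul_bounded (f := fun _ => A) (s := Ioo 0 1)
      (integrableOn_const (by simp)) hYn (fun x => hYb _)
  have e : ∀ w, DecDensity m w → ∫ x in Ioo 0 1, (w x + A) * Y ((Tmap γ)^[n] x)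
      = (∫ x in Ioo 0 1, w x * Y ((Tmap γ)^[n] x)) + ∫ x in Ioo 0 1, A * Y ((Tmap γ)^[n] x) :=
    fun w hw => by
      rw [← integral_add (integrableOn_mul_bounded hw.integrableOn hYn (fun x => hYb _)) i0]
      simp only [add_mul]
  rw [e u hu, e v hv, add_sub_add_right_eq_sub] at key
  refine key.trans ?_
  gcongr

/-! ### The invariant measure as a limit of iterates of Lebesgue measure -/

/-- Difference between the correlation of `h` and `Z ∘ T^n` and the product of their means. -/
def mixDefect (γ : ℝ) (Z h : ℝ → ℝ) (n : ℕ) : ℝ :=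
  (∫ x in Ioo 0 1, h x * Z ((Tmap γ)^[n] x)) -
    (∫ x in Ioo 0 1, h x) * ∫ x in Ioo 0 1, Z ((Tmap γ)^[n] x)

lemma mixDefect_sub {γ : ℝ} {Z u v : ℝ → ℝ} (hZ : Measurable Z) (hZb : ∀ x, |Z x| ≤ 1)
    (hu : IntegrableOn u (Ioo 0 1)) (hv : IntegrableOn v (Ioo 0 1)) (n : ℕ) :
    mixDefect γ Z (fun x => u x - v x) n = mixDefect γ Z u n - mixDefect γ Z v n := by
  have hZn := hZ.comp (measurable_Tmap_iterate γ n)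
  have h1 := integrableOn_mul_bounded hu hZn (fun x => hZb _)
  have h2 := integrableOn_mul_bounded hv hZn (fun x => hZb _)
  simp only [Function.comp] at h1 h2
  simp only [mixDefect, sub_mul]
  rw [integral_sub h1 h2, integral_sub hu hv]
  ring

lemma abs_mixDefect_le {γ : ℝ} {Z h : ℝ → ℝ} (hZb : ∀ x, |Z x| ≤ 1)
    (hh : IntegrableOn h (Ioo 0 1)) (n : ℕ) :
    |mixDefect γ Z h n| ≤ 2 * ∫ x in Ioo 0 1, |h x| := by
  have h1 : |∫ x in Ioo 0 1, h x * Z ((Tmap γ)^[n] x)| ≤ ∫ x in Ioo 0 1, |h x| := by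
    refine norm_integral_le_of_norm_le (f := fun x => h x * Z ((Tmap γ)^[n] x)) hh.abs (Eventually.of_forall fun x => ?_)
    rw [Real.norm_eq_abs, abs_mul]
    exact mul_le_of_le_one_right (abs_nonneg _) (hZb _)
  have h2 : |∫ x in Ioo 0 1, h x| ≤ ∫ x in Ioo 0 1, |h x| := abs_integral_le_integral_abs
  have h3 : |∫ x in Ioo (0:ℝ) 1, Z ((Tmap γ)^[n] x)| ≤ 1 := by
    have := norm_integral_le_of_norm_le (μ := volume.restrict (Ioo (0:ℝ) 1))
      (f := fun x => Z ((Tmap γ)^[n] x)) (integrable_const (1:ℝ))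
      (Eventually.of_forall fun x => hZb _)
    simpa using this
  refine (norm_sub_le (_ : ℝ) _).trans ?_
  rw [Real.norm_eq_abs, Real.norm_eq_abs, abs_mul]
  have := mul_le_mul h2 h3 (abs_nonneg _) ((abs_nonneg _).trans h2)
  linarith

lemma tendsto_mixDefect_antitone {γ : ℝ} (hγ : γ ∈ Ioo (0:ℝ) 1) {Z : ℝ → ℝ} (hZ : Measurable Z)
    (hZb : ∀ x, |Z x| ≤ 1) {u : ℝ → ℝ} {A : ℝ} (hu : AntitoneOn u (Icc 0 1))
    (hu0 : ∀ x ∈ Icc (0:ℝ) 1, 0 ≤ u x) (huA : ∀ x ∈ Icc (0:ℝ) 1, u x ≤ A) :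
    Tendsto (mixDefect γ Z u) atTop (𝓝 0) := by
  have hκ₀ : 0 < (1 - γ) / γ := div_pos (by linarith [hγ.2]) hγ.1
  obtain ⟨C, hC, h⟩ := antitone_decay hγ (half_pos hκ₀).le (half_lt_self hκ₀) A
  have hsub : Ioo (0:ℝ) 1 ⊆ Icc 0 1 := Ioo_subset_Icc_self
  have hA : 0 ≤ A := (hu0 0 (by simp)).trans (huA 0 (by simp))
  have hui : IntegrableOn u (Ioo 0 1) := (hu.integrableOn_isCompact isCompact_Icc).mono_set hsub
  have hud : DecDensity (∫ x in Ioo 0 1, u x) u := ⟨hu.mono hsub, fun x hx => hu0 x (hsub hx), hui, rfl⟩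
  have hvd : DecDensity (∫ x in Ioo 0 1, u x) (fun _ => ∫ x in Ioo 0 1, u x) :=
    ⟨antitoneOn_const, fun x hx => hud.mass_nonneg, integrableOn_const (by simp), by simp⟩
  have hmA : ∫ x in Ioo 0 1, u x ≤ A := by
    have := setIntegral_mono_on hui (integrableOn_const (C := A) (by simp)) measurableSet_Ioo
      fun x hx => huA x (hsub hx)
    simpa using this
  have hdiv : ∀ x ∈ Ioo (0:ℝ) 1, A ≤ A / x ^ γ := fun x hx => by
    have h0 := Real.rpow_pos_of_pos hx.1 γ
    have h1 : x ^ γ ≤ 1 := Real.rpow_le_one hx.1.le hx.2.le hγ.1.le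
    rw [le_div_iff₀ h0]
    nlinarith
  have key := h _ _ _ hud hvd (fun x hx => (huA x (hsub hx)).trans (hdiv x hx))
    (fun x hx => hmA.trans (hdiv x hx))
  have hlim : Tendsto (fun n : ℕ => C * ((n:ℝ) + 1) ^ (-((1 - γ) / γ / 2))) atTop (𝓝 (C * 0)) :=
    ((tendsto_rpow_neg_atTop (half_pos hκ₀)).comp
      (tendsto_atTop_add_const_right _ _ tendsto_natCast_atTop_atTop)).const_mul C
  rw [mul_zero] at hlim
  refine squeeze_zero_norm (fun n => ?_) hlim
  have := key n Z hZ hZb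
  rwa [integral_const_mul] at this

lemma tendsto_mixDefect_polynomial {γ : ℝ} (hγ : γ ∈ Ioo (0:ℝ) 1) {Z : ℝ → ℝ} (hZ : Measurable Z)
    (hZb : ∀ x, |Z x| ≤ 1) (P : Polynomial ℝ) :
    Tendsto (mixDefect γ Z fun x => P.eval x) atTop (𝓝 0) := by
  obtain ⟨L, hL⟩ := isCompact_Icc (a := (0:ℝ)) (b := 1) |>.exists_bound_of_continuousOn
    P.derivative.continuous.continuousOn
  obtain ⟨B, hB⟩ := isCompact_Icc (a := (0:ℝ)) (b := 1) |>.exists_bound_of_continuousOn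
    P.continuous.continuousOn
  have hL0 : 0 ≤ L := (norm_nonneg _).trans (hL 0 (by simp))
  simp only [Real.norm_eq_abs, abs_le] at hL hB
  have h1 : Tendsto (mixDefect γ Z fun x => P.eval x - L * x + (B + L)) atTop (𝓝 0) := by
    refine tendsto_mixDefect_antitone (A := 2 * B + L) hγ hZ hZb ?_ (fun x hx => ?_) fun x hx => ?_
    · refine antitoneOn_of_deriv_nonpos (convex_Icc 0 1)
        (Continuous.continuousOn (by fun_prop)) (by fun_prop) fun x hx => ?_
      rw [interior_Icc] at hx
      have hd : HasDerivAt (fun x => P.eval x - L * x + (B + L)) (P.derivative.eval x - L * 1) x :=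
        ((P.hasDerivAt x).sub ((hasDerivAt_id x).const_mul L)).add_const _
      rw [hd.deriv]
      linarith [(hL x (Ioo_subset_Icc_self hx)).2]
    · nlinarith [(hB x hx).1, hx.2]
    · nlinarith [(hB x hx).2, hx.1]
  have h2 : Tendsto (mixDefect γ Z fun x => - L * x + (B + L)) atTop (𝓝 0) := by
    have hB0 : 0 ≤ B := by linarith [(hB 0 (by simp)).1, (hB 0 (by simp)).2]
    refine tendsto_mixDefect_antitone (A := B + L) hγ hZ hZb (fun x _ y _ hxy => ?_)
      (fun x hx => ?_) fun x hx => ?_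
    · nlinarith
    · nlinarith [hx.2]
    · nlinarith [hx.1]
  have h3 := h1.sub h2
  rw [sub_zero] at h3
  refine h3.congr fun n => ?_
  rw [← mixDefect_sub hZ hZb]
  · congr 1; funext x; ring
  · exact ((by fun_prop : Continuous _).continuousOn.integrableOn_compact isCompact_Icc).mono_set
      Ioo_subset_Icc_self
  · exact ((by fun_prop : Continuous _).continuousOn.integrableOn_compact isCompact_Icc).mono_set
      Ioo_subset_Icc_self

lemma tendsto_mixDefect {γ : ℝ} (hγ : γ ∈ Ioo (0:ℝ) 1) {Z : ℝ → ℝ} (hZ : Measurable Z)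
    (hZb : ∀ x, |Z x| ≤ 1) {h : ℝ → ℝ} (hh : IntegrableOn h (Ioo 0 1)) :
    Tendsto (mixDefect γ Z h) atTop (𝓝 0) := by
  rw [Metric.tendsto_atTop]
  intro ε hε
  obtain ⟨g, -, hg, hgc, hgi⟩ := Integrable.exists_hasCompactSupport_integral_sub_le hh
    (ε := ε / 8) (by positivity)
  obtain ⟨P, hP⟩ := exists_polynomial_near_of_continuousOn 0 1 g hgc.continuousOn (ε / 8)
    (by positivity)
  have hPi : IntegrableOn (fun x => P.eval x) (Ioo 0 1) :=
    (P.continuous.continuousOn.integrableOn_compact isCompact_Icc).mono_set Ioo_subset_Icc_self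
  have hgP : ∫ x in Ioo 0 1, |g x - P.eval x| ≤ ε / 8 := by
    have := setIntegral_mono_on (hgi.sub hPi).abs
      (integrableOn_const (C := ε / 8) (s := Ioo (0:ℝ) 1) (μ := volume) (by simp)) measurableSet_Ioo
      fun x hx => by
        rw [Pi.sub_apply, abs_sub_comm]
        exact (hP x (Ioo_subset_Icc_self hx)).le
    simpa using this
  have hhP : ∫ x in Ioo 0 1, |h x - P.eval x| ≤ ε / 4 := by
    have := integral_mono (hh.sub hPi).abs ((hh.sub hgi).abs.add (hgi.sub hPi).abs)
      fun x => abs_sub_le (h x) (g x) (P.eval x)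
    rw [integral_add' (hh.sub hgi).abs (hgi.sub hPi).abs] at this
    simp only [Pi.sub_apply, Real.norm_eq_abs] at this hg
    linarith
  obtain ⟨n₀, hn₀⟩ := Metric.tendsto_atTop.1 (tendsto_mixDefect_polynomial hγ hZ hZb P) (ε / 2)
    (by positivity)
  refine ⟨n₀, fun n hn => ?_⟩
  have h1 := hn₀ n hn
  have h2 := (abs_mixDefect_le (γ := γ) hZb (hh.sub hPi) n).trans
    (mul_le_mul_of_nonneg_left hhP zero_le_two)
  have h3 := mixDefect_sub (γ := γ) hZ hZb hh hPi n
  rw [Real.dist_eq, sub_zero] at h1 ⊢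
  have h4 : mixDefect γ Z h n = mixDefect γ Z (h - fun x => P.eval x) n
      + mixDefect γ Z (fun x => P.eval x) n := by
    rw [show (h - fun x => P.eval x) = fun x => h x - P.eval x from rfl, h3]; ring
  rw [h4]
  refine (abs_add_le _ _).trans_lt ?_
  linarith

section Invariant
variable {γ : ℝ} {ν : Measure ℝ}

lemma ae_mem_Ioo [IsProbabilityMeasure ν] (hsupp : ν (Icc 0 1) = 1) (hac : ν ≪ volume) : ∀ᵐ x ∂ν, x ∈ Ioo (0:ℝ) 1 := by
  have h1 : ∀ᵐ x ∂ν, x ∈ Icc (0:ℝ) 1 := (prob_compl_eq_zero_iff measurableSet_Icc).2 hsupp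
  have h2 : ∀ᵐ x ∂(volume : Measure ℝ), x ≠ 0 ∧ x ≠ 1 := by
    filter_upwards [Measure.ae_ne volume (0:ℝ), Measure.ae_ne volume (1:ℝ)] with x h0 h1
    exact ⟨h0, h1⟩
  filter_upwards [h1, hac.ae_le h2] with x hx hx'
  exact ⟨lt_of_le_of_ne hx.1 hx'.1.symm, lt_of_le_of_ne hx.2 hx'.2⟩

lemma measurePreserving_Tmap (hinv : Measure.map (Tmap γ) ν = ν) :
    MeasurePreserving (Tmap γ) ν ν := ⟨measurable_Tmap γ, hinv⟩

lemma integral_comp_iterate (hinv : Measure.map (Tmap γ) ν = ν) {Z : ℝ → ℝ} (hZ : Measurable Z)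
    (n : ℕ) : ∫ x, Z ((Tmap γ)^[n] x) ∂ν = ∫ x, Z x ∂ν := by
  have h := (measurePreserving_Tmap hinv).iterate n
  conv_rhs => rw [← h.map_eq]
  rw [integral_map h.measurable.aemeasurable hZ.aestronglyMeasurable]

theorem tendsto_integral_iterate [IsProbabilityMeasure ν] (hγ : γ ∈ Ioo (0:ℝ) 1) (hsupp : ν (Icc 0 1) = 1)
    (hac : ν ≪ volume) (hinv : Measure.map (Tmap γ) ν = ν) {Z : ℝ → ℝ} (hZ : Measurable Z)
    (hZb : ∀ x, |Z x| ≤ 1) :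
    Tendsto (fun n : ℕ => ∫ x in Ioo 0 1, Z ((Tmap γ)^[n] x)) atTop (𝓝 (∫ x, Z x ∂ν)) := by
  have hres : ν.restrict (Ioo 0 1) = ν := Measure.restrict_eq_self_of_ae_mem (ae_mem_Ioo hsupp hac)
  have hint : ∀ g : ℝ → ℝ, ∫ x in Ioo 0 1, (ν.rnDeriv volume x).toReal * g x = ∫ x, g x ∂ν := by
    intro g
    have := setIntegral_rnDeriv_smul hac (f := g) (measurableSet_Ioo (a := (0:ℝ)) (b := 1))
    rwa [hres] at this
  have hmass : ∫ x in Ioo (0:ℝ) 1, (ν.rnDeriv volume x).toReal = 1 := by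
    simpa using hint fun _ => 1
  have h := tendsto_mixDefect hγ hZ hZb
    (h := fun x => (ν.rnDeriv volume x).toReal) Measure.integrable_toReal_rnDeriv.integrableOn
  have h' := (tendsto_const_nhds (x := ∫ x, Z x ∂ν)).sub h
  rw [sub_zero] at h'
  refine h'.congr fun n => ?_
  rw [mixDefect, hmass, hint fun x => Z ((Tmap γ)^[n] x), integral_comp_iterate hinv hZ]
  ring

end Invariant

/-! ### Covariance decay for piecewise monotone observables -/

/-- `g` is monotone (in either direction) on an order-connected set and vanishes elsewhere. -/
def IsMonPiece (g : ℝ → ℝ) : Prop :=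
  ∃ I : Set ℝ, I.OrdConnected ∧ (MonotoneOn g I ∨ AntitoneOn g I) ∧ ∀ x ∉ I, g x = 0

lemma IsMonPiece.const_mul {g : ℝ → ℝ} (hg : IsMonPiece g) {c : ℝ} (hc : 0 ≤ c) :
    IsMonPiece fun x => c * g x := by
  obtain ⟨I, hI, h, h0⟩ := hg
  exact ⟨I, hI, h.imp
    (fun h x hx y hy hxy => mul_le_mul_of_nonneg_left (h hx hy hxy) hc)
    (fun h x hx y hy hxy => mul_le_mul_of_nonneg_left (h hx hy hxy) hc),
    fun x hx => by simp [h0 x hx]⟩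

lemma exists_antitone_sub_of_antitoneOn {g : ℝ → ℝ} {I : Set ℝ} (hI : I.OrdConnected)
    (hg : AntitoneOn g I) (h0 : ∀ x ∉ I, g x = 0) (hb : ∀ x, |g x| ≤ 1) :
    ∃ g₁ g₂ : ℝ → ℝ, Antitone g₁ ∧ Antitone g₂ ∧ (∀ x, g₁ x ∈ Icc (0:ℝ) 2) ∧
      (∀ x, g₂ x ∈ Icc (0:ℝ) 2) ∧ ∀ x, g x = g₁ x - g₂ x := by
  classical
  have key : ∀ h : ℝ → ℝ, AntitoneOn h I → (∀ x, |h x| ≤ 1) →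
      Antitone (fun x => if x ∈ I then h x + 1 else if ∃ y ∈ I, x < y then 2 else 0) ∧
      ∀ x, (if x ∈ I then h x + 1 else if ∃ y ∈ I, x < y then 2 else 0) ∈ Icc (0:ℝ) 2 := by
    intro h hh hhb
    simp only [abs_le] at hhb
    refine ⟨fun x y hxy => ?_, fun x => ?_⟩
    · by_cases hx : x ∈ I <;> by_cases hy : y ∈ I
      · simp only [hx, hy, if_true]
        linarith [hh hx hy hxy]
      · have : ¬ ∃ z ∈ I, y < z := fun ⟨z, hz, hyz⟩ => hy (hI.out hx hz ⟨hxy, hyz.le⟩)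
        simp only [hx, hy, this, if_true, if_false]
        linarith [(hhb x).1]
      · have hlt : x < y := lt_of_le_of_ne hxy fun e => hx (e ▸ hy)
        have : ∃ z ∈ I, x < z := ⟨y, hy, hlt⟩
        simp only [hx, hy, this, if_true, if_false]
        linarith [(hhb y).2]
      · simp only [hx, hy, if_false]
        by_cases hz : ∃ z ∈ I, y < z
        · have : ∃ z ∈ I, x < z := let ⟨z, h1, h2⟩ := hz; ⟨z, h1, hxy.trans_lt h2⟩
          simp only [hz, this, if_true, le_refl]
        · simp only [hz, if_false]
          split_ifs <;> norm_num
    · have := hhb x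
      split_ifs <;> constructor <;> linarith
  obtain ⟨h1, h1'⟩ := key g hg hb
  obtain ⟨h2, h2'⟩ := key (fun _ => 0) antitoneOn_const (by simp)
  refine ⟨_, _, h1, h2, h1', h2', fun x => ?_⟩
  by_cases hx : x ∈ I
  · simp [hx]
  · simp [hx, h0 x hx]

lemma IsMonPiece.exists_antitone_sub {g : ℝ → ℝ} (hg : IsMonPiece g) (hb : ∀ x, |g x| ≤ 1) :
    ∃ g₁ g₂ : ℝ → ℝ, Antitone g₁ ∧ Antitone g₂ ∧ (∀ x, g₁ x ∈ Icc (0:ℝ) 2) ∧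
      (∀ x, g₂ x ∈ Icc (0:ℝ) 2) ∧ ∀ x, g x = g₁ x - g₂ x := by
  obtain ⟨I, hI, h | h, h0⟩ := hg
  · obtain ⟨g₁, g₂, h1, h2, h3, h4, h5⟩ := exists_antitone_sub_of_antitoneOn (g := fun x => - g x)
      hI h.neg (fun x hx => by simp [h0 x hx]) fun x => by simpa using hb x
    exact ⟨g₂, g₁, h2, h1, h4, h3, fun x => by linarith [h5 x]⟩
  · exact exists_antitone_sub_of_antitoneOn hI h h0 hb

/-- Truncation of a real number to `[-s, s]`. -/
def clip (s x : ℝ) : ℝ := max (-s) (min x s)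

lemma clip_mono (s : ℝ) : Monotone (clip s) := fun _ _ h =>
  max_le_max le_rfl (min_le_min_right _ h)

lemma clip_zero {s : ℝ} (hs : 0 ≤ s) : clip s 0 = 0 := by
  simp [clip, hs]

lemma abs_clip_le {s : ℝ} (hs : 0 ≤ s) (x : ℝ) : |clip s x| ≤ s :=
  abs_le.2 ⟨le_max_left _ _, max_le (by linarith) (min_le_right _ _)⟩

lemma clip_eq_self {s x : ℝ} (h : |x| ≤ s) : clip s x = x := by
  rw [abs_le] at h
  rw [clip, min_eq_left h.2, max_eq_right h.1]

lemma abs_clip_le_abs {s : ℝ} (hs : 0 ≤ s) (x : ℝ) : |clip s x| ≤ |x| := by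
  rcases le_or_gt |x| s with h | h
  · rw [clip_eq_self h]
  · exact (abs_clip_le hs x).trans h.le

lemma abs_sub_clip_le {s : ℝ} (hs : 0 ≤ s) (x : ℝ) : |x - clip s x| ≤ |x| := by
  rcases le_total 0 x with h | h
  · have h1 : 0 ≤ clip s x := by rw [← clip_zero hs]; exact clip_mono s h
    have h2 := abs_clip_le_abs hs x
    rw [abs_of_nonneg h1, abs_of_nonneg h] at h2
    rw [abs_of_nonneg h, abs_of_nonneg (by linarith)]
    linarith
  · have h1 : clip s x ≤ 0 := by rw [← clip_zero hs]; exact clip_mono s h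
    have h2 := abs_clip_le_abs hs x
    rw [abs_of_nonpos h1, abs_of_nonpos h] at h2
    rw [abs_of_nonpos h, abs_of_nonpos (by linarith)]
    linarith

lemma continuous_clip (s : ℝ) : Continuous (clip s) := by
  unfold clip; fun_prop

lemma IsMonPiece.clip {g : ℝ → ℝ} (hg : IsMonPiece g) {s : ℝ} (hs : 0 ≤ s) :
    IsMonPiece fun x => clip s (g x) := by
  obtain ⟨I, hI, h, h0⟩ := hg
  exact ⟨I, hI, h.imp (fun h x hx y hy hxy => clip_mono s (h hx hy hxy))
    (fun h x hx y hy hxy => clip_mono s (h hx hy hxy)), fun x hx => by simp only [h0 x hx, clip_zero hs]⟩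

lemma IsMonPiece.measurable {g : ℝ → ℝ} (hg : IsMonPiece g) : Measurable g := by
  have h1 : ∀ n : ℕ, Measurable fun x => _root_.clip ((n:ℝ) + 1) (g x) := fun n => by
    have hn : (0:ℝ) < n + 1 := by positivity
    obtain ⟨g₁, g₂, h1, h2, -, -, h5⟩ := ((hg.clip hn.le).const_mul
      (inv_nonneg.2 hn.le)).exists_antitone_sub fun x => by
        rw [abs_mul, abs_of_pos (inv_pos.2 hn), inv_mul_le_iff₀ hn, mul_one]
        exact abs_clip_le hn.le _
    have : (fun x => _root_.clip ((n:ℝ) + 1) (g x)) = fun x => ((n:ℝ) + 1) * (g₁ x - g₂ x) := by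
      funext x
      rw [← h5 x, mul_inv_cancel_left₀ hn.ne']
    rw [this]
    exact (h1.measurable.sub h2.measurable).const_mul _
  refine measurable_of_tendsto_metrizable h1 (tendsto_pi_nhds.2 fun x => ?_)
  refine tendsto_const_nhds.congr' ?_
  filter_upwards [tendsto_natCast_atTop_atTop.eventually_ge_atTop |g x|] with n hn
  rw [clip_eq_self]
  linarith

section Covariance
variable {γ : ℝ} {ν : Measure ℝ} [IsProbabilityMeasure ν]

lemma tendsto_integral_iterate_of_bdd (hγ : γ ∈ Ioo (0:ℝ) 1) (hsupp : ν (Icc 0 1) = 1)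
    (hac : ν ≪ volume) (hinv : Measure.map (Tmap γ) ν = ν) {Z : ℝ → ℝ} (hZ : Measurable Z)
    {c : ℝ} (hc : 0 < c) (hZb : ∀ x, |Z x| ≤ c) :
    Tendsto (fun n : ℕ => ∫ x in Ioo 0 1, Z ((Tmap γ)^[n] x)) atTop (𝓝 (∫ x, Z x ∂ν)) := by
  have h := (tendsto_integral_iterate hγ hsupp hac hinv (hZ.const_mul c⁻¹) fun x => by
    rw [abs_mul, abs_of_pos (inv_pos.2 hc), inv_mul_le_iff₀ hc, mul_one]
    exact hZb x).const_mul c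
  simpa only [integral_const_mul, mul_inv_cancel_left₀ hc.ne'] using h

lemma antitone_covariance_decay (hγ : γ ∈ Ioo (0:ℝ) 1) (hsupp : ν (Icc 0 1) = 1)
    (hac : ν ≪ volume) (hinv : Measure.map (Tmap γ) ν = ν) {κ : ℝ} (hκ0 : 0 ≤ κ)
    (hκ : κ < (1 - γ) / γ) :
    ∃ C, 0 ≤ C ∧ ∀ g : ℝ → ℝ, Antitone g → (∀ x, g x ∈ Icc (0:ℝ) 2) →
      ∀ Y : ℝ → ℝ, Measurable Y → (∀ x, |Y x| ≤ 1) → ∀ k : ℕ,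
      |(∫ x, g x * Y ((Tmap γ)^[k] x) ∂ν) - (∫ x, g x ∂ν) * ∫ x, Y x ∂ν|
        ≤ C * ((k:ℝ) + 1) ^ (-κ) := by
  obtain ⟨C, hC, h⟩ := antitone_decay hγ hκ0 hκ 6
  refine ⟨C, hC, fun g hg hgb Y hY hYb k => ?_⟩
  set H : ℕ → ℝ → ℝ := fun m => (transfer γ)^[m] fun _ => 1
  have h1d : DecDensity 1 (fun _ => 1) :=
    ⟨antitoneOn_const, fun _ _ => zero_le_one, integrableOn_const (by simp), by simp⟩
  have hH : ∀ m, DecDensity 1 (H m) := fun m => h1d.transfer_iterate hγ.1 m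
  have hHb : ∀ m, ∀ x ∈ Ioo (0:ℝ) 1, H m x ≤ 3 / x ^ γ := fun m x hx => by
    have := h1d.transfer_iterate_bound hγ (a := 3) (b := 1) (l := 0) le_rfl le_rfl le_rfl
      (fun x hx => by
        have h0 := Real.rpow_pos_of_pos hx.1 γ
        have h1 : x ^ γ ≤ 1 := Real.rpow_le_one hx.1.le hx.2.le hγ.1.le
        rw [zero_add, le_div_iff₀ h0]
        linarith) m x hx
    simpa using this
  have hgm : Measurable g := hg.measurable
  have hgabs : ∀ x, |g x| ≤ 2 := fun x => abs_le.2 ⟨by linarith [(hgb x).1], (hgb x).2⟩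
  have hYk : Measurable fun x => Y ((Tmap γ)^[k] x) := hY.comp (measurable_Tmap_iterate γ k)
  have hgY : Measurable fun x => g x * Y ((Tmap γ)^[k] x) := hgm.mul hYk
  have hgYb : ∀ x, |g x * Y ((Tmap γ)^[k] x)| ≤ 2 := fun x => by
    rw [abs_mul]
    have := mul_le_mul (hgabs x) (hYb ((Tmap γ)^[k] x)) (abs_nonneg _) zero_le_two
    linarith
  have hHint : ∀ {Z : ℝ → ℝ} {c : ℝ}, Measurable Z → 0 < c → (∀ x, |Z x| ≤ c) →
      Tendsto (fun m => ∫ x in Ioo 0 1, H m x * Z x) atTop (𝓝 (∫ x, Z x ∂ν)) := by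
    intro Z c hZ hc hZb
    refine (tendsto_integral_iterate_of_bdd hγ hsupp hac hinv hZ hc hZb).congr fun m => ?_
    have := integral_transfer_iterate hγ.1 h1d.integrableOn hZ hZb m
    simpa using this.symm
  have hlim := ((hHint hgY two_pos hgYb).sub
    ((hHint hgm two_pos hgabs).mul (hHint hYk one_pos fun x => hYb _))).abs
  rw [integral_comp_iterate hinv hY] at hlim
  refine le_of_tendsto hlim (Eventually.of_forall fun m => ?_)
  have hu : DecDensity (∫ x in Ioo 0 1, H m x * g x) (fun x => H m x * g x) :=
    ⟨fun x hx y hy hxy => mul_le_mul ((hH m).anti hx hy hxy) (hg hxy) (hgb y).1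
      ((hH m).nonneg x hx), fun x hx => mul_nonneg ((hH m).nonneg x hx) (hgb x).1,
      integrableOn_mul_bounded (hH m).integrableOn hgm hgabs, rfl⟩
  have hmass2 : ∫ x in Ioo 0 1, H m x * g x ≤ 2 := by
    have := setIntegral_mono_on hu.integrableOn ((hH m).integrableOn.mul_const 2) measurableSet_Ioo
      fun x hx => mul_le_mul_of_nonneg_left (hgb x).2 ((hH m).nonneg x hx)
    rwa [integral_mul_const, (hH m).mass, one_mul] at this
  have hv := (hH m).const_mul hu.mass_nonneg
  rw [mul_one] at hv
  have hb6 : ∀ x ∈ Ioo (0:ℝ) 1, ∀ t ≤ (2:ℝ), H m x * t ≤ 6 / x ^ γ := fun x hx t ht => by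
    calc H m x * t ≤ H m x * 2 := mul_le_mul_of_nonneg_left ht ((hH m).nonneg x hx)
      _ ≤ 3 / x ^ γ * 2 := mul_le_mul_of_nonneg_right (hHb m x hx) zero_le_two
      _ = 6 / x ^ γ := by ring
  have key := h _ _ _ hu hv (fun x hx => hb6 x hx _ (hgb x).2)
    (fun x hx => by rw [mul_comm]; exact hb6 x hx _ hmass2) k Y hY hYb
  simp only [mul_assoc, integral_const_mul] at key
  exact key

/-- Covariances of piecewise monotone observables with the future decay at any rate
`κ < (1 - γ) / γ`. -/
theorem monPiece_covariance_decay (hγ : γ ∈ Ioo (0:ℝ) 1) (hsupp : ν (Icc 0 1) = 1)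
    (hac : ν ≪ volume) (hinv : Measure.map (Tmap γ) ν = ν) {κ : ℝ} (hκ0 : 0 ≤ κ)
    (hκ : κ < (1 - γ) / γ) :
    ∃ C, 0 ≤ C ∧ ∀ g : ℝ → ℝ, IsMonPiece g → (∀ x, |g x| ≤ 1) →
      ∀ Y : ℝ → ℝ, Measurable Y → (∀ x, |Y x| ≤ 1) → ∀ k : ℕ,
      |(∫ x, g x * Y ((Tmap γ)^[k] x) ∂ν) - (∫ x, g x ∂ν) * ∫ x, Y x ∂ν|
        ≤ C * ((k:ℝ) + 1) ^ (-κ) := by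
  obtain ⟨C, hC, h⟩ := antitone_covariance_decay hγ hsupp hac hinv hκ0 hκ
  refine ⟨C + C, by positivity, fun g hg hgb Y hY hYb k => ?_⟩
  obtain ⟨g₁, g₂, h1, h2, h3, h4, h5⟩ := hg.exists_antitone_sub hgb
  have hYk : Measurable fun x => Y ((Tmap γ)^[k] x) := hY.comp (measurable_Tmap_iterate γ k)
  have hi : ∀ w : ℝ → ℝ, Antitone w → (∀ x, w x ∈ Icc (0:ℝ) 2) → Integrable w ν :=
    fun w hw hwb => Integrable.of_bound hw.measurable.aestronglyMeasurable 2
      (Eventually.of_forall fun x => abs_le.2 ⟨by linarith [(hwb x).1], (hwb x).2⟩)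
  have hi' : ∀ w : ℝ → ℝ, Antitone w → (∀ x, w x ∈ Icc (0:ℝ) 2) →
      Integrable (fun x => w x * Y ((Tmap γ)^[k] x)) ν := fun w hw hwb =>
    (hi w hw hwb).mul_bdd (c := 1) hYk.aestronglyMeasurable (Eventually.of_forall fun x => hYb _)
  simp only [h5, sub_mul]
  rw [integral_sub (hi' _ h1 h3) (hi' _ h2 h4), integral_sub (hi _ h1 h3) (hi _ h2 h4)]
  have k1 := h g₁ h1 h3 Y hY hYb k
  have k2 := h g₂ h2 h4 Y hY hYb k
  rw [abs_le] at k1 k2 ⊢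
  constructor <;> nlinarith

end Covariance

/-! ### A moment inequality for stationary sequences -/

lemma rpow_tangent_le {s a b : ℝ} (hs : 1 ≤ s) (ha : 0 ≤ a) (hb : 0 ≤ b) :
    a ^ s + s * a ^ (s - 1) * (b - a) ≤ b ^ s := by
  rcases ha.eq_or_lt with rfl | ha
  · rw [Real.zero_rpow (by linarith), sub_zero, zero_add]
    rcases hs.eq_or_lt with rfl | hs
    · simp
    · rw [Real.zero_rpow (by linarith)]
      simpa using Real.rpow_nonneg hb s
  · have h := one_add_mul_self_le_rpow_one_add (s := b / a - 1)
      (by linarith [div_nonneg hb ha.le]) hs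
    rw [add_sub_cancel, Real.div_rpow hb ha.le, le_div_iff₀ (Real.rpow_pos_of_pos ha s)] at h
    refine le_trans (le_of_eq ?_) h
    rw [Real.rpow_sub_one ha.ne']
    field_simp

/-- The signed power `|x|^{q-1} sign x`. -/
def signedPow (q x : ℝ) : ℝ := |x| ^ (q - 2) * x

lemma signedPow_neg (q x : ℝ) : signedPow q (-x) = - signedPow q x := by
  simp [signedPow]

lemma signedPow_zero (q : ℝ) : signedPow q 0 = 0 := by simp [signedPow]

lemma signedPow_of_nonneg {q x : ℝ} (hq : 2 ≤ q) (hx : 0 ≤ x) : signedPow q x = x ^ (q - 1) := by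
  rw [signedPow, abs_of_nonneg hx, show q - 1 = (q - 2) + 1 by ring,
    Real.rpow_add_one' hx (by linarith)]

lemma abs_signedPow {q : ℝ} (hq : 2 ≤ q) (x : ℝ) : |signedPow q x| = |x| ^ (q - 1) := by
  rw [signedPow, abs_mul, abs_of_nonneg (Real.rpow_nonneg (abs_nonneg x) _),
    show q - 1 = (q - 2) + 1 by ring, Real.rpow_add_one' (abs_nonneg x) (by linarith)]

lemma abs_rpow_sub_le {q : ℝ} (hq : 2 ≤ q) (a b : ℝ) :
    |a| ^ q - |b| ^ q ≤ q * signedPow q a * (a - b) := by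
  have h := rpow_tangent_le (s := q) (by linarith) (abs_nonneg a) (abs_nonneg b)
  have h1 : |a| ^ (q - 1) = |a| ^ (q - 2) * |a| := by
    rw [show q - 1 = (q - 2) + 1 by ring, Real.rpow_add_one' (abs_nonneg a) (by linarith)]
  have h2 : 0 ≤ |a| ^ (q - 2) := Real.rpow_nonneg (abs_nonneg a) _
  have h3 : a * b ≤ |a| * |b| := by rw [← abs_mul]; exact le_abs_self _
  have h4 : q * signedPow q a * (a - b) - q * |a| ^ (q - 1) * (|a| - |b|)
      = q * (|a| ^ (q - 2) * (|a| * |b| - a * b)) := by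
    rw [h1, signedPow]
    linear_combination (-q * |a| ^ (q - 2)) * (abs_mul_abs_self a)
  have h5 : 0 ≤ q * (|a| ^ (q - 2) * (|a| * |b| - a * b)) :=
    mul_nonneg (by linarith) (mul_nonneg h2 (by linarith))
  linarith

lemma abs_signedPow_sub_le {q : ℝ} (hq : 2 ≤ q) (a b : ℝ) :
    |signedPow q a - signedPow q b| ≤ (q - 1) * (|a - b| * (|a| ^ (q - 2) + |b| ^ (q - 2))) := by
  have same : ∀ a b : ℝ, 0 ≤ a → 0 ≤ b →
      |signedPow q a - signedPow q b| ≤ (q - 1) * (|a - b| * (|a| ^ (q - 2) + |b| ^ (q - 2))) := by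
    intro a b ha hb
    have h1 := rpow_tangent_le (s := q - 1) (by linarith) ha hb
    have h2 := rpow_tangent_le (s := q - 1) (by linarith) hb ha
    rw [show q - 1 - 1 = q - 2 by ring] at h1 h2
    rw [signedPow_of_nonneg hq ha, signedPow_of_nonneg hq hb, abs_of_nonneg ha, abs_of_nonneg hb]
    have hA := Real.rpow_nonneg ha (q - 2)
    have hB := Real.rpow_nonneg hb (q - 2)
    have hq1 : 0 ≤ q - 1 := by linarith
    have h3 := mul_le_mul_of_nonneg_left (le_abs_self (a - b)) (mul_nonneg hq1 hA)
    have h4 := mul_le_mul_of_nonneg_left (neg_abs_le (a - b)) (mul_nonneg hq1 hB)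
    have h5 := mul_nonneg (mul_nonneg hq1 hA) (abs_nonneg (a - b))
    have h6 := mul_nonneg (mul_nonneg hq1 hB) (abs_nonneg (a - b))
    rw [abs_le]
    constructor <;> nlinarith
  have opp : ∀ a b : ℝ, 0 ≤ a → 0 ≤ b →
      |signedPow q a - signedPow q (-b)| ≤
        (q - 1) * (|a - -b| * (|a| ^ (q - 2) + |(-b)| ^ (q - 2))) := by
    intro a b ha hb
    rw [signedPow_neg, sub_neg_eq_add, sub_neg_eq_add, abs_neg, signedPow, signedPow,
      abs_of_nonneg ha, abs_of_nonneg hb, abs_of_nonneg (add_nonneg ha hb)]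
    have hA := Real.rpow_nonneg ha (q - 2)
    have hB := Real.rpow_nonneg hb (q - 2)
    rw [abs_of_nonneg (by positivity)]
    have : 0 ≤ (a + b) * (a ^ (q - 2) + b ^ (q - 2)) := by positivity
    nlinarith [mul_nonneg ha hB, mul_nonneg hb hA]
  have flip : ∀ a b : ℝ, |signedPow q (-a) - signedPow q (-b)| = |signedPow q a - signedPow q b| := by
    intro a b
    rw [signedPow_neg, signedPow_neg, neg_sub_neg, abs_sub_comm]
  rcases le_total 0 a with ha | ha <;> rcases le_total 0 b with hb | hb
  · exact same a b ha hb
  · simpa only [neg_neg] using opp a (-b) ha (by linarith)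
  · have := opp (-a) b (by linarith) hb
    rwa [flip, neg_sub_neg, abs_sub_comm b, abs_neg, abs_neg] at this
  · have := same (-a) (-b) (by linarith) (by linarith)
    rwa [flip, neg_sub_neg, abs_sub_comm b, abs_neg, abs_neg] at this

variable {Ω : Type*} [MeasurableSpace Ω] {μ : Measure Ω} [IsProbabilityMeasure μ]

lemma integrable_of_abs_le {g : Ω → ℝ} (hg : Measurable g) {c : ℝ} (hb : ∀ x, |g x| ≤ c) :
    Integrable g μ :=
  Integrable.of_bound hg.aestronglyMeasurable c (Eventually.of_forall hb)

lemma abs_rpow_le_rpow {x c s : ℝ} (hs : 0 ≤ s) (h : |x| ≤ c) : abs (|x| ^ s) ≤ c ^ s := by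
  rw [abs_of_nonneg (Real.rpow_nonneg (abs_nonneg x) s)]
  exact Real.rpow_le_rpow (abs_nonneg x) h hs

/-- Hölder's inequality for powers of bounded functions. -/
lemma integral_abs_rpow_mul_le {f g : Ω → ℝ} (hf : Measurable f) (hg : Measurable g) {c d : ℝ}
    (hfb : ∀ x, |f x| ≤ c) (hgb : ∀ x, |g x| ≤ d) {a b s t : ℝ} (hs : 0 < s) (ht : 0 < t)
    (ha : 0 ≤ a) (hb : 0 ≤ b) (hab : a + b = 1) :
    ∫ x, |f x| ^ (s * a) * |g x| ^ (t * b) ∂μ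
      ≤ (∫ x, |f x| ^ s ∂μ) ^ a * (∫ x, |g x| ^ t ∂μ) ^ b := by
  have i1 : Integrable (fun x => |f x| ^ s) μ :=
    integrable_of_abs_le (hf.norm.pow_const s) fun x => abs_rpow_le_rpow hs.le (hfb x)
  have i2 : Integrable (fun x => |g x| ^ t) μ :=
    integrable_of_abs_le (hg.norm.pow_const t) fun x => abs_rpow_le_rpow ht.le (hgb x)
  have n1 : ∀ x, 0 ≤ |f x| ^ s := fun x => Real.rpow_nonneg (abs_nonneg _) _
  have n2 : ∀ x, 0 ≤ |g x| ^ t := fun x => Real.rpow_nonneg (abs_nonneg _) _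
  have h := ENNReal.lintegral_mul_norm_pow_le (μ := μ) (f := fun x => ENNReal.ofReal (|f x| ^ s))
    (g := fun x => ENNReal.ofReal (|g x| ^ t)) (hf.norm.pow_const s).ennreal_ofReal.aemeasurable
    (hg.norm.pow_const t).ennreal_ofReal.aemeasurable ha hb hab
  rw [← ofReal_integral_eq_lintegral_ofReal i1 (Eventually.of_forall n1),
    ← ofReal_integral_eq_lintegral_ofReal i2 (Eventually.of_forall n2),
    ENNReal.ofReal_rpow_of_nonneg (integral_nonneg n1) ha,
    ENNReal.ofReal_rpow_of_nonneg (integral_nonneg n2) hb,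
    ← ENNReal.ofReal_mul (Real.rpow_nonneg (integral_nonneg n1) _)] at h
  have e : ∀ x, ENNReal.ofReal (|f x| ^ s) ^ a * ENNReal.ofReal (|g x| ^ t) ^ b
      = ENNReal.ofReal (|f x| ^ (s * a) * |g x| ^ (t * b)) := fun x => by
    rw [ENNReal.ofReal_rpow_of_nonneg (n1 x) ha, ENNReal.ofReal_rpow_of_nonneg (n2 x) hb,
      ← ENNReal.ofReal_mul (Real.rpow_nonneg (n1 x) _), ← Real.rpow_mul (abs_nonneg _),
      ← Real.rpow_mul (abs_nonneg _)]
  simp only [e] at h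
  rw [← ofReal_integral_eq_lintegral_ofReal] at h
  · exact (ENNReal.ofReal_le_ofReal_iff (mul_nonneg (Real.rpow_nonneg (integral_nonneg n1) _)
      (Real.rpow_nonneg (integral_nonneg n2) _))).1 h
  · refine integrable_of_abs_le (c := c ^ (s * a) * d ^ (t * b)) ((hf.norm.pow_const _).mul
      (hg.norm.pow_const _)) fun x => ?_
    rw [abs_mul]
    exact mul_le_mul (abs_rpow_le_rpow (by positivity) (hfb x))
      (abs_rpow_le_rpow (by positivity) (hgb x)) (abs_nonneg _)
      (Real.rpow_nonneg ((abs_nonneg _).trans (hfb x)) _)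
  · exact Eventually.of_forall fun x => by positivity

section Birkhoff
variable {Ω : Type*} {T : Ω → Ω} {f : Ω → ℝ}

lemma abs_birkhoffSum_le {c : ℝ} (hfb : ∀ x, |f x| ≤ c) (n : ℕ) (x : Ω) :
    |birkhoffSum T f n x| ≤ n * c := by
  refine (Finset.abs_sum_le_sum_abs _ _).trans ?_
  refine (Finset.sum_le_sum fun k _ => hfb _).trans ?_
  simp

/-- Increment of the (rescaled) signed power along a Birkhoff sum when its first term is added. -/
def birkhoffIncr (T : Ω → Ω) (f : Ω → ℝ) (q : ℝ) (i : ℕ) (x : Ω) : ℝ :=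
  q * (signedPow q (birkhoffSum T f (i + 1) x) - signedPow q (birkhoffSum T f i (T x)))

lemma abs_birkhoffIncr_le {q : ℝ} (hq : 2 ≤ q) (i : ℕ) (x : Ω) :
    |birkhoffIncr T f q i x| ≤ q * (q - 1) * (|f x| *
      (|birkhoffSum T f (i + 1) x| ^ (q - 2) + |birkhoffSum T f i (T x)| ^ (q - 2))) := by
  have h := abs_signedPow_sub_le hq (birkhoffSum T f (i + 1) x) (birkhoffSum T f i (T x))
  have e : birkhoffSum T f (i + 1) x - birkhoffSum T f i (T x) = f x := by
    rw [birkhoffSum_succ']; ring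
  rw [e] at h
  rw [birkhoffIncr, abs_mul, abs_of_nonneg (by linarith : 0 ≤ q), mul_assoc]
  exact mul_le_mul_of_nonneg_left h (by linarith)

lemma signedPow_birkhoffSum_eq_sum (q : ℝ) (j : ℕ) (x : Ω) :
    q * signedPow q (birkhoffSum T f (j + 1) x)
      = ∑ k ∈ Finset.range (j + 1), birkhoffIncr T f q (j - k) (T^[k] x) := by
  have h := Finset.sum_range_sub'
    (fun k => q * signedPow q (birkhoffSum T f (j + 1 - k) (T^[k] x))) (j + 1)
  simp only [Nat.sub_zero, Function.iterate_zero, id, Nat.sub_self, birkhoffSum_zero,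
    signedPow_zero, mul_zero, sub_zero] at h
  rw [← h]
  refine Finset.sum_congr rfl fun k hk => ?_
  have hk' : k ≤ j := Nat.lt_succ_iff.1 (Finset.mem_range.1 hk)
  rw [birkhoffIncr, ← mul_sub, Nat.succ_sub hk', Nat.add_sub_add_right,
    Function.iterate_succ_apply']

lemma abs_signedPow_le {q c x : ℝ} (hq : 2 ≤ q) (h : |x| ≤ c) : |signedPow q x| ≤ c ^ (q - 1) := by
  rw [abs_signedPow hq]
  exact Real.rpow_le_rpow (abs_nonneg _) h (by linarith)

lemma birkhoffIncr_bdd {q c : ℝ} (hq : 2 ≤ q) (hfb : ∀ x, |f x| ≤ c) (i : ℕ) :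
    ∃ d, ∀ x, |birkhoffIncr T f q i x| ≤ d := by
  refine ⟨q * (((i + 1 : ℕ) * c) ^ (q - 1) + (i * c) ^ (q - 1)), fun x => ?_⟩
  rw [birkhoffIncr, abs_mul, abs_of_nonneg (by linarith : 0 ≤ q)]
  refine mul_le_mul_of_nonneg_left ((norm_sub_le (_ : ℝ) _).trans (add_le_add ?_ ?_)) (by linarith)
  · exact abs_signedPow_le hq (abs_birkhoffSum_le hfb _ _)
  · exact abs_signedPow_le hq (abs_birkhoffSum_le hfb _ _)

end Birkhoff

section Moment
variable {Ω : Type*} [MeasurableSpace Ω] {μ : Measure Ω} {T : Ω → Ω} {f : Ω → ℝ}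

lemma measurable_birkhoffSum (hT : Measurable T) (hf : Measurable f) (n : ℕ) :
    Measurable (birkhoffSum T f n) := by
  unfold birkhoffSum
  exact Finset.measurable_sum _ fun k _ => hf.comp (hT.iterate k)

lemma integral_comp_of_measurePreserving (hT : MeasurePreserving T μ μ) {g : Ω → ℝ}
    (hg : Measurable g) : ∫ x, g (T x) ∂μ = ∫ x, g x ∂μ := by
  conv_rhs => rw [← hT.map_eq]
  rw [integral_map hT.measurable.aemeasurable hg.aestronglyMeasurable]

lemma measurable_signedPow (q : ℝ) : Measurable (signedPow q) :=
  (measurable_norm.pow_const _).mul measurable_id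

lemma measurable_birkhoffIncr (hT : Measurable T) (hf : Measurable f) (q : ℝ) (i : ℕ) :
    Measurable (birkhoffIncr T f q i) :=
  (((measurable_signedPow q).comp (measurable_birkhoffSum hT hf _)).sub
    ((measurable_signedPow q).comp ((measurable_birkhoffSum hT hf _).comp hT))).const_mul q

lemma integral_birkhoffIncr_rpow_le [IsProbabilityMeasure μ] (hT : MeasurePreserving T μ μ) (hf : Measurable f) {c : ℝ}
    (hfb : ∀ x, |f x| ≤ c) {q p r : ℝ} (hq : 2 ≤ q) (hp : 0 < p) (hr : 0 < r)
    (hpr : r / p + r * (q - 2) / q = 1) {A W : ℝ} (hA : 0 ≤ A) (hW : 0 ≤ W)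
    (hfA : ∫ x, |f x| ^ p ∂μ ≤ A ^ p) {i : ℕ}
    (h1 : ∫ x, |birkhoffSum T f (i + 1) x| ^ q ∂μ ≤ W)
    (h2 : ∫ x, |birkhoffSum T f i x| ^ q ∂μ ≤ W) :
    ∫ x, |birkhoffIncr T f q i x| ^ r ∂μ
      ≤ (2 * (q * (q - 1)) * 2 ^ (1 / r) * A * W ^ (1 - 2 / q)) ^ r := by
  have hq0 : 0 < q := by linarith
  have hq1 : 0 < q - 1 := by linarith
  have hcq : 0 < q * (q - 1) := by positivity
  set S := birkhoffSum T f (i + 1) with hS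
  set S' : Ω → ℝ := fun x => birkhoffSum T f i (T x) with hS'
  have hSm : Measurable S := measurable_birkhoffSum hT.measurable hf _
  have hSm' : Measurable S' := (measurable_birkhoffSum hT.measurable hf _).comp hT.measurable
  have hSb : ∀ x, |S x| ≤ (i + 1 : ℕ) * c := fun x => abs_birkhoffSum_le hfb _ _
  have hSb' : ∀ x, |S' x| ≤ i * c := fun x => abs_birkhoffSum_le hfb _ _
  have h2' : ∫ x, |S' x| ^ q ∂μ ≤ W :=
    (integral_comp_of_measurePreserving hT
      ((measurable_birkhoffSum hT.measurable hf i).norm.pow_const q)).trans_le h2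
  have hq2 : 0 ≤ q - 2 := by linarith
  have hrq : 0 ≤ r * (q - 2) := by positivity
  have hölder : ∀ (U : Ω → ℝ) (d : ℝ), Measurable U → (∀ x, |U x| ≤ d) → ∫ x, |U x| ^ q ∂μ ≤ W →
      ∫ x, |f x| ^ r * |U x| ^ (r * (q - 2)) ∂μ ≤ (A * W ^ (1 - 2 / q)) ^ r := by
    intro U d hU hUb hUW
    have h := integral_abs_rpow_mul_le (μ := μ) hf hU hfb hUb hp hq0 (a := r / p)
      (b := r * (q - 2) / q) (by positivity) (by positivity) hpr
    rw [mul_div_cancel₀ _ hp.ne', mul_div_cancel₀ _ hq0.ne'] at h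
    refine h.trans ?_
    have e1 : A ^ r = (A ^ p) ^ (r / p) := by
      rw [← Real.rpow_mul hA, mul_div_cancel₀ _ hp.ne']
    have e2 : (W ^ (1 - 2 / q)) ^ r = W ^ (r * (q - 2) / q) := by
      rw [← Real.rpow_mul hW]
      congr 1
      field_simp
    rw [Real.mul_rpow hA (Real.rpow_nonneg hW _), e1, e2]
    have n1 : 0 ≤ ∫ x, |f x| ^ p ∂μ := integral_nonneg fun x => by positivity
    have n2 : 0 ≤ ∫ x, |U x| ^ q ∂μ := integral_nonneg fun x => by positivity
    gcongr
  have k1 := hölder S _ hSm hSb h1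
  have k2 := hölder S' _ hSm' hSb' h2'
  have hint : ∀ (U : Ω → ℝ) (d : ℝ), Measurable U → (∀ x, |U x| ≤ d) →
      Integrable (fun x => |f x| ^ r * |U x| ^ (r * (q - 2))) μ := fun U d hU hUb => by
    refine integrable_of_abs_le (c := c ^ r * d ^ (r * (q - 2))) ((hf.norm.pow_const _).mul
      (hU.norm.pow_const _)) fun x => ?_
    rw [abs_mul]
    exact mul_le_mul (abs_rpow_le_rpow (by positivity) (hfb x))
      (abs_rpow_le_rpow (by positivity) (hUb x)) (abs_nonneg _)
      (Real.rpow_nonneg ((abs_nonneg _).trans (hfb x)) _)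
  have hpt : ∀ x, |birkhoffIncr T f q i x| ^ r ≤ (2 * (q * (q - 1))) ^ r *
      (|f x| ^ r * |S x| ^ (r * (q - 2)) + |f x| ^ r * |S' x| ^ (r * (q - 2))) := by
    intro x
    have hX : 0 ≤ |S x| ^ (q - 2) := by positivity
    have hY : 0 ≤ |S' x| ^ (q - 2) := by positivity
    have hb : |birkhoffIncr T f q i x| ≤ 2 * (q * (q - 1)) *
        (|f x| * max (|S x| ^ (q - 2)) (|S' x| ^ (q - 2))) := by
      refine (abs_birkhoffIncr_le hq i x).trans ?_
      have : |S x| ^ (q - 2) + |S' x| ^ (q - 2)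
          ≤ 2 * max (|S x| ^ (q - 2)) (|S' x| ^ (q - 2)) := by
        linarith [le_max_left (|S x| ^ (q - 2)) (|S' x| ^ (q - 2)),
          le_max_right (|S x| ^ (q - 2)) (|S' x| ^ (q - 2))]
      calc _ ≤ q * (q - 1) * (|f x| * (2 * max (|S x| ^ (q - 2)) (|S' x| ^ (q - 2)))) := by
            gcongr
        _ = _ := by ring
    have hm : 0 ≤ max (|S x| ^ (q - 2)) (|S' x| ^ (q - 2)) := hX.trans (le_max_left _ _)
    calc |birkhoffIncr T f q i x| ^ r
        ≤ (2 * (q * (q - 1)) * (|f x| * max (|S x| ^ (q - 2)) (|S' x| ^ (q - 2)))) ^ r := by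
          gcongr
      _ = (2 * (q * (q - 1))) ^ r *
          (|f x| ^ r * (max (|S x| ^ (q - 2)) (|S' x| ^ (q - 2))) ^ r) := by
          rw [Real.mul_rpow (by positivity) (by positivity), Real.mul_rpow (by positivity) hm]
      _ ≤ (2 * (q * (q - 1))) ^ r *
          (|f x| ^ r * (|S x| ^ (r * (q - 2)) + |S' x| ^ (r * (q - 2)))) := by
          gcongr
          have e : ∀ y : ℝ, |y| ^ (r * (q - 2)) = (|y| ^ (q - 2)) ^ r := fun y => by
            rw [← Real.rpow_mul (abs_nonneg y), mul_comm]
          rw [e, e]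
          have hXr := Real.rpow_nonneg hX r
          have hYr := Real.rpow_nonneg hY r
          rcases max_choice (|S x| ^ (q - 2)) (|S' x| ^ (q - 2)) with h | h <;> rw [h] <;> linarith
      _ = _ := by ring
  have hmono := integral_mono_of_nonneg (μ := μ) (Eventually.of_forall fun x => by positivity)
    (((hint S _ hSm hSb).add (hint S' _ hSm' hSb')).const_mul ((2 * (q * (q - 1))) ^ r))
    (Eventually.of_forall hpt)
  refine hmono.trans ?_
  simp only [Pi.add_apply]
  rw [integral_const_mul, integral_add (hint S _ hSm hSb) (hint S' _ hSm' hSb')]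
  have hAW : 0 ≤ A * W ^ (1 - 2 / q) := mul_nonneg hA (Real.rpow_nonneg hW _)
  have e3 : (2 * (q * (q - 1)) * 2 ^ (1 / r) * A * W ^ (1 - 2 / q)) ^ r
      = (2 * (q * (q - 1))) ^ r * (2 * (A * W ^ (1 - 2 / q)) ^ r) := by
    rw [mul_assoc _ A, Real.mul_rpow (by positivity) hAW, Real.mul_rpow (by positivity)
      (by positivity), ← Real.rpow_mul (by norm_num), one_div, inv_mul_cancel₀ hr.ne',
      Real.rpow_one]
    ring
  rw [e3]
  gcongr
  linarith

/-- A Rio-type inequality: the moment of order `q` of Birkhoff sums is controlled by the covariances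
between the observable and functions of the future. -/
theorem birkhoffSum_moment_le [IsProbabilityMeasure μ] (hT : MeasurePreserving T μ μ) (hf : Measurable f) {c : ℝ}
    (hfb : ∀ x, |f x| ≤ c) {q p r : ℝ} (hq : 2 ≤ q) (hp : 0 < p) (hr : 0 < r)
    (hpr : r / p + r * (q - 2) / q = 1) {A : ℝ} (hA : 0 < A)
    (hfA : ∫ x, |f x| ^ p ∂μ ≤ A ^ p) {D : ℕ → ℝ} (hD : ∀ k, 0 ≤ D k)
    (hcov : ∀ (k : ℕ) (G : Ω → ℝ) (B : ℝ), Measurable G → (∃ d, ∀ x, |G x| ≤ d) → 0 < B →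
      ∫ x, |G x| ^ r ∂μ ≤ B ^ r → |∫ x, f x * G (T^[k] x) ∂μ| ≤ D k * B) (n : ℕ) :
    ∫ x, |birkhoffSum T f n x| ^ q ∂μ
      ≤ (2 * (q * (q - 1)) * 2 ^ (1 / r) * A * (n * ∑ k ∈ Finset.range n, D k)) ^ (q / 2) := by
  have hq0 : 0 < q := by linarith
  have hq1 : 0 < q - 1 := by linarith
  set V : ℕ → ℝ := fun j => ∫ x, |birkhoffSum T f j x| ^ q ∂μ with hV
  have hV0 : ∀ j, 0 ≤ V j := fun j => integral_nonneg fun x => by positivity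
  obtain ⟨j₀, hj₀, hmax⟩ := Finset.exists_max_image (Finset.range (n + 1)) V ⟨0, by simp⟩
  have hmax' : ∀ j ≤ n, V j ≤ V j₀ := fun j hj => hmax j (Finset.mem_range.2 (by omega))
  set W := V j₀ with hWdef
  have hW : 0 ≤ W := hV0 j₀
  set Δ := ∑ k ∈ Finset.range n, D k with hΔ
  have hΔ0 : 0 ≤ Δ := Finset.sum_nonneg fun k _ => hD k
  set K := 2 * (q * (q - 1)) * 2 ^ (1 / r) * A with hK
  have hK0 : 0 < K := by positivity
  have hR : 0 ≤ K * (n * Δ) := by positivity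
  refine (hmax' n le_rfl).trans ?_
  rcases hW.eq_or_lt with h0 | hW0
  · rw [← h0]; positivity
  set B := K * W ^ (1 - 2 / q) with hB
  have hB0 : 0 < B := mul_pos hK0 (Real.rpow_pos_of_pos hW0 _)
  have hSm := measurable_birkhoffSum hT.measurable hf
  have hSi : ∀ j, Integrable (fun x => |birkhoffSum T f j x| ^ q) μ := fun j =>
    integrable_of_abs_le ((hSm j).norm.pow_const q)
      fun x => abs_rpow_le_rpow hq0.le (abs_birkhoffSum_le hfb j x)
  have hstep : ∀ j, j + 1 ≤ n → V (j + 1) - V j ≤ Δ * B := by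
    intro j hj
    have hVj : V j = ∫ x, |birkhoffSum T f j (T x)| ^ q ∂μ :=
      (integral_comp_of_measurePreserving hT ((hSm j).norm.pow_const q)).symm
    have hSTi : Integrable (fun x => |birkhoffSum T f j (T x)| ^ q) μ :=
      integrable_of_abs_le (((hSm j).comp hT.measurable).norm.pow_const q)
        fun x => abs_rpow_le_rpow hq0.le (abs_birkhoffSum_le hfb j _)
    have hGi : ∀ k, Integrable (fun x => f x * birkhoffIncr T f q (j - k) (T^[k] x)) μ := by
      intro k
      obtain ⟨d, hd⟩ := birkhoffIncr_bdd (T := T) hq hfb (j - k)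
      refine integrable_of_abs_le (c := c * d) (hf.mul
        ((measurable_birkhoffIncr hT.measurable hf q _).comp (hT.measurable.iterate k)))
        fun x => ?_
      rw [abs_mul]
      exact mul_le_mul (hfb x) (hd _) (abs_nonneg _) ((abs_nonneg _).trans (hfb x))
    have hle : V (j + 1) - V j
        ≤ ∫ x, ∑ k ∈ Finset.range (j + 1), f x * birkhoffIncr T f q (j - k) (T^[k] x) ∂μ := by
      rw [hVj, hV]
      simp only
      rw [← integral_sub (hSi _) hSTi]
      refine integral_mono ((hSi _).sub hSTi) (integrable_finsetSum _ fun k _ => hGi k) fun x => ?_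
      have h1 := abs_rpow_sub_le hq (birkhoffSum T f (j + 1) x) (birkhoffSum T f j (T x))
      have e : birkhoffSum T f (j + 1) x - birkhoffSum T f j (T x) = f x := by
        rw [birkhoffSum_succ']; ring
      rw [e, signedPow_birkhoffSum_eq_sum, mul_comm, Finset.mul_sum] at h1
      exact h1
    refine hle.trans ?_
    rw [integral_finsetSum _ fun k _ => hGi k]
    calc ∑ k ∈ Finset.range (j + 1), ∫ x, f x * birkhoffIncr T f q (j - k) (T^[k] x) ∂μ
        ≤ ∑ k ∈ Finset.range (j + 1), D k * B := by
          refine Finset.sum_le_sum fun k hk => (le_abs_self _).trans ?_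
          refine hcov k _ B (measurable_birkhoffIncr hT.measurable hf q _)
            (birkhoffIncr_bdd hq hfb _) hB0 ?_
          exact integral_birkhoffIncr_rpow_le hT hf hfb hq hp hr hpr hA.le hW hfA
            (hmax' _ (by omega)) (hmax' _ (by omega))
      _ ≤ ∑ k ∈ Finset.range n, D k * B :=
          Finset.sum_le_sum_of_subset_of_nonneg (Finset.range_mono hj)
            fun k _ _ => mul_nonneg (hD k) hB0.le
      _ = Δ * B := by rw [hΔ, Finset.sum_mul]
  have hVle : ∀ j ≤ n, V j ≤ j * (Δ * B) := by
    intro j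
    induction j with
    | zero => intro _; simp [hV, hq0.ne']
    | succ j ih =>
      intro hj
      have := ih (by omega)
      have := hstep j hj
      push_cast
      linarith
  have hj₀n : j₀ ≤ n := Nat.lt_succ_iff.1 (Finset.mem_range.1 hj₀)
  have hWle : W ≤ K * (n * Δ) * W ^ (1 - 2 / q) := by
    calc W ≤ j₀ * (Δ * B) := hVle j₀ hj₀n
      _ ≤ n * (Δ * B) := by gcongr
      _ = _ := by rw [hB]; ring
  have h1 : W ^ (2 / q) ≤ K * (n * Δ) := by
    have h2 : W = W ^ (2 / q) * W ^ (1 - 2 / q) := by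
      rw [← Real.rpow_add hW0, add_sub_cancel, Real.rpow_one]
    nth_rewrite 1 [h2] at hWle
    exact le_of_mul_le_mul_right hWle (Real.rpow_pos_of_pos hW0 _)
  calc W = (W ^ (2 / q)) ^ (q / 2) := by
        rw [← Real.rpow_mul hW, div_mul_div_cancel₀ hq0.ne', div_self two_ne_zero, Real.rpow_one]
    _ ≤ _ := by gcongr

end Moment

/-! ### From bounded observables to observables with moments -/

lemma abs_sub_clip_le_rpow {s p x : ℝ} (hs : 0 < s) (hp : 1 ≤ p) :
    |x - clip s x| ≤ s * (|x| / s) ^ p := by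
  rcases le_or_gt |x| s with h | h
  · rw [clip_eq_self h, sub_self, abs_zero]; positivity
  · have h1 : 1 ≤ |x| / s := (one_le_div hs).2 h.le
    calc |x - clip s x| ≤ |x| := abs_sub_clip_le hs.le x
      _ = s * (|x| / s) ^ (1:ℝ) := by rw [Real.rpow_one, mul_div_cancel₀ _ hs.ne']
      _ ≤ _ := by gcongr

lemma mul_le_rpow_add_rpow {p r x y : ℝ} (hp : 1 < p) (hr : 0 < r) (hpr : 1 / p + 1 / r ≤ 1)
    (hx : 0 ≤ x) (hy : 0 ≤ y) (hxy : 1 < x ∨ 1 < y) : x * y ≤ x ^ p + y ^ r := by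
  have hp0 : 0 < p := by linarith
  have hr1 : 1 ≤ r := by
    have : 1 / r ≤ 1 := by linarith [one_div_pos.2 hp0]
    rwa [div_le_one hr] at this
  have hxp := Real.rpow_nonneg hx p
  have hyr := Real.rpow_nonneg hy r
  rcases le_or_gt y 1 with h1 | h1
  · have hx1 : 1 < x := hxy.resolve_right h1.not_gt
    have := Real.self_le_rpow_of_one_le hx1.le hp.le
    nlinarith
  rcases le_or_gt x 1 with h2 | h2
  · have := Real.self_le_rpow_of_one_le h1.le hr1
    nlinarith
  have hc : p.HolderConjugate p.conjExponent := Real.HolderConjugate.conjExponent hp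
  have hY := Real.young_inequality_of_nonneg hx hy hc
  have hc0 : 0 < p.conjExponent := hc.symm.pos
  have hinv := hc.inv_add_inv_eq_one
  have hcr : p.conjExponent ≤ r := by
    rw [← inv_le_inv₀ hr hc0]
    rw [one_div, one_div] at hpr
    linarith
  have h3 : y ^ p.conjExponent ≤ y ^ r := Real.rpow_le_rpow_of_exponent_le h1.le hcr
  have h4 : x ^ p / p ≤ x ^ p := div_le_self hxp hp.le
  have h5 : y ^ p.conjExponent / p.conjExponent ≤ y ^ p.conjExponent :=
    div_le_self (Real.rpow_nonneg hy _) hc.symm.lt.le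
  linarith

lemma abs_mul_sub_clip_mul_clip_le {s L p r x y : ℝ} (hs : 0 < s) (hL : 0 < L) (hp : 1 < p)
    (hr : 0 < r) (hpr : 1 / p + 1 / r ≤ 1) :
    |x * y - clip s x * clip L y| ≤ s * L * ((|x| / s) ^ p + (|y| / L) ^ r) := by
  by_cases h : |x| ≤ s ∧ |y| ≤ L
  · rw [clip_eq_self h.1, clip_eq_self h.2, sub_self, abs_zero]; positivity
  · have h1 : |x * y - clip s x * clip L y| ≤ |x * y| := by
      have key : ∀ {s x : ℝ}, 0 ≤ s → ∃ t, 0 ≤ t ∧ t ≤ 1 ∧ clip s x = t * x := by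
        intro s x hs
        by_cases hx : x = 0
        · exact ⟨0, le_rfl, zero_le_one, by rw [hx, clip_zero hs, mul_zero]⟩
        refine ⟨clip s x / x, ?_, ?_, by field_simp⟩
        · rcases le_total 0 x with h | h
          · exact div_nonneg (by rw [← clip_zero hs]; exact clip_mono s h) h
          · exact div_nonneg_of_nonpos (by rw [← clip_zero hs]; exact clip_mono s h) h
        · refine (le_abs_self _).trans ?_
          rw [abs_div]
          exact div_le_one_of_le₀ (abs_clip_le_abs hs x) (abs_nonneg _)
      obtain ⟨a, ha0, ha1, ha⟩ := key (x := x) hs.le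
      obtain ⟨b, hb0, hb1, hb⟩ := key (x := y) hL.le
      rw [ha, hb, show x * y - a * x * (b * y) = (1 - a * b) * (x * y) by ring, abs_mul]
      refine mul_le_of_le_one_left (abs_nonneg _) (abs_le.2 ⟨?_, ?_⟩) <;> nlinarith
    refine h1.trans ?_
    have h2 := mul_le_rpow_add_rpow hp hr hpr (div_nonneg (abs_nonneg x) hs.le)
      (div_nonneg (abs_nonneg y) hL.le) (by
        rw [one_lt_div hs, one_lt_div hL]
        by_contra! hcon
        exact h hcon)
    calc |x * y| = s * L * (|x| / s * (|y| / L)) := by rw [abs_mul]; field_simp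
      _ ≤ _ := by gcongr

section Cov
variable {Ω : Type*} [MeasurableSpace Ω] {μ : Measure Ω} [IsProbabilityMeasure μ] {U : Ω → Ω}

lemma abs_integral_le_of_abs_le {g : Ω → ℝ} {c : ℝ} (hb : ∀ x, |g x| ≤ c) :
    |∫ x, g x ∂μ| ≤ c := by
  have := norm_integral_le_of_norm_le (μ := μ) (f := g) (integrable_const c)
    (Eventually.of_forall hb)
  simpa using this

lemma covariance_le_of_truncated (hU : MeasurePreserving U μ μ) {g : Ω → ℝ} (hg : Measurable g)
    {c : ℝ} (hgb : ∀ x, |g x| ≤ c) {p r A B C α : ℝ} (hp : 1 < p) (hr : 0 < r)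
    (hpr : 1 / p + 1 / r ≤ 1) (hA : 0 < A) (hB : 0 < B) (hα : 0 < α) (hα1 : α ≤ 1)
    (hcov : ∀ s : ℝ, 0 < s → ∀ Y : Ω → ℝ, Measurable Y → (∀ x, |Y x| ≤ 1) →
      |(∫ x, clip s (g x) * Y (U x) ∂μ) - (∫ x, clip s (g x) ∂μ) * ∫ x, Y x ∂μ| ≤ s * (C * α))
    (hgA : ∫ x, |g x| ^ p ∂μ ≤ A ^ p) {G : Ω → ℝ} (hG : Measurable G) {d : ℝ}
    (hGb : ∀ x, |G x| ≤ d) (hGB : ∫ x, |G x| ^ r ∂μ ≤ B ^ r) :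
    |(∫ x, g x * G (U x) ∂μ) - (∫ x, g x ∂μ) * ∫ x, G x ∂μ|
      ≤ (C + 5) * A * α ^ (1 - 1 / p - 1 / r) * B := by
  have hp0 : 0 < p := by linarith
  have hr1 : 1 ≤ r := by
    have : 1 / r ≤ 1 := by linarith [one_div_pos.2 hp0]
    rwa [div_le_one hr] at this
  set s := A * α ^ (-(1 / p)) with hs_def
  set L := B * α ^ (-(1 / r)) with hL_def
  have hs : 0 < s := by positivity
  have hL : 0 < L := by positivity
  have hsL : s * L * α = A * α ^ (1 - 1 / p - 1 / r) * B := by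
    rw [hs_def, hL_def, show 1 - 1 / p - 1 / r = -(1 / p) + -(1 / r) + 1 by ring,
      Real.rpow_add hα, Real.rpow_add hα, Real.rpow_one]
    ring
  have norm_le : ∀ {f : Ω → ℝ} {p A s : ℝ}, 0 < p → 0 < A → s = A * α ^ (-(1 / p)) →
      ∫ x, |f x| ^ p ∂μ ≤ A ^ p → ∫ x, (|f x| / s) ^ p ∂μ ≤ α := by
    intro f p A s hp hA hs h
    have hs0 : 0 < s := by rw [hs]; positivity
    have e : ∀ x, (|f x| / s) ^ p = |f x| ^ p / s ^ p := fun x =>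
      Real.div_rpow (abs_nonneg _) hs0.le _
    simp only [e]
    rw [integral_div, div_le_iff₀ (by positivity)]
    refine h.trans (le_of_eq ?_)
    rw [hs, Real.mul_rpow hA.le (by positivity), ← Real.rpow_mul hα.le,
      show -(1 / p) * p = -1 by field_simp, Real.rpow_neg_one]
    field_simp
  have kx := norm_le hp0 hA hs_def hgA
  have ky := norm_le hr hB hL_def hGB
  have kyU : ∫ x, (|G (U x)| / L) ^ r ∂μ ≤ α :=
    (integral_comp_of_measurePreserving hU ((hG.norm.div_const L).pow_const r)).trans_le ky
  have hGU : Measurable fun x => G (U x) := hG.comp hU.measurable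
  have cm : ∀ {f : Ω → ℝ} (s : ℝ), Measurable f → Measurable fun x => clip s (f x) :=
    fun s hf => (continuous_clip s).measurable.comp hf
  have ipow : ∀ {f : Ω → ℝ} {c s p : ℝ}, Measurable f → (∀ x, |f x| ≤ c) → 0 < s → 0 < p →
      Integrable (fun x => (|f x| / s) ^ p) μ := by
    intro f c s p hf hb hs hp
    refine integrable_of_abs_le (c := (c / s) ^ p) ((hf.norm.div_const s).pow_const p) fun x => ?_
    rw [abs_of_nonneg (by positivity)]
    have := hb x
    gcongr
  have ix := ipow hg hgb hs hp0
  have iy := ipow hG hGb hL hr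
  have iyU := ipow hGU (fun x => hGb (U x)) hL hr
  have imul : ∀ {f h : Ω → ℝ} {c d : ℝ}, Measurable f → Measurable h → (∀ x, |f x| ≤ c) →
      (∀ x, |h x| ≤ d) → Integrable (fun x => f x * h x) μ := by
    intro f h c d hf hh hfb hhb
    refine integrable_of_abs_le (c := c * d) (hf.mul hh) fun x => ?_
    rw [abs_mul]
    exact mul_le_mul (hfb x) (hhb x) (abs_nonneg _) ((abs_nonneg _).trans (hfb x))
  have ig : Integrable g μ := integrable_of_abs_le hg hgb
  have iG : Integrable G μ := integrable_of_abs_le hG hGb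
  have igs := integrable_of_abs_le (μ := μ) (cm s hg) fun x => abs_clip_le hs.le (g x)
  have iGL := integrable_of_abs_le (μ := μ) (cm L hG) fun x => abs_clip_le hL.le (G x)
  have h1 : |(∫ x, g x * G (U x) ∂μ) - ∫ x, clip s (g x) * clip L (G (U x)) ∂μ| ≤ 2 * (s * L * α) := by
    rw [← integral_sub (imul hg hGU hgb fun x => hGb (U x))
      (imul (cm s hg) (cm L hGU) (fun x => abs_clip_le hs.le _) fun x => abs_clip_le hL.le _)]
    refine (norm_integral_le_of_norm_le (f := fun x => g x * G (U x) - clip s (g x) * clip L (G (U x)))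
      ((ix.add iyU).const_mul (s * L))
      (Eventually.of_forall fun x => abs_mul_sub_clip_mul_clip_le hs hL hp hr hpr)).trans ?_
    simp only [Pi.add_apply]
    rw [integral_const_mul, integral_add ix iyU]
    have : s * L * ((∫ x, (|g x| / s) ^ p ∂μ) + ∫ x, (|G (U x)| / L) ^ r ∂μ)
        ≤ s * L * (α + α) := by gcongr
    linarith
  have h2 : |(∫ x, g x ∂μ) - ∫ x, clip s (g x) ∂μ| ≤ s * α := by
    rw [← integral_sub ig igs]
    refine (norm_integral_le_of_norm_le (f := fun x => g x - clip s (g x)) (ix.const_mul s)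
      (Eventually.of_forall fun x => abs_sub_clip_le_rpow hs hp.le)).trans ?_
    rw [integral_const_mul]
    gcongr
  have h3 : |(∫ x, G x ∂μ) - ∫ x, clip L (G x) ∂μ| ≤ L * α := by
    rw [← integral_sub iG iGL]
    refine (norm_integral_le_of_norm_le (f := fun x => G x - clip L (G x)) (iy.const_mul L)
      (Eventually.of_forall fun x => abs_sub_clip_le_rpow hL hr1)).trans ?_
    rw [integral_const_mul]
    gcongr
  have h4 : |∫ x, clip s (g x) ∂μ| ≤ s := abs_integral_le_of_abs_le fun x => abs_clip_le hs.le _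
  have h5 : |∫ x, clip L (G x) ∂μ| ≤ L := abs_integral_le_of_abs_le fun x => abs_clip_le hL.le _
  have h6 : |(∫ x, clip s (g x) * clip L (G (U x)) ∂μ) - (∫ x, clip s (g x) ∂μ) *
      ∫ x, clip L (G x) ∂μ| ≤ C * (s * L * α) := by
    have := hcov s hs (fun x => L⁻¹ * clip L (G x)) ((cm L hG).const_mul _) fun x => by
      rw [abs_mul, abs_of_pos (inv_pos.2 hL), inv_mul_le_iff₀ hL, mul_one]
      exact abs_clip_le hL.le _
    simp only [mul_left_comm _ L⁻¹, integral_const_mul] at this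
    rw [← mul_sub, abs_mul, abs_of_pos (inv_pos.2 hL), inv_mul_le_iff₀ hL] at this
    linarith
  set a := ∫ x, g x * G (U x) ∂μ
  set a' := ∫ x, clip s (g x) * clip L (G (U x)) ∂μ
  set u := ∫ x, g x ∂μ
  set u' := ∫ x, clip s (g x) ∂μ
  set v := ∫ x, G x ∂μ
  set v' := ∫ x, clip L (G x) ∂μ
  have h7 : |(u - u') * v'| ≤ s * α * L := by
    rw [abs_mul]; exact mul_le_mul h2 h5 (abs_nonneg _) (by positivity)
  have h8 : |u| ≤ 2 * s := by
    have : |u| ≤ |u - u'| + |u'| := by simpa using abs_add_le (u - u') u'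
    nlinarith
  have h9 : |u * (v - v')| ≤ 2 * s * (L * α) := by
    rw [abs_mul]; exact mul_le_mul h8 h3 (abs_nonneg _) (by positivity)
  have e : (C + 5) * A * α ^ (1 - 1 / p - 1 / r) * B = (C + 5) * (s * L * α) := by rw [hsL]; ring
  rw [e, show a - u * v = (a - a') + (a' - u' * v') - (u - u') * v' - u * (v - v') by ring]
  rw [abs_le] at *
  constructor <;> nlinarith [h1.1, h1.2, h6.1, h6.2, h7.1, h7.2, h9.1, h9.2]

end Cov

/-! ### Moments of the functions in `Mon` -/

lemma Mon.isMonPiece {M : ℝ} {p : ℝ≥0∞} {μ : Measure ℝ} {g : ℝ → ℝ} (hg : Mon M p μ g) :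
    IsMonPiece g := by
  obtain ⟨⟨I, -, h⟩, -⟩ := hg
  exact ⟨I, h⟩

lemma lintegral_tail_lt_top {s p : ℝ} (hs : 0 < s) (hsp : s < p) (c : ℝ) :
    (∫⁻ t in Ioc (0:ℝ) 1, ENNReal.ofReal (t ^ (s - 1))) +
      ∫⁻ t in Ioi (1:ℝ), ENNReal.ofReal (c * t ^ (-p)) * ENNReal.ofReal (t ^ (s - 1)) < ∞ := by
  have h1 : IntegrableOn (fun t : ℝ => t ^ (s - 1)) (Ioc 0 1) :=
    (intervalIntegrable_iff_integrableOn_Ioc_of_le zero_le_one).1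
      (intervalIntegral.intervalIntegrable_rpow' (by linarith))
  have h2 : IntegrableOn (fun t : ℝ => c * t ^ (s - 1 - p)) (Ioi 1) :=
    (integrableOn_Ioi_rpow_of_lt (by linarith) one_pos).const_mul c
  refine ENNReal.add_lt_top.2 ⟨h1.lintegral_lt_top, lt_of_eq_of_lt ?_ h2.lintegral_lt_top⟩
  refine setLIntegral_congr_fun measurableSet_Ioi fun t ht => ?_
  have ht0 : (0:ℝ) < t := one_pos.trans ht
  rw [← ENNReal.ofReal_mul' (by positivity), mul_assoc, ← Real.rpow_add ht0]
  ring_nf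

lemma lintegral_rpow_abs_le_of_tail {μ : Measure ℝ} [IsProbabilityMeasure μ] {s p c : ℝ}
    (hs : 0 < s) {g : ℝ → ℝ} (hg : Measurable g)
    (htail : ∀ t : ℝ, 0 < t → μ {x | t < |g x|} ≤ ENNReal.ofReal (c * t ^ (-p))) :
    ∫⁻ x, ENNReal.ofReal (|g x| ^ s) ∂μ ≤ ENNReal.ofReal s *
      ((∫⁻ t in Ioc (0:ℝ) 1, ENNReal.ofReal (t ^ (s - 1))) +
        ∫⁻ t in Ioi (1:ℝ), ENNReal.ofReal (c * t ^ (-p)) * ENNReal.ofReal (t ^ (s - 1))) := by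
  rw [lintegral_rpow_eq_lintegral_meas_lt_mul μ (Eventually.of_forall fun x => abs_nonneg (g x))
    hg.norm.aemeasurable hs, ← Ioc_union_Ioi_eq_Ioi (zero_le_one' ℝ),
    lintegral_union measurableSet_Ioi (Ioc_disjoint_Ioi le_rfl)]
  gcongr ENNReal.ofReal s * (?_ + ?_)
  · exact lintegral_mono fun t => mul_le_of_le_one_left' prob_le_one
  · refine setLIntegral_mono' measurableSet_Ioi fun t ht => ?_
    gcongr
    exact htail t (one_pos.trans ht)

theorem Mon.exists_integral_rpow_le {M : ℝ} {p : ℝ≥0∞} {μ : Measure ℝ}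
    [IsProbabilityMeasure μ] {s : ℝ} (hs : 0 < s) (hsp : ENNReal.ofReal s < p) :
    ∃ A : ℝ, 0 < A ∧ ∀ g, Mon M p μ g → Integrable (fun x => |g x| ^ s) μ ∧
      ∫ x, |g x| ^ s ∂μ ≤ A ^ s := by
  have main : ∃ K : ℝ≥0∞, K < ∞ ∧ ∀ g, Mon M p μ g →
      ∫⁻ x, ENNReal.ofReal (|g x| ^ s) ∂μ ≤ K := by
    by_cases hp : p = ∞
    · refine ⟨ENNReal.ofReal (M ^ s), ENNReal.ofReal_lt_top, fun g hg => ?_⟩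
      have h := hg.2
      rw [if_pos hp] at h
      have h' : ∀ᵐ x ∂μ, |g x| ≤ M := by
        simpa [ae_iff] using h
      refine (lintegral_mono_ae (g := fun _ => ENNReal.ofReal (M ^ s)) ?_).trans (by simp)
      filter_upwards [h'] with x hx
      gcongr
    · have hsp' : s < p.toReal := (ENNReal.ofReal_lt_iff_lt_toReal hs.le hp).1 hsp
      refine ⟨_, ENNReal.mul_lt_top (ENNReal.ofReal_lt_top (r := s))
        (lintegral_tail_lt_top hs hsp' (M ^ p.toReal)), fun g hg => ?_⟩
      have h := hg.2
      rw [if_neg hp] at h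
      exact lintegral_rpow_abs_le_of_tail hs hg.isMonPiece.measurable h
  obtain ⟨K, hK, h⟩ := main
  refine ⟨(K.toReal + 1) ^ (1 / s), by positivity, fun g hg => ?_⟩
  have hm : Measurable fun x => |g x| ^ s := hg.isMonPiece.measurable.norm.pow_const s
  have hn : ∀ x, 0 ≤ |g x| ^ s := fun x => by positivity
  refine ⟨⟨hm.aestronglyMeasurable, ?_⟩, ?_⟩
  · rw [hasFiniteIntegral_iff_ofReal (Eventually.of_forall hn)]
    exact (h g hg).trans_lt hK
  · rw [integral_eq_lintegral_of_nonneg_ae (Eventually.of_forall hn) hm.aestronglyMeasurable,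
      ← Real.rpow_mul (by positivity), one_div_mul_cancel hs.ne', Real.rpow_one]
    have := ENNReal.toReal_mono hK.ne (h g hg)
    linarith

/-! ### Bounded combinations of piecewise monotone functions -/

lemma abs_sum_mul_rpow_le {ι : Type*} (t : Finset ι) {s : ℝ} (hs : 1 ≤ s) {a : ι → ℝ}
    (ha : ∑ i ∈ t, |a i| ≤ 1) (y : ι → ℝ) :
    |∑ i ∈ t, a i * y i| ^ s ≤ ∑ i ∈ t, |a i| * |y i| ^ s := by
  have hs0 : 0 < s := by linarith
  have h0 : 0 ≤ ∑ i ∈ t, |a i| := Finset.sum_nonneg fun i _ => abs_nonneg _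
  have h1 : 0 ≤ ∑ i ∈ t, |a i| * |y i| ^ s := Finset.sum_nonneg fun i _ => by positivity
  have h := Real.inner_le_weight_mul_Lp_of_nonneg t hs (fun i => |a i|) (fun i => |y i|)
    (fun i => abs_nonneg _) fun i => abs_nonneg _
  have h2 : |∑ i ∈ t, a i * y i| ≤ (∑ i ∈ t, |a i| * |y i| ^ s) ^ s⁻¹ := by
    refine (Finset.abs_sum_le_sum_abs _ _).trans ?_
    simp only [abs_mul]
    refine h.trans (mul_le_of_le_one_left (by positivity) ?_)
    exact Real.rpow_le_one h0 ha (by linarith [inv_le_one_of_one_le₀ hs])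
  calc |∑ i ∈ t, a i * y i| ^ s ≤ ((∑ i ∈ t, |a i| * |y i| ^ s) ^ s⁻¹) ^ s := by gcongr
    _ = _ := Real.rpow_inv_rpow h1 hs0.ne'

lemma exists_abs_sum_mul_le {Ω ι : Type*} (t : Finset ι) (a : ι → ℝ) {g : ι → Ω → ℝ}
    (hg : ∀ i, ∃ c, ∀ x, |g i x| ≤ c) : ∃ c, ∀ x, |∑ i ∈ t, a i * g i x| ≤ c := by
  choose c hc using hg
  refine ⟨∑ i ∈ t, |a i| * c i, fun x => (Finset.abs_sum_le_sum_abs _ _).trans ?_⟩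
  refine Finset.sum_le_sum fun i _ => ?_
  rw [abs_mul]
  exact mul_le_mul_of_nonneg_left (hc i x) (abs_nonneg _)

lemma abs_sub_rpow_le {s : ℝ} (hs : 1 ≤ s) (x y : ℝ) :
    |x - y| ^ s ≤ 2 ^ (s - 1) * (|x| ^ s + |y| ^ s) := by
  have h : (|x| + |y|) ^ s ≤ 2 ^ (s - 1) * (|x| ^ s + |y| ^ s) := by
    have := NNReal.rpow_add_le_mul_rpow_add_rpow (Real.nnabs x) (Real.nnabs y) hs
    have := NNReal.coe_le_coe.2 this
    push_cast at this
    simpa using this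
  refine le_trans ?_ h
  gcongr
  exact norm_sub_le x y

section Moments
variable {Ω : Type*} [MeasurableSpace Ω] {μ : Measure Ω} [IsProbabilityMeasure μ]

lemma abs_integral_rpow_le {F : Ω → ℝ} (hF : Measurable F) {c : ℝ} (hFb : ∀ x, |F x| ≤ c) {s : ℝ}
    (hs : 1 ≤ s) : |∫ x, F x ∂μ| ^ s ≤ ∫ x, |F x| ^ s ∂μ := by
  have hs0 : 0 < s := by linarith
  have h0 : 0 ≤ ∫ x, |F x| ^ s ∂μ := integral_nonneg fun x => by positivity
  have h := integral_abs_rpow_mul_le (μ := μ) hF (measurable_const (a := (1:ℝ))) hFb (d := 1)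
    (fun _ => by simp) hs0 one_pos (inv_nonneg.2 hs0.le)
    (by linarith [inv_le_one_of_one_le₀ hs] : 0 ≤ 1 - s⁻¹) (by ring)
  simp only [mul_inv_cancel₀ hs0.ne', Real.rpow_one, abs_one, Real.one_rpow, mul_one,
    integral_const, probReal_univ, smul_eq_mul] at h
  calc |∫ x, F x ∂μ| ^ s ≤ ((∫ x, |F x| ^ s ∂μ) ^ s⁻¹) ^ s := by
        gcongr
        exact abs_integral_le_integral_abs.trans h
    _ = _ := Real.rpow_inv_rpow h0 hs0.ne'

lemma integral_abs_sub_integral_rpow_le {F : Ω → ℝ} (hF : Measurable F) {c : ℝ}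
    (hFb : ∀ x, |F x| ≤ c) {s A : ℝ} (hs : 1 ≤ s) (hA : 0 ≤ A) (hFA : ∫ x, |F x| ^ s ∂μ ≤ A ^ s) :
    ∫ x, |F x - ∫ y, F y ∂μ| ^ s ∂μ ≤ (2 * A) ^ s := by
  have hs0 : 0 < s := by linarith
  have i1 : Integrable (fun x => |F x| ^ s) μ :=
    integrable_of_abs_le (hF.norm.pow_const s) fun x => abs_rpow_le_rpow hs0.le (hFb x)
  calc ∫ x, |F x - ∫ y, F y ∂μ| ^ s ∂μ
      ≤ ∫ x, 2 ^ (s - 1) * (|F x| ^ s + |∫ y, F y ∂μ| ^ s) ∂μ :=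
        integral_mono_of_nonneg (Eventually.of_forall fun x => by positivity)
          ((i1.add (integrable_const _)).const_mul _)
          (Eventually.of_forall fun x => abs_sub_rpow_le hs _ _)
    _ = 2 ^ (s - 1) * ((∫ x, |F x| ^ s ∂μ) + |∫ y, F y ∂μ| ^ s) := by
        rw [integral_const_mul, integral_add i1 (integrable_const _)]
        simp
    _ ≤ 2 ^ (s - 1) * (A ^ s + A ^ s) := by
        gcongr ?_ * (?_ + ?_)
        exact (abs_integral_rpow_le hF hFb hs).trans hFA
    _ = (2 * A) ^ s := by
        rw [Real.mul_rpow zero_le_two hA, Real.rpow_sub_one two_ne_zero]; ring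

lemma integral_abs_sum_rpow_le {ι : Type*} (t : Finset ι) {a : ι → ℝ} (ha : ∑ i ∈ t, |a i| ≤ 1)
    {g : ι → Ω → ℝ} (hg : ∀ i, Measurable (g i)) (hgb : ∀ i, ∃ c, ∀ x, |g i x| ≤ c) {s K : ℝ}
    (hs : 1 ≤ s) (hK : 0 ≤ K) (hgK : ∀ i, ∫ x, |g i x| ^ s ∂μ ≤ K) :
    ∫ x, |∑ i ∈ t, a i * g i x| ^ s ∂μ ≤ K := by
  have hs0 : 0 < s := by linarith
  have ii : ∀ i, Integrable (fun x => |a i| * |g i x| ^ s) μ := fun i => by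
    obtain ⟨c, hc⟩ := hgb i
    exact (integrable_of_abs_le ((hg i).norm.pow_const s)
      fun x => abs_rpow_le_rpow hs0.le (hc x)).const_mul _
  calc ∫ x, |∑ i ∈ t, a i * g i x| ^ s ∂μ ≤ ∫ x, ∑ i ∈ t, |a i| * |g i x| ^ s ∂μ :=
        integral_mono_of_nonneg (Eventually.of_forall fun x => by positivity)
          (integrable_finsetSum _ fun i _ => ii i)
          (Eventually.of_forall fun x => abs_sum_mul_rpow_le t hs ha _)
    _ = ∑ i ∈ t, |a i| * ∫ x, |g i x| ^ s ∂μ := by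
        rw [integral_finsetSum _ fun i _ => ii i]
        simp only [integral_const_mul]
    _ ≤ ∑ i ∈ t, |a i| * K := by gcongr with i; exact hgK i
    _ ≤ K := by
        rw [← Finset.sum_mul]
        exact mul_le_of_le_one_left hK ha

lemma covariance_sum_le {ι : Type*} (t : Finset ι) {a : ι → ℝ} (ha : ∑ i ∈ t, |a i| ≤ 1)
    {g : ι → Ω → ℝ} (hg : ∀ i, Measurable (g i)) (hgb : ∀ i, ∃ c, ∀ x, |g i x| ≤ c)
    {U : Ω → Ω} (hU : MeasurePreserving U μ μ) {G : Ω → ℝ} (hG : Measurable G)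
    (hGb : ∃ d, ∀ x, |G x| ≤ d) {K : ℝ} (hK : 0 ≤ K)
    (h : ∀ i, |(∫ x, g i x * G (U x) ∂μ) - (∫ x, g i x ∂μ) * ∫ x, G x ∂μ| ≤ K) :
    |∫ x, ((∑ i ∈ t, a i * g i x) - ∫ y, ∑ i ∈ t, a i * g i y ∂μ) * G (U x) ∂μ| ≤ K := by
  obtain ⟨d, hd⟩ := hGb
  have ig : ∀ i, Integrable (fun x => a i * g i x) μ := fun i => by
    obtain ⟨c, hc⟩ := hgb i
    exact (integrable_of_abs_le (hg i) hc).const_mul _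
  have hGU : Measurable fun x => G (U x) := hG.comp hU.measurable
  have iG : Integrable (fun x => G (U x)) μ := integrable_of_abs_le hGU fun x => hd _
  have igG : ∀ i, Integrable (fun x => a i * g i x * G (U x)) μ := fun i =>
    (ig i).mul_bdd hGU.aestronglyMeasurable (Eventually.of_forall fun x => hd (U x))
  have e : ∫ x, ((∑ i ∈ t, a i * g i x) - ∫ y, ∑ i ∈ t, a i * g i y ∂μ) * G (U x) ∂μ
      = ∑ i ∈ t, a i * ((∫ x, g i x * G (U x) ∂μ) - (∫ x, g i x ∂μ) * ∫ x, G x ∂μ) := by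
    simp only [sub_mul, Finset.sum_mul]
    rw [integral_sub (integrable_finsetSum _ fun i _ => igG i) (iG.const_mul _),
      integral_finsetSum _ fun i _ => igG i, integral_const_mul,
      integral_finsetSum _ fun i _ => ig i, integral_comp_of_measurePreserving hU hG,
      Finset.sum_mul, ← Finset.sum_sub_distrib]
    refine Finset.sum_congr rfl fun i _ => ?_
    simp only [mul_assoc, integral_const_mul]
    ring
  rw [e]
  refine (Finset.abs_sum_le_sum_abs _ _).trans ?_
  calc ∑ i ∈ t, |a i * ((∫ x, g i x * G (U x) ∂μ) - (∫ x, g i x ∂μ) * ∫ x, G x ∂μ)|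
      ≤ ∑ i ∈ t, |a i| * K := by
        refine Finset.sum_le_sum fun i _ => ?_
        rw [abs_mul]
        exact mul_le_mul_of_nonneg_left (h i) (abs_nonneg _)
    _ ≤ K := by
        rw [← Finset.sum_mul]
        exact mul_le_of_le_one_left hK ha

end Moments

section Combination
variable {γ : ℝ} {ν : Measure ℝ} [IsProbabilityMeasure ν]

lemma monPiece_covariance_moment_le (hγ : γ ∈ Ioo (0:ℝ) 1) (hsupp : ν (Icc 0 1) = 1)
    (hac : ν ≪ volume) (hinv : Measure.map (Tmap γ) ν = ν) {s r A θ : ℝ} (hs : 1 < s) (hr : 0 < r)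
    (hsr : 1 / s + 1 / r < 1) (hA : 0 < A) (hθ : 0 ≤ θ)
    (hθ' : θ < (1 - 1 / s - 1 / r) * ((1 - γ) / γ)) :
    ∃ C, 0 ≤ C ∧ ∀ g : ℝ → ℝ, IsMonPiece g → (∃ c, ∀ x, |g x| ≤ c) → ∫ x, |g x| ^ s ∂ν ≤ A ^ s →
      ∀ (k : ℕ) (G : ℝ → ℝ) (B : ℝ), Measurable G → (∃ d, ∀ x, |G x| ≤ d) → 0 < B →
      ∫ x, |G x| ^ r ∂ν ≤ B ^ r →
      |(∫ x, g x * G ((Tmap γ)^[k] x) ∂ν) - (∫ x, g x ∂ν) * ∫ x, G x ∂ν|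
        ≤ C * ((k:ℝ) + 1) ^ (-θ) * B := by
  set e := 1 - 1 / s - 1 / r with he
  have he0 : 0 < e := by linarith
  obtain ⟨C, hC, h⟩ := monPiece_covariance_decay hγ hsupp hac hinv (κ := θ / e) (by positivity)
    (by rw [div_lt_iff₀ he0]; linarith)
  refine ⟨(C + 5) * A, by positivity, ?_⟩
  rintro g hg ⟨c, hc⟩ hgA k G B hG ⟨d, hd⟩ hB hGB
  have hk : (1:ℝ) ≤ (k:ℝ) + 1 := by linarith [(Nat.cast_nonneg k : (0:ℝ) ≤ k)]
  have := covariance_le_of_truncated (α := ((k:ℝ) + 1) ^ (-(θ / e))) (C := C)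
    ((measurePreserving_Tmap hinv).iterate k) hg.measurable hc hs hr hsr.le hA hB (by positivity)
    (Real.rpow_le_one_of_one_le_of_nonpos hk (neg_nonpos.2 (by positivity))) ?_ hgA hG hd hGB
  · rwa [← he, ← Real.rpow_mul (by positivity), neg_mul, div_mul_cancel₀ _ he0.ne'] at this
  · intro t ht Y hY hYb
    have h1 := h _ ((hg.clip ht.le).const_mul (inv_nonneg.2 ht.le)) (fun x => by
      rw [abs_mul, abs_of_pos (inv_pos.2 ht), inv_mul_le_iff₀ ht, mul_one]
      exact abs_clip_le ht.le _) Y hY hYb k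
    simp only [mul_assoc, integral_const_mul] at h1
    rwa [← mul_sub, abs_mul, abs_of_pos (inv_pos.2 ht), inv_mul_le_iff₀ ht] at h1

lemma Sn_eq_birkhoffSum (f : ℝ → ℝ) (n : ℕ) (x : ℝ) :
    Sn γ f n x = birkhoffSum (Tmap γ) f n (Tmap γ x) := by
  simp only [Sn, birkhoffSum, Function.iterate_succ_apply]

theorem exists_moment_Sn_combination_le (hγ : γ ∈ Ioo (0:ℝ) 1) (hsupp : ν (Icc 0 1) = 1)
    (hac : ν ≪ volume) (hinv : Measure.map (Tmap γ) ν = ν) {q s A θ : ℝ} (hq : 2 ≤ q) (hqs : q < s)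
    (hA : 0 < A) (hθ : 0 ≤ θ) (hθ' : θ < 2 * (1 / q - 1 / s) * ((1 - γ) / γ)) :
    ∃ C, 0 ≤ C ∧ ∀ (m : ℕ) (a : Fin m → ℝ) (g : Fin m → ℝ → ℝ), ∑ i, |a i| ≤ 1 →
      (∀ i, IsMonPiece (g i)) → (∀ i, ∃ c, ∀ x, |g i x| ≤ c) →
      (∀ i, ∫ x, |g i x| ^ s ∂ν ≤ A ^ s) → ∀ n : ℕ,
      ∫ x, |Sn γ (fun z => (∑ i, a i * g i z) - ∫ y, ∑ i, a i * g i y ∂ν) n x| ^ q ∂ν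
        ≤ (C * (n * ∑ k ∈ Finset.range n, ((k:ℝ) + 1) ^ (-θ))) ^ (q / 2) := by
  have hq0 : 0 < q := by linarith
  have hs0 : 0 < s := by linarith
  have hsq : 1 / s < 1 / q := one_div_lt_one_div_of_lt hq0 hqs
  have hq2 : 1 / q ≤ 1 / 2 := one_div_le_one_div_of_le two_pos hq
  set r : ℝ := (1 / s + 1 - 2 / q)⁻¹ with hr
  have hri : 1 / r = 1 / s + 1 - 2 / q := by rw [hr, one_div, inv_inv]
  have hdq : 2 / q = 2 * (1 / q) := by ring
  have hri0 : 0 < 1 / s + 1 - 2 / q := by have := one_div_pos.2 hs0; linarith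
  have hr0 : 0 < r := inv_pos.2 hri0
  obtain ⟨C, hC, h⟩ := monPiece_covariance_moment_le hγ hsupp hac hinv (s := s) (r := r) (A := A)
    (θ := θ) (by linarith) hr0 (by linarith) hA hθ
    (by rw [hri]; convert hθ' using 2; ring)
  refine ⟨2 * (q * (q - 1)) * 2 ^ (1 / r) * (2 * A) * C,
    by have : 0 ≤ q - 1 := by linarith
       positivity, fun m a g ha hg hgb hgA n => ?_⟩
  set F : ℝ → ℝ := fun z => ∑ i, a i * g i z with hF
  have hgm : ∀ i, Measurable (g i) := fun i => (hg i).measurable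
  have hFm : Measurable F := Finset.measurable_sum _ fun i _ => (hgm i).const_mul _
  obtain ⟨c, hc⟩ : ∃ c, ∀ x, |F x| ≤ c := exists_abs_sum_mul_le Finset.univ a hgb
  have hT := measurePreserving_Tmap hinv
  have hm : Measurable fun z => F z - ∫ y, F y ∂ν := hFm.sub_const _
  have hb : ∀ x, |F x - ∫ y, F y ∂ν| ≤ c + |∫ y, F y ∂ν| := fun x =>
    (norm_sub_le (F x) _).trans (add_le_add (hc x) le_rfl)
  have key := birkhoffSum_moment_le hT hm hb hq hs0 hr0
    (by
      have : r * (1 / s + 1 - 2 / q) = 1 := inv_mul_cancel₀ hri0.ne'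
      rw [← this]; field_simp; ring)
    (by positivity : 0 < 2 * A)
    (integral_abs_sub_integral_rpow_le hFm hc (by linarith) hA.le
      (integral_abs_sum_rpow_le Finset.univ ha hgm hgb (by linarith) (by positivity) hgA))
    (D := fun k => C * ((k:ℝ) + 1) ^ (-θ)) (fun k => by positivity)
    (fun k G B hG hGb hB hGB => covariance_sum_le Finset.univ ha hgm hgb (hT.iterate k) hG hGb
      (by positivity) fun i => h (g i) (hg i) (hgb i) (hgA i) k G B hG hGb hB hGB) n
  rw [← Finset.mul_sum] at key
  simp only [Sn_eq_birkhoffSum]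
  rw [integral_comp_of_measurePreserving hT
    (g := fun x => |birkhoffSum (Tmap γ) (fun z => F z - ∫ y, F y ∂ν) n x| ^ q)
    ((measurable_birkhoffSum hT.measurable hm n).norm.pow_const q)]
  refine key.trans (le_of_eq ?_)
  congr 1
  ring

end Combination

/-! ### Passing to the closure in `L¹` -/

lemma integral_le_of_ae_tendsto {Ω : Type*} [MeasurableSpace Ω] {μ : Measure Ω} {u : ℕ → Ω → ℝ}
    {v : Ω → ℝ} {K : ℝ} (hu : ∀ j, Measurable (u j)) (hu0 : ∀ j x, 0 ≤ u j x)
    (hi : ∀ j, Integrable (u j) μ) (hK : ∀ j, ∫ x, u j x ∂μ ≤ K)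
    (hlim : ∀ᵐ x ∂μ, Tendsto (fun j => u j x) atTop (𝓝 (v x))) : ∫ x, v x ∂μ ≤ K := by
  have hK0 : 0 ≤ K := (integral_nonneg (hu0 0)).trans (hK 0)
  by_cases hv : Integrable v μ
  swap
  · rwa [integral_undef hv]
  have hv0 : 0 ≤ᵐ[μ] v := hlim.mono fun x hx => ge_of_tendsto' hx fun j => hu0 j x
  rw [← ENNReal.ofReal_le_ofReal_iff hK0, ofReal_integral_eq_lintegral_ofReal hv hv0]
  calc ∫⁻ x, ENNReal.ofReal (v x) ∂μ
      = ∫⁻ x, liminf (fun j => ENNReal.ofReal (u j x)) atTop ∂μ := by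
        refine lintegral_congr_ae (hlim.mono fun x hx => ?_)
        exact ((ENNReal.continuous_ofReal.tendsto _).comp hx).liminf_eq.symm
    _ ≤ liminf (fun j => ∫⁻ x, ENNReal.ofReal (u j x) ∂μ) atTop :=
        lintegral_liminf_le fun j => (hu j).ennreal_ofReal
    _ ≤ ENNReal.ofReal K := by
        refine liminf_le_of_frequently_le' (Frequently.of_forall fun j => ?_)
        rw [← ofReal_integral_eq_lintegral_ofReal (hi j) (Eventually.of_forall (hu0 j))]
        exact ENNReal.ofReal_le_ofReal (hK j)

lemma integrable_of_integrable_rpow {Ω : Type*} [MeasurableSpace Ω] {μ : Measure Ω}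
    [IsFiniteMeasure μ] {g : Ω → ℝ} (hg : Measurable g) {s : ℝ} (hs : 1 ≤ s)
    (h : Integrable (fun x => |g x| ^ s) μ) : Integrable g μ := by
  refine ((integrable_const (1:ℝ)).add h).mono' hg.aestronglyMeasurable
    (Eventually.of_forall fun x => ?_)
  have h0 : 0 ≤ |g x| ^ s := by positivity
  rw [Real.norm_eq_abs]
  rcases le_total |g x| 1 with h1 | h1
  · exact h1.trans (le_add_of_nonneg_right h0)
  · exact (Real.self_le_rpow_of_one_le h1 hs).trans (le_add_of_nonneg_left zero_le_one)

lemma exists_clip_combination {μ : Measure ℝ} [IsProbabilityMeasure μ] {m : ℕ} {a : Fin m → ℝ}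
    {g : Fin m → ℝ → ℝ} {s K : ℝ} (ha : ∑ i, |a i| ≤ 1) (hs : 1 < s)
    (hi : ∀ i, Integrable (fun x => |g i x| ^ s) μ) (hK : ∀ i, ∫ x, |g i x| ^ s ∂μ ≤ K)
    {ε : ℝ} (hε : 0 < ε) : ∃ t : ℝ, 0 < t ∧
      ∫ x, |(∑ i, a i * g i x) - ∑ i, a i * clip t (g i x)| ∂μ < ε := by
  have hlim : Tendsto (fun t : ℝ => t ^ (-(s - 1)) * |K|) atTop (𝓝 0) := by
    simpa using (tendsto_rpow_neg_atTop (by linarith : 0 < s - 1)).mul_const |K|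
  obtain ⟨t, ht, ht0⟩ := ((hlim.eventually_lt_const hε).and (eventually_gt_atTop 0)).exists
  refine ⟨t, ht0, lt_of_le_of_lt ?_ ht⟩
  have ii : ∀ i, Integrable (fun x => |a i| * (t ^ (-(s - 1)) * |g i x| ^ s)) μ := fun i =>
    ((hi i).const_mul _).const_mul _
  have hpt : ∀ x, |(∑ i, a i * g i x) - ∑ i, a i * clip t (g i x)|
      ≤ ∑ i, |a i| * (t ^ (-(s - 1)) * |g i x| ^ s) := fun x => by
    rw [← Finset.sum_sub_distrib]
    refine (Finset.abs_sum_le_sum_abs _ _).trans (Finset.sum_le_sum fun i _ => ?_)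
    rw [← mul_sub, abs_mul]
    refine mul_le_mul_of_nonneg_left ((abs_sub_clip_le_rpow ht0 hs.le).trans (le_of_eq ?_))
      (abs_nonneg _)
    rw [Real.div_rpow (abs_nonneg _) ht0.le, show -(s - 1) = 1 - s by ring,
      Real.rpow_sub ht0, Real.rpow_one]
    ring
  calc ∫ x, |(∑ i, a i * g i x) - ∑ i, a i * clip t (g i x)| ∂μ
      ≤ ∫ x, ∑ i, |a i| * (t ^ (-(s - 1)) * |g i x| ^ s) ∂μ :=
        integral_mono_of_nonneg (Eventually.of_forall fun x => abs_nonneg _)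
          (integrable_finsetSum _ fun i _ => ii i) (Eventually.of_forall hpt)
    _ = ∑ i, |a i| * (t ^ (-(s - 1)) * ∫ x, |g i x| ^ s ∂μ) := by
        rw [integral_finsetSum _ fun i _ => ii i]
        simp only [integral_const_mul]
    _ ≤ ∑ i, |a i| * (t ^ (-(s - 1)) * |K|) := by
        gcongr with i
        exact (hK i).trans (le_abs_self K)
    _ ≤ t ^ (-(s - 1)) * |K| := by
        rw [← Finset.sum_mul]
        exact mul_le_of_le_one_left (by positivity) ha

theorem ClassC.exists_bounded_combination {M : ℝ} {p : ℝ≥0∞} {μ : Measure ℝ}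
    [IsProbabilityMeasure μ] {f : ℝ → ℝ} (hf : ClassC M p μ f) {s A : ℝ} (hs : 1 < s)
    (hA : ∀ g, Mon M p μ g → Integrable (fun x => |g x| ^ s) μ ∧ ∫ x, |g x| ^ s ∂μ ≤ A ^ s)
    {ε : ℝ} (hε : 0 < ε) :
    ∃ (m : ℕ) (a : Fin m → ℝ) (g : Fin m → ℝ → ℝ), ∑ i, |a i| ≤ 1 ∧ (∀ i, IsMonPiece (g i)) ∧
      (∀ i, ∃ c, ∀ x, |g i x| ≤ c) ∧ (∀ i, ∫ x, |g i x| ^ s ∂μ ≤ A ^ s) ∧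
      ∫ x, |f x - ∑ i, a i * g i x| ∂μ < ε := by
  have hs0 : 0 < s := by linarith
  obtain ⟨m, a, g, ha, hg, hfg⟩ := hf.2 (ε / 2) (by positivity)
  have hgm : ∀ i, Measurable (g i) := fun i => (hg i).isMonPiece.measurable
  have hgi := fun i => (hA (g i) (hg i)).1
  obtain ⟨t, ht, htε⟩ := exists_clip_combination ha hs hgi (fun i => (hA (g i) (hg i)).2)
    (half_pos hε)
  have hcm : ∀ i, Measurable fun x => clip t (g i x) := fun i =>
    (continuous_clip t).measurable.comp (hgm i)
  refine ⟨m, a, fun i x => clip t (g i x), ha, fun i => (hg i).isMonPiece.clip ht.le,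
    fun i => ⟨t, fun x => abs_clip_le ht.le _⟩, fun i => ?_, ?_⟩
  · refine (integral_mono_of_nonneg (Eventually.of_forall fun x => by positivity) (hgi i)
      (Eventually.of_forall fun x => ?_)).trans (hA (g i) (hg i)).2
    exact Real.rpow_le_rpow (abs_nonneg _) (abs_clip_le_abs ht.le _) hs0.le
  · have i1 : Integrable (fun x => ∑ i, a i * g i x) μ := integrable_finsetSum _ fun i _ =>
      (integrable_of_integrable_rpow (hgm i) hs.le (hgi i)).const_mul _
    have i2 : Integrable (fun x => ∑ i, a i * clip t (g i x)) μ := integrable_finsetSum _ fun i _ =>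
      (integrable_of_abs_le (hcm i) fun x => abs_clip_le ht.le _).const_mul _
    have i3 := (hf.1.sub i1).abs
    have i4 := (i1.sub i2).abs
    calc ∫ x, |f x - ∑ i, a i * clip t (g i x)| ∂μ
        ≤ ∫ x, (|f x - ∑ i, a i * g i x|
            + |(∑ i, a i * g i x) - ∑ i, a i * clip t (g i x)|) ∂μ :=
          integral_mono (hf.1.sub i2).abs (i3.add i4) fun x => abs_sub_le _ _ _
      _ = (∫ x, |f x - ∑ i, a i * g i x| ∂μ)
            + ∫ x, |(∑ i, a i * g i x) - ∑ i, a i * clip t (g i x)| ∂μ := integral_add i3 i4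
      _ < ε := by linarith

lemma exists_subseq_ae_tendsto {Ω : Type*} [MeasurableSpace Ω] {μ : Measure Ω} {f : Ω → ℝ}
    {F : ℕ → Ω → ℝ} (hf : Integrable f μ) (hF : ∀ j, Integrable (F j) μ)
    (h : Tendsto (fun j => ∫ x, |f x - F j x| ∂μ) atTop (𝓝 0)) :
    ∃ φ : ℕ → ℕ, StrictMono φ ∧ ∀ᵐ x ∂μ, Tendsto (fun j => F (φ j) x) atTop (𝓝 (f x)) := by
  refine (tendstoInMeasure_of_tendsto_eLpNorm (p := 1) one_ne_zero
    (fun j => (hF j).aestronglyMeasurable) hf.aestronglyMeasurable ?_).exists_seq_tendsto_ae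
  have e : ∀ j, eLpNorm (F j - f) 1 μ = ENNReal.ofReal (∫ x, |f x - F j x| ∂μ) := fun j => by
    rw [eLpNorm_one_eq_lintegral_enorm, ofReal_integral_eq_lintegral_ofReal
      (f := fun x => |f x - F j x|) (hf.sub (hF j)).abs (Eventually.of_forall fun x => abs_nonneg _)]
    refine lintegral_congr fun x => ?_
    rw [Pi.sub_apply, ← ofReal_norm, Real.norm_eq_abs, abs_sub_comm]
  simp only [e]
  rw [← ENNReal.ofReal_zero]
  exact (ENNReal.continuous_ofReal.tendsto 0).comp h

section Closure
variable {γ : ℝ} {ν : Measure ℝ} [IsProbabilityMeasure ν]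

theorem ClassC.exists_moment_Sn_le (hγ : γ ∈ Ioo (0:ℝ) 1) (hsupp : ν (Icc 0 1) = 1)
    (hac : ν ≪ volume) (hinv : Measure.map (Tmap γ) ν = ν) {M : ℝ} {p : ℝ≥0∞} {f : ℝ → ℝ}
    (hf : ClassC M p ν f) {q s θ : ℝ} (hq : 2 ≤ q) (hqs : q < s) (hsp : ENNReal.ofReal s < p)
    (hθ : 0 ≤ θ) (hθ' : θ < 2 * (1 / q - 1 / s) * ((1 - γ) / γ)) :
    ∃ C, 0 ≤ C ∧ ∀ n : ℕ, ∫ x, |Sn γ (fun z => f z - ∫ y, f y ∂ν) n x| ^ q ∂ν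
      ≤ (C * (n * ∑ k ∈ Finset.range n, ((k:ℝ) + 1) ^ (-θ))) ^ (q / 2) := by
  have hq0 : 0 < q := by linarith
  obtain ⟨A, hA0, hA⟩ := Mon.exists_integral_rpow_le (M := M) (μ := ν) (by linarith : 0 < s) hsp
  obtain ⟨C, hC, h⟩ :=
    exists_moment_Sn_combination_le hγ hsupp hac hinv hq hqs hA0 hθ hθ'
  refine ⟨C, hC, fun n => ?_⟩
  choose m a g ha hg hgb hgA hfg using fun j : ℕ =>
    hf.exists_bounded_combination (by linarith : 1 < s) hA (Nat.one_div_pos_of_nat (α := ℝ) (n := j))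
  set F : ℕ → ℝ → ℝ := fun j x => ∑ i, a j i * g j i x with hF
  have hFm : ∀ j, Measurable (F j) := fun j =>
    Finset.measurable_sum _ fun i _ => (hg j i).measurable.const_mul _
  have hFb : ∀ j, ∃ c, ∀ x, |F j x| ≤ c := fun j =>
    exists_abs_sum_mul_le Finset.univ (a j) (hgb j)
  have hFi : ∀ j, Integrable (F j) ν := fun j =>
    let ⟨_, hc⟩ := hFb j; integrable_of_abs_le (hFm j) hc
  have hL1 : Tendsto (fun j => ∫ x, |f x - F j x| ∂ν) atTop (𝓝 0) :=
    squeeze_zero (fun j => integral_nonneg fun x => abs_nonneg _) (fun j => (hfg j).le)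
      tendsto_one_div_add_atTop_nhds_zero_nat
  have hmean : Tendsto (fun j => ∫ x, F j x ∂ν) atTop (𝓝 (∫ x, f x ∂ν)) := by
    refine tendsto_iff_norm_sub_tendsto_zero.2 (squeeze_zero (fun _ => norm_nonneg _) (fun j => ?_)
      hL1)
    rw [norm_sub_rev, ← integral_sub hf.1 (hFi j)]
    exact norm_integral_le_integral_norm _
  obtain ⟨φ, hφ, hae⟩ := exists_subseq_ae_tendsto hf.1 hFi hL1
  have hT := measurePreserving_Tmap hinv
  have hae' : ∀ᵐ x ∂ν, ∀ i : ℕ, Tendsto (fun j => F (φ j) ((Tmap γ)^[i + 1] x)) atTop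
      (𝓝 (f ((Tmap γ)^[i + 1] x))) :=
    ae_all_iff.2 fun i => (hT.iterate (i + 1)).quasiMeasurePreserving.ae hae
  have hSm : ∀ j, Measurable (Sn γ (fun z => F j z - ∫ y, F j y ∂ν) n) := fun j =>
    Finset.measurable_sum _ fun i _ =>
      ((hFm j).sub_const _).comp (hT.iterate (i + 1)).measurable
  refine integral_le_of_ae_tendsto
    (u := fun j x => |Sn γ (fun z => F (φ j) z - ∫ y, F (φ j) y ∂ν) n x| ^ q)
    (fun j => (hSm _).norm.pow_const q) (fun j x => by positivity) (fun j => ?_)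
    (fun j => h _ _ _ (ha _) (hg _) (hgb _) (hgA _) n) ?_
  · obtain ⟨c, hc⟩ := hFb (φ j)
    refine integrable_of_abs_le ((hSm _).norm.pow_const q)
      fun x => abs_rpow_le_rpow hq0.le (?_ : _ ≤ n * (c + |∫ y, F (φ j) y ∂ν|))
    rw [Sn_eq_birkhoffSum]
    exact abs_birkhoffSum_le (fun y => (norm_sub_le (F (φ j) y) _).trans (add_le_add (hc y) le_rfl))
      n _
  · filter_upwards [hae'] with x hx
    refine (Tendsto.abs ?_).rpow_const (Or.inr hq0.le)
    exact tendsto_finsetSum _ fun i _ => (hx i).sub (hmean.comp hφ.tendsto_atTop)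

end Closure

/-! ### Rates -/

lemma sum_range_rpow_neg_le {θ : ℝ} (hθ : 0 ≤ θ) (hθ1 : θ < 1) (n : ℕ) :
    ∑ k ∈ Finset.range n, ((k:ℝ) + 1) ^ (-θ) ≤ (n:ℝ) ^ (1 - θ) / (1 - θ) := by
  have h1 : 0 < 1 - θ := by linarith
  induction n with
  | zero => simp [Real.zero_rpow h1.ne']
  | succ n ih =>
    rw [Finset.sum_range_succ]
    have hn : (0:ℝ) < (n:ℝ) + 1 := by positivity
    have hb := rpow_one_add_le_one_add_mul_self (s := -(1 / ((n:ℝ) + 1))) (p := 1 - θ)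
      (by rw [neg_le_neg_iff, div_le_one hn]; linarith [(Nat.cast_nonneg n : (0:ℝ) ≤ n)]) h1.le
      (by linarith)
    rw [show 1 + -(1 / ((n:ℝ) + 1)) = n / (n + 1) by field_simp; ring,
      Real.div_rpow (by positivity) hn.le, div_le_iff₀ (by positivity)] at hb
    have e : (1 + (1 - θ) * -(1 / ((n:ℝ) + 1))) * ((n:ℝ) + 1) ^ (1 - θ)
        = ((n:ℝ) + 1) ^ (1 - θ) - (1 - θ) * ((n:ℝ) + 1) ^ (-θ) := by
      rw [show -θ = 1 - θ - 1 by ring, Real.rpow_sub_one hn.ne']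
      ring
    rw [e] at hb
    push_cast
    rw [le_div_iff₀ h1] at ih ⊢
    linarith

lemma exists_sum_range_rpow_neg_le {θ : ℝ} (hθ : 1 < θ) :
    ∃ Z, 0 ≤ Z ∧ ∀ n : ℕ, ∑ k ∈ Finset.range n, ((k:ℝ) + 1) ^ (-θ) ≤ Z := by
  have h : Summable fun k : ℕ => ((k:ℝ) + 1) ^ (-θ) := by
    simpa using (summable_nat_add_iff 1).2 (Real.summable_nat_rpow.2 (by linarith : -θ < -1))
  exact ⟨_, tsum_nonneg fun k => by positivity, fun n =>
    h.sum_le_tsum _ fun k _ => by positivity⟩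

lemma toReal_one_div_ofReal_sub {q : ℝ} {p : ℝ≥0∞} (hq : 0 < q) (hqp : ENNReal.ofReal q < p) :
    (1 / ENNReal.ofReal q - 1 / p).toReal = 1 / q - p.toReal⁻¹ := by
  have hq' : ENNReal.ofReal q ≠ 0 := (ENNReal.ofReal_pos.2 hq).ne'
  rw [one_div, one_div, ENNReal.toReal_sub_of_le (ENNReal.inv_le_inv.2 hqp.le)
    (ENNReal.inv_ne_top.2 hq'), ENNReal.toReal_inv, ENNReal.toReal_inv,
    ENNReal.toReal_ofReal hq.le, one_div]

lemma exists_exponent {q e : ℝ} {p : ℝ≥0∞} (hq : 0 < q) (hqp : ENNReal.ofReal q < p) (he0 : 0 < e)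
    (he : e < (1 / ENNReal.ofReal q - 1 / p).toReal) :
    ∃ s, q < s ∧ ENNReal.ofReal s < p ∧ 1 / q - 1 / s = e := by
  rw [toReal_one_div_ofReal_sub hq hqp] at he
  have hp0 : 0 ≤ p.toReal⁻¹ := inv_nonneg.2 ENNReal.toReal_nonneg
  have h : 0 < 1 / q - e := by linarith
  refine ⟨(1 / q - e)⁻¹, ?_, ?_, by rw [one_div (1 / q - e)⁻¹, inv_inv]; ring⟩
  · rw [lt_inv_comm₀ hq h, ← one_div]; linarith
  · by_cases hp : p = ∞
    · rw [hp]; exact ENNReal.ofReal_lt_top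
    · rw [ENNReal.ofReal_lt_iff_lt_toReal (inv_nonneg.2 h.le) hp]
      have : 0 < p.toReal := ENNReal.toReal_pos (pos_of_gt hqp).ne' hp
      rw [inv_lt_comm₀ h this]; linarith

section Rates
variable {γ : ℝ} {ν : Measure ℝ} [IsProbabilityMeasure ν]

theorem ClassC.exists_norm_Sn_le (hγ : γ ∈ Ioo (0:ℝ) 1) (hsupp : ν (Icc 0 1) = 1)
    (hac : ν ≪ volume) (hinv : Measure.map (Tmap γ) ν = ν) {M : ℝ} {p : ℝ≥0∞} {f : ℝ → ℝ}
    (hf : ClassC M p ν f) {q θ : ℝ} (hq : 2 ≤ q) (hqp : ENNReal.ofReal q < p) (hθ : 0 ≤ θ)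
    (hθ' : θ < 2 * (1 / ENNReal.ofReal q - 1 / p).toReal * ((1 - γ) / γ)) :
    ∃ C, 0 ≤ C ∧ ∀ n : ℕ, (∫ x, |Sn γ (fun z => f z - ∫ y, f y ∂ν) n x| ^ q ∂ν) ^ (1 / q)
      ≤ √(C * (n * ∑ k ∈ Finset.range n, ((k:ℝ) + 1) ^ (-θ))) := by
  have hq0 : 0 < q := by linarith
  set e := (1 / ENNReal.ofReal q - 1 / p).toReal
  set κ := (1 - γ) / γ with hκ
  have hκ0 : 0 < κ := div_pos (by linarith [hγ.2]) hγ.1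
  have h1 : θ / (2 * κ) < e := by rw [div_lt_iff₀ (by positivity)]; linarith
  have h0 : 0 ≤ θ / (2 * κ) := by positivity
  obtain ⟨s, hqs, hsp, hs⟩ := exists_exponent (e := (e + θ / (2 * κ)) / 2) hq0 hqp (by linarith)
    (show _ < e by linarith)
  have h2 : θ < 2 * (1 / q - 1 / s) * κ := by
    rw [hs]
    have : θ = θ / (2 * κ) * (2 * κ) := by field_simp
    nlinarith
  obtain ⟨C, hC, h⟩ := hf.exists_moment_Sn_le hγ hsupp hac hinv hq hqs hsp hθ h2
  refine ⟨C, hC, fun n => ?_⟩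
  have hX : 0 ≤ C * (n * ∑ k ∈ Finset.range n, ((k:ℝ) + 1) ^ (-θ)) :=
    mul_nonneg hC (mul_nonneg (Nat.cast_nonneg n) (Finset.sum_nonneg fun k _ => by positivity))
  refine (Real.rpow_le_rpow (integral_nonneg fun x => by positivity) (h n)
    (by positivity)).trans (le_of_eq ?_)
  rw [← Real.rpow_mul hX, Real.sqrt_eq_rpow]
  congr 1
  field_simp

end Rates

/-- Corollary 3 of Dedecker–Prieur: for `γ ∈ (0,1)`,
`f ∈ C(M,p,ν_γ)` with `p > 2` and `2 ≤ q < p`, writing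
`e = (p−q)/(pq)` (read as `1/q` when `p = ∞`, which is how
`(1/q − 1/p).toReal` behaves), so that `2(p−q)/(2(p−q)+pq) = 2e/(2e+1)`:
(1) if `γ < 2e/(2e+1)` then `‖S_n(f−ν_γ(f))‖_q = O(√n)`;
(2) if `2e/(2e+1) ≤ γ < 1` then for any `ε > 0`,
`‖S_n(f−ν_γ(f))‖_q = O(n^{1+ε−(1−γ)(p−q)/(γpq)})`. -/
theorem statement17 (γ : ℝ) (hγ : γ ∈ Set.Ioo (0:ℝ) 1)
    (ν : Measure ℝ) [IsProbabilityMeasure ν] (hsupp : ν (Set.Icc 0 1) = 1)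
    (hac : ν ≪ MeasureTheory.volume) (hinv : Measure.map (Tmap γ) ν = ν)
    (M : ℝ) (hM : 0 < M) (p : ℝ≥0∞) (hp : 2 < p)
    (f : ℝ → ℝ) (hf : ClassC M p ν f)
    (q : ℝ) (hq : 2 ≤ q) (hqp : ENNReal.ofReal q < p) :
    (γ < 2 * ((1 / ENNReal.ofReal q - 1 / p).toReal) /
        (2 * ((1 / ENNReal.ofReal q - 1 / p).toReal) + 1) →
      ∃ B : ℝ, ∀ n : ℕ, 1 ≤ n →
        (∫ x, |Sn γ (fun z => f z - ∫ y, f y ∂ν) n x| ^ q ∂ν) ^ (1/q)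
          ≤ B * Real.sqrt n) ∧
    (2 * ((1 / ENNReal.ofReal q - 1 / p).toReal) /
        (2 * ((1 / ENNReal.ofReal q - 1 / p).toReal) + 1) ≤ γ →
      ∀ ε : ℝ, 0 < ε →
      ∃ B : ℝ, ∀ n : ℕ, 1 ≤ n →
        (∫ x, |Sn γ (fun z => f z - ∫ y, f y ∂ν) n x| ^ q ∂ν) ^ (1/q)
          ≤ B * (n : ℝ) ^
            (1 + ε - (1 - γ) * ((1 / ENNReal.ofReal q - 1 / p).toReal) / γ)) := by
  have hbound : ∀ θ : ℝ, 0 ≤ θ →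
      θ < 2 * (1 / ENNReal.ofReal q - 1 / p).toReal * ((1 - γ) / γ) → _ := fun θ hθ hθ' =>
    hf.exists_norm_Sn_le hγ hsupp hac hinv hq hqp hθ hθ'
  have he : 0 < (1 / ENNReal.ofReal q - 1 / p).toReal := by
    refine ENNReal.toReal_pos (tsub_pos_of_lt ?_).ne' ?_
    · rw [one_div, one_div]
      exact ENNReal.inv_lt_inv.2 hqp
    · refine (tsub_le_self.trans_lt ?_).ne
      rw [one_div]
      exact ENNReal.inv_lt_top.2 (ENNReal.ofReal_pos.2 (by linarith))
  set e := (1 / ENNReal.ofReal q - 1 / p).toReal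
  have hγ0 := hγ.1
  have hκ : 2 * e * ((1 - γ) / γ) = 2 * e * (1 - γ) / γ := by ring
  have hκ0 : 0 < 2 * e * ((1 - γ) / γ) := mul_pos (by positivity) (div_pos (by linarith [hγ.2]) hγ0)
  refine ⟨fun h => ?_, fun h ε hε => ?_⟩
  · rw [lt_div_iff₀ (by positivity)] at h
    have h1 : 1 < 2 * e * ((1 - γ) / γ) := by rw [hκ, lt_div_iff₀ hγ0]; linarith
    obtain ⟨C, hC, hn⟩ := hbound ((1 + 2 * e * ((1 - γ) / γ)) / 2) (by linarith) (by linarith)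
    obtain ⟨Z, hZ, hsum⟩ := exists_sum_range_rpow_neg_le
      (by linarith : 1 < (1 + 2 * e * ((1 - γ) / γ)) / 2)
    refine ⟨√(C * Z), fun n _ => (hn n).trans ?_⟩
    rw [← Real.sqrt_mul (by positivity), show C * Z * n = C * (n * Z) by ring]
    gcongr
    exact hsum n
  · rw [div_le_iff₀ (by positivity)] at h
    have h1 : 2 * e * ((1 - γ) / γ) ≤ 1 := by rw [hκ, div_le_iff₀ hγ0]; linarith
    set θ := max 0 (2 * e * ((1 - γ) / γ) - 2 * ε)
    have hθ0 : 0 ≤ θ := le_max_left _ _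
    have hθ1 : 2 * e * ((1 - γ) / γ) - 2 * ε ≤ θ := le_max_right _ _
    have hθ2 : θ < 2 * e * ((1 - γ) / γ) := max_lt hκ0 (by linarith)
    have hθ3 : 0 < 1 - θ := by linarith
    obtain ⟨C, hC, hn⟩ := hbound θ hθ0 hθ2
    refine ⟨√(C / (1 - θ)), fun n hn1 => (hn n).trans ?_⟩
    have hn1' : (1:ℝ) ≤ n := by exact_mod_cast hn1
    have hn0 : (0:ℝ) < n := by linarith
    calc √(C * (n * ∑ k ∈ Finset.range n, ((k:ℝ) + 1) ^ (-θ)))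
        ≤ √(C * (n * ((n:ℝ) ^ (1 - θ) / (1 - θ)))) := by
          gcongr
          exact sum_range_rpow_neg_le hθ0 (by linarith) n
      _ = √(C / (1 - θ)) * (n:ℝ) ^ (1 - θ / 2) := by
          rw [show C * (n * ((n:ℝ) ^ (1 - θ) / (1 - θ))) = C / (1 - θ) * ((n:ℝ) ^ (1 - θ / 2)) ^ 2 by
            rw [← Real.rpow_mul_natCast hn0.le,
              show (1 - θ / 2) * ((2:ℕ):ℝ) = 1 + (1 - θ) by push_cast; ring,
              Real.rpow_add hn0, Real.rpow_one]
            ring, Real.sqrt_mul (by positivity), Real.sqrt_sq (by positivity)]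
      _ ≤ _ := by
          refine mul_le_mul_of_nonneg_left (Real.rpow_le_rpow_of_exponent_le hn1' ?_)
            (Real.sqrt_nonneg _)
          have : (1 - γ) * e / γ = e * ((1 - γ) / γ) := by ring
          linarith

end
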